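/- (Second-order expansion under the per-symbol variance condition.) Suppose that for every x ∈ 𝒳, η²·Var_{Y₁∼W₁(·|x)}(i_{P*,W₁}(x;Y₁)) + (1−η)²·Var_{Y₂∼W₂(·|x)}(i_{P*,W₂}(x;Y₂)) = V, where V = η²V₁ + (1−η)²V₂. Then for every ε ∈ (0, 1/2) there exist a constant K > 0 and an integer n₀ such that for all n ≥ n₀, | log M*_f(n, ε) − ( nC − √(nV)·Q^{−1}(2ε) ) | ≤ K·n^{1/3}·log n. -/

import Mathlib

open Finset

noncomputable section

variable {𝒳 𝒴 : Type*} [Fintype 𝒳] [Fintype 𝒴]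

/-- `P` is a probability distribution on the finite alphabet `𝒳`. -/
def IsDist (P : 𝒳 → ℝ) : Prop := (∀ x, 0 ≤ P x) ∧ ∑ x, P x = 1

/-- The output distribution `PW` induced by input distribution `P` and channel `W`. -/
def outDist (P : 𝒳 → ℝ) (W : 𝒳 → 𝒴 → ℝ) (y : 𝒴) : ℝ := ∑ x, P x * W x y

/-- The mutual information `I(P, W)` (natural logarithm). -/
def mutInfo (P : 𝒳 → ℝ) (W : 𝒳 → 𝒴 → ℝ) : ℝ :=
  ∑ x, ∑ y, P x * W x y * Real.log (W x y / outDist P W y)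

/-- Relative entropy (KL divergence) between two pmfs on a finite alphabet. -/
def relEnt (p q : 𝒴 → ℝ) : ℝ := ∑ y, p y * Real.log (p y / q y)

/-- Directional derivative `∇I_k(v)` of the mutual information at `P*` along `v`. -/
def gradI (Pstar : 𝒳 → ℝ) (W : 𝒳 → 𝒴 → ℝ) (v : 𝒳 → ℝ) : ℝ :=
  ∑ x, v x * relEnt (W x) (outDist Pstar W)

/-- Per-symbol information density `i_{P,W}(x;y)`. -/
def infoDens (P : 𝒳 → ℝ) (W : 𝒳 → 𝒴 → ℝ) (x : 𝒳) (y : 𝒴) : ℝ :=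
  Real.log (W x y / outDist P W y)

/-- Causality of a feedback encoder: the input at time `i` depends on the message and
on the channel outputs at times `< i` only. -/
def Causal (n M : ℕ) (f : Fin M → (Fin n → 𝒴) → (Fin n → 𝒴) → Fin n → 𝒳) : Prop :=
  ∀ (j : Fin M) (y1 y1' y2 y2' : Fin n → 𝒴) (i : Fin n),
    (∀ t, t < i → y1 t = y1' t) → (∀ t, t < i → y2 t = y2' t) →
      f j y1 y2 i = f j y1' y2' i

/-- The joint law `ℙ(j, y₁ⁿ, y₂ⁿ)` induced by an FLF code:
`(1/M) ∏ᵢ W₁(y₁ᵢ | fᵢ(j, y₁^{i-1}, y₂^{i-1})) W₂(y₂ᵢ | fᵢ(j, y₁^{i-1}, y₂^{i-1}))`. -/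
def codeLaw (W1 W2 : 𝒳 → 𝒴 → ℝ) (n M : ℕ)
    (f : Fin M → (Fin n → 𝒴) → (Fin n → 𝒴) → Fin n → 𝒳)
    (j : Fin M) (y1 y2 : Fin n → 𝒴) : ℝ :=
  (1 / M) * ∏ i, (W1 (f j y1 y2 i) (y1 i) * W2 (f j y1 y2 i) (y2 i))

/-- Error probability `ℙ[g(Y₁ⁿ) ≠ J]` at decoder 1. -/
def errProb1 (W1 W2 : 𝒳 → 𝒴 → ℝ) (n M : ℕ)
    (f : Fin M → (Fin n → 𝒴) → (Fin n → 𝒴) → Fin n → 𝒳)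
    (g : (Fin n → 𝒴) → Fin M) : ℝ :=
  ∑ j, ∑ y1 : Fin n → 𝒴, ∑ y2 : Fin n → 𝒴,
    if g y1 = j then 0 else codeLaw W1 W2 n M f j y1 y2

/-- Error probability `ℙ[g(Y₂ⁿ) ≠ J]` at decoder 2. -/
def errProb2 (W1 W2 : 𝒳 → 𝒴 → ℝ) (n M : ℕ)
    (f : Fin M → (Fin n → 𝒴) → (Fin n → 𝒴) → Fin n → 𝒳)
    (g : (Fin n → 𝒴) → Fin M) : ℝ :=
  ∑ j, ∑ y1 : Fin n → 𝒴, ∑ y2 : Fin n → 𝒴,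
    if g y2 = j then 0 else codeLaw W1 W2 n M f j y1 y2

/-- Per-symbol conditional variance `Var_{Y ∼ W(·|x)}(i_{P,W}(x;Y))`. -/
def symbVar (P : 𝒳 → ℝ) (W : 𝒳 → 𝒴 → ℝ) (x : 𝒳) : ℝ :=
  ∑ y, W x y * (infoDens P W x y - ∑ y', W x y' * infoDens P W x y') ^ 2

/-- Conditional information variance `V(P) = Σₓ P(x) Var_{Y∼W(·|x)}(i_{P,W}(x;Y))`. -/
def condInfoVar (P : 𝒳 → ℝ) (W : 𝒳 → 𝒴 → ℝ) : ℝ := ∑ x, P x * symbVar P W x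

/-- Existence of an `(n, M, ε)` fixed-length feedback code. -/
def FLFExists (W1 W2 : 𝒳 → 𝒴 → ℝ) (n M : ℕ) (ε : ℝ) : Prop :=
  ∃ f : Fin M → (Fin n → 𝒴) → (Fin n → 𝒴) → Fin n → 𝒳,
    Causal n M f ∧
      ∃ g1 g2 : (Fin n → 𝒴) → Fin M,
        errProb1 W1 W2 n M f g1 ≤ ε ∧ errProb2 W1 W2 n M f g2 ≤ ε

/-- `M*_f(n, ε)`: the maximum code size of `(n, M, ε)`-FLF codes. -/
noncomputable def MstarF (W1 W2 : 𝒳 → 𝒴 → ℝ) (n : ℕ) (ε : ℝ) : ℕ :=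
  sSup {M | FLFExists W1 W2 n M ε}

/-- The Gaussian tail function `Q(t)`. -/
noncomputable def Qfun (t : ℝ) : ℝ :=
  ∫ u in Set.Ioi t, Real.exp (-u ^ 2 / 2) / Real.sqrt (2 * Real.pi)

/-- The inverse `Q⁻¹` of the Gaussian tail function (on `(0,1)`). -/
noncomputable def Qinv : ℝ → ℝ := Function.invFun Qfun

/-! ### The Gaussian tail function -/

/-- The standard Gaussian density. -/
def gaussDens (u : ℝ) : ℝ := Real.exp (-u ^ 2 / 2) / Real.sqrt (2 * Real.pi)

lemma gaussDens_pos (u : ℝ) : 0 < gaussDens u := by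
  unfold gaussDens; positivity

lemma continuous_gaussDens : Continuous gaussDens := by
  unfold gaussDens; fun_prop

lemma gaussDens_neg (u : ℝ) : gaussDens (-u) = gaussDens u := by
  simp [gaussDens]

lemma integrable_gaussDens : MeasureTheory.Integrable gaussDens := by
  have h := (integrable_exp_neg_mul_sq (b := 1 / 2) (by norm_num)).div_const
    (Real.sqrt (2 * Real.pi))
  refine h.congr (Filter.Eventually.of_forall fun u => ?_)
  simp only [gaussDens]
  congr 2
  ring

lemma integral_gaussDens : ∫ u, gaussDens u = 1 := by
  have h := integral_gaussian (1 / 2)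
  have h2 : ∀ u : ℝ, gaussDens u = Real.exp (-(1 / 2) * u ^ 2) / Real.sqrt (2 * Real.pi) := by
    intro u
    simp only [gaussDens]
    congr 2
    ring
  simp_rw [h2]
  rw [MeasureTheory.integral_div, h]
  have h3 : Real.pi / (1 / 2) = 2 * Real.pi := by ring
  rw [h3]
  exact div_self (by positivity)

lemma Qfun_eq (t : ℝ) : Qfun t = ∫ u in Set.Ioi t, gaussDens u := rfl

lemma Qfun_sub (a b : ℝ) : Qfun b = Qfun a - ∫ u in a..b, gaussDens u := by
  have hi : ∀ c, MeasureTheory.IntegrableOn gaussDens (Set.Ioi c) :=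
    fun c => integrable_gaussDens.integrableOn
  rcases le_total a b with h | h
  · rw [← intervalIntegral.integral_Ioi_sub_Ioi (hi a) h, Qfun_eq, Qfun_eq]
    ring
  · rw [intervalIntegral.integral_symm, ← intervalIntegral.integral_Ioi_sub_Ioi (hi b) h,
      Qfun_eq, Qfun_eq]
    ring

lemma hasDerivAt_Qfun (x : ℝ) : HasDerivAt Qfun (-gaussDens x) x := by
  have h : HasDerivAt (fun u => ∫ t in (0 : ℝ)..u, gaussDens t) (gaussDens x) x :=
    intervalIntegral.integral_hasDerivAt_right
      (continuous_gaussDens.intervalIntegrable _ _)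
      (continuous_gaussDens.stronglyMeasurableAtFilter _ _) continuous_gaussDens.continuousAt
  have h2 := h.const_sub (Qfun 0)
  refine h2.congr_of_eventuallyEq (Filter.Eventually.of_forall fun u => ?_)
  exact Qfun_sub 0 u

lemma Qfun_antitone : Antitone Qfun :=
  antitone_of_deriv_nonpos (fun x => (hasDerivAt_Qfun x).differentiableAt)
    (fun x => by rw [(hasDerivAt_Qfun x).deriv]; linarith [gaussDens_pos x])

lemma Qfun_nonneg (t : ℝ) : 0 ≤ Qfun t :=
  MeasureTheory.integral_nonneg fun u => (gaussDens_pos u).le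

lemma Qfun_neg (t : ℝ) : Qfun (-t) = 1 - Qfun t := by
  have h1 : ∫ u in Set.Iic (-t), gaussDens u = Qfun t := by
    rw [← integral_comp_neg_Ioi]
    simp_rw [gaussDens_neg]
    rfl
  have h2 := MeasureTheory.integral_add_compl (measurableSet_Iic (a := -t)) integrable_gaussDens
  rw [Set.compl_Iic, h1, integral_gaussDens, ← Qfun_eq] at h2
  linarith

lemma Qfun_le_one (t : ℝ) : Qfun t ≤ 1 := by
  have := Qfun_nonneg (-t)
  rw [Qfun_neg] at this
  linarith

lemma gaussDens_le_inv (x : ℝ) : gaussDens x ≤ 1 / (1 + x ^ 2 / 2 + x ^ 4 / 8) := by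
  unfold gaussDens
  have h1 : 1 ≤ Real.sqrt (2 * Real.pi) := by
    rw [Real.one_le_sqrt]
    linarith [Real.pi_gt_three]
  have h2 := Real.quadratic_le_exp_of_nonneg (x := x ^ 2 / 2) (by positivity)
  have h3 : Real.exp (-x ^ 2 / 2) = 1 / Real.exp (x ^ 2 / 2) := by
    rw [one_div, ← Real.exp_neg]
    congr 1
    ring
  calc Real.exp (-x ^ 2 / 2) / Real.sqrt (2 * Real.pi) ≤ Real.exp (-x ^ 2 / 2) / 1 := by
        gcongr
    _ = 1 / Real.exp (x ^ 2 / 2) := by rw [div_one, h3]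
    _ ≤ _ := by
        apply one_div_le_one_div_of_le (by positivity)
        nlinarith

/-- Quartic polynomials times the Gaussian density are bounded. -/
lemma poly_mul_gaussDens_le (x : ℝ) : (1 + x ^ 2 + x ^ 4) * gaussDens x ≤ 8 := by
  have h := gaussDens_le_inv x
  have h2 : 0 ≤ 1 + x ^ 2 + x ^ 4 := by positivity
  calc (1 + x ^ 2 + x ^ 4) * gaussDens x
      ≤ (1 + x ^ 2 + x ^ 4) * (1 / (1 + x ^ 2 / 2 + x ^ 4 / 8)) := by gcongr
    _ ≤ 8 := by
        rw [mul_one_div, div_le_iff₀ (by positivity)]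
        nlinarith [sq_nonneg x, sq_nonneg (x ^ 2)]

lemma Qfun_le_inv {l : ℝ} (hl : 0 < l) : Qfun l ≤ 8 / l := by
  rw [Qfun_eq]
  have hb : ∀ u ∈ Set.Ioi l, gaussDens u ≤ 8 * u ^ (-2 : ℝ) := by
    intro u hu
    have hu0 : 0 < u := hl.trans hu
    rw [Real.rpow_neg hu0.le]
    have h := poly_mul_gaussDens_le u
    have h2 : u ^ (2 : ℝ) = u ^ 2 := by exact_mod_cast Real.rpow_natCast u 2
    rw [h2, ← div_eq_mul_inv, le_div_iff₀ (by positivity)]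
    nlinarith [gaussDens_pos u, sq_nonneg (u ^ 2), mul_nonneg (sq_nonneg (u ^ 2)) (gaussDens_pos u).le]
  have hint : MeasureTheory.IntegrableOn (fun u : ℝ => 8 * u ^ (-2 : ℝ)) (Set.Ioi l) :=
    (integrableOn_Ioi_rpow_of_lt (by norm_num) hl).const_mul 8
  refine (MeasureTheory.setIntegral_mono_on integrable_gaussDens.integrableOn hint
    measurableSet_Ioi hb).trans ?_
  rw [MeasureTheory.integral_const_mul, integral_Ioi_rpow_of_lt (by norm_num) hl]
  have : l ^ (-2 + 1 : ℝ) = l⁻¹ := by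
    rw [show (-2 + 1 : ℝ) = -1 by norm_num, Real.rpow_neg_one]
  rw [this]
  apply le_of_eq
  field_simp
  norm_num

lemma one_sub_Qfun_le_inv {l : ℝ} (hl : 0 < l) : 1 - 8 / l ≤ Qfun (-l) := by
  rw [Qfun_neg]
  linarith [Qfun_le_inv hl]

lemma continuous_Qfun : Continuous Qfun :=
  continuous_iff_continuousAt.2 fun x => (hasDerivAt_Qfun x).continuousAt

lemma Qfun_Qinv {p : ℝ} (hp0 : 0 < p) (hp1 : p < 1) : Qfun (Qinv p) = p := by
  apply Function.invFun_eq
  have h1 : Qfun (8 / p) ≤ p := by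
    have := Qfun_le_inv (l := 8 / p) (by positivity)
    rwa [div_div_cancel₀ (by norm_num)] at this
  have h2 : p ≤ Qfun (-(8 / (1 - p))) := by
    have hq : 0 < 1 - p := by linarith
    have := one_sub_Qfun_le_inv (l := 8 / (1 - p)) (by positivity)
    rw [div_div_cancel₀ (by norm_num)] at this
    linarith
  exact mem_range_of_exists_le_of_exists_ge continuous_Qfun ⟨_, h1⟩ ⟨_, h2⟩

/-- Near any point, `Qfun` decreases at least linearly. -/
lemma exists_Qfun_slope (q : ℝ) : ∃ κ > 0, ∀ s, 0 ≤ s → s ≤ 1 →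
    Qfun (q + s) ≤ Qfun q - κ * s ∧ Qfun q + κ * s ≤ Qfun (q - s) := by
  obtain ⟨x₀, -, hx₀⟩ := (isCompact_Icc (a := q - 1) (b := q + 1)).exists_isMinOn
    (Set.nonempty_Icc.2 (by linarith)) continuous_gaussDens.continuousOn
  refine ⟨gaussDens x₀, gaussDens_pos _, fun s hs0 hs1 => ?_⟩
  have key : ∀ a b, q - 1 ≤ a → a ≤ b → b ≤ q + 1 →
      gaussDens x₀ * (b - a) ≤ Qfun a - Qfun b := by
    intro a b ha hab hb
    rw [Qfun_sub a b, sub_sub_cancel]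
    have := intervalIntegral.integral_mono_on (μ := MeasureTheory.volume) hab
      (intervalIntegrable_const (c := gaussDens x₀))
      (continuous_gaussDens.intervalIntegrable a b)
      (fun x hx => hx₀ (Set.mem_Icc.2 ⟨ha.trans hx.1, hx.2.trans hb⟩))
    rw [intervalIntegral.integral_const, smul_eq_mul] at this
    linarith
  constructor
  · have := key q (q + s) (by linarith) (by linarith) (by linarith)
    rw [add_sub_cancel_left] at this
    linarith
  · have := key (q - s) q (by linarith) (by linarith) (by linarith)
    rw [sub_sub_cancel] at this
    linarith

lemma abs_sub_le_of_deriv_bound {f f' : ℝ → ℝ} {δ C : ℝ}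
    (hd : ∀ t ∈ Set.uIcc 0 δ, HasDerivAt f (f' t) t)
    (hb : ∀ t ∈ Set.uIcc 0 δ, |f' t| ≤ C) : |f δ - f 0| ≤ C * |δ| := by
  have := (convex_uIcc (0 : ℝ) δ).norm_image_sub_le_of_norm_hasDerivWithin_le
    (f := f) (f' := f') (C := C) (fun t ht => (hd t ht).hasDerivWithinAt) hb
    Set.left_mem_uIcc Set.right_mem_uIcc
  simpa [Real.norm_eq_abs] using this

lemma abs_le_of_mem_uIcc {t δ : ℝ} (ht : t ∈ Set.uIcc 0 δ) : |t| ≤ |δ| := by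
  rcases Set.mem_uIcc.1 ht with h | h
  · rw [abs_of_nonneg h.1, abs_of_nonneg (h.1.trans h.2)]; exact h.2
  · rw [abs_of_nonpos h.2, abs_of_nonpos (h.1.trans h.2)]; linarith [h.1]

lemma hasDerivAt_gaussDens (x : ℝ) : HasDerivAt gaussDens (-(x * gaussDens x)) x := by
  have h1 : HasDerivAt (fun u : ℝ => -u ^ 2 / 2) (-x) x := by
    have := ((hasDerivAt_pow 2 x).neg).div_const 2
    refine this.congr_deriv ?_
    norm_num
    ring
  have h2 := (h1.exp).div_const (Real.sqrt (2 * Real.pi))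
  refine h2.congr_deriv ?_
  simp only [gaussDens]
  ring

lemma hasDerivAt_id_mul_gaussDens (x : ℝ) :
    HasDerivAt (fun u => u * gaussDens u) ((1 - x ^ 2) * gaussDens x) x := by
  have := (hasDerivAt_id x).mul (hasDerivAt_gaussDens x)
  refine this.congr_deriv ?_
  simp only [id]
  ring

lemma abs_one_sub_sq_mul_gaussDens_le (x : ℝ) : |(1 - x ^ 2) * gaussDens x| ≤ 8 := by
  have h := poly_mul_gaussDens_le x
  have hg := (gaussDens_pos x).le
  rw [abs_mul, abs_of_nonneg hg]
  refine le_trans (mul_le_mul_of_nonneg_right ?_ hg) h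
  rw [abs_le]
  constructor <;> nlinarith [sq_nonneg x, sq_nonneg (x ^ 2)]

lemma abs_id_mul_gaussDens_le (x : ℝ) : |x * gaussDens x| ≤ 8 := by
  have h := poly_mul_gaussDens_le x
  have hg := (gaussDens_pos x).le
  rw [abs_mul, abs_of_nonneg hg]
  refine le_trans (mul_le_mul_of_nonneg_right ?_ hg) h
  rw [abs_le]
  constructor <;> nlinarith [sq_nonneg (x - 1), sq_nonneg (x + 1), sq_nonneg (x ^ 2)]

lemma gaussDens_taylor (x δ : ℝ) :
    |gaussDens (x + δ) - gaussDens x + x * gaussDens x * δ| ≤ 8 * δ ^ 2 := by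
  have h := abs_sub_le_of_deriv_bound (δ := δ) (C := 8 * |δ|)
    (f := fun t => gaussDens (x + t) + x * gaussDens x * t)
    (f' := fun t => -((x + t) * gaussDens (x + t)) + x * gaussDens x) ?_ ?_
  · simp only [add_zero, mul_zero] at h
    have e : 8 * |δ| * |δ| = 8 * δ ^ 2 := by rw [mul_assoc, abs_mul_abs_self, ← pow_two]
    rw [e] at h
    convert h using 2
    ring
  · intro t _
    have h1 := (hasDerivAt_gaussDens (x + t)).comp_const_add x t
    have h2 := (hasDerivAt_id t).const_mul (x * gaussDens x)
    have h3 := h1.add h2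
    refine h3.congr_deriv ?_
    simp
  · intro t ht
    have h1 := abs_sub_le_of_deriv_bound (δ := t) (C := 8)
      (f := fun u => (x + u) * gaussDens (x + u))
      (f' := fun u => (1 - (x + u) ^ 2) * gaussDens (x + u))
      (fun u _ => (hasDerivAt_id_mul_gaussDens (x + u)).comp_const_add x u)
      (fun u _ => abs_one_sub_sq_mul_gaussDens_le _)
    simp only [add_zero] at h1
    have h2 := abs_le_of_mem_uIcc ht
    calc |-((x + t) * gaussDens (x + t)) + x * gaussDens x|
        = |(x + t) * gaussDens (x + t) - x * gaussDens x| := by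
          rw [← abs_neg]; congr 1; ring
      _ ≤ 8 * |t| := h1
      _ ≤ 8 * |δ| := by gcongr

lemma Qfun_taylor (x δ : ℝ) :
    |Qfun (x + δ) - Qfun x + gaussDens x * δ - x * gaussDens x / 2 * δ ^ 2| ≤ 8 * |δ| ^ 3 := by
  have h := abs_sub_le_of_deriv_bound (δ := δ) (C := 8 * δ ^ 2)
    (f := fun t => Qfun (x + t) + gaussDens x * t - x * gaussDens x / 2 * t ^ 2)
    (f' := fun t => -gaussDens (x + t) + gaussDens x - x * gaussDens x * t) ?_ ?_
  · simp only [add_zero, mul_zero] at h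
    have e : 8 * |δ| ^ 3 = 8 * δ ^ 2 * |δ| := by rw [pow_succ, sq_abs]; ring
    rw [e]
    convert h using 2
    ring
  · intro t _
    have h1 := (hasDerivAt_Qfun (x + t)).comp_const_add x t
    have h2 := (hasDerivAt_id t).const_mul (gaussDens x)
    have h3 := (hasDerivAt_pow 2 t).const_mul (x * gaussDens x / 2)
    refine ((h1.add h2).sub h3).congr_deriv ?_
    simp
    ring
  · intro t ht
    have h1 := gaussDens_taylor x t
    have h2 : t ^ 2 ≤ δ ^ 2 := sq_le_sq.2 (abs_le_of_mem_uIcc ht)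
    calc |-gaussDens (x + t) + gaussDens x - x * gaussDens x * t|
        = |gaussDens (x + t) - gaussDens x + x * gaussDens x * t| := by
          rw [← abs_neg]; congr 1; ring
      _ ≤ 8 * t ^ 2 := h1
      _ ≤ 8 * δ ^ 2 := by gcongr

lemma hasDerivAt_div_sqrt_one_add (x : ℝ) {θ : ℝ} (hθ : 0 ≤ θ) :
    HasDerivAt (fun t => x / Real.sqrt (1 + t))
      (-(x / Real.sqrt (1 + θ)) / (2 * (1 + θ))) θ := by
  have hp : 0 < 1 + θ := by linarith
  have h1 : HasDerivAt (fun t : ℝ => 1 + t) 1 θ := (hasDerivAt_id θ).const_add 1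
  have h2 := h1.sqrt hp.ne'
  have h3 := (hasDerivAt_const θ x).div h2 (Real.sqrt_pos.2 hp).ne'
  refine h3.congr_deriv ?_
  have hs := Real.sq_sqrt hp.le
  have hs0 := Real.sqrt_pos.2 hp
  rw [hs]
  field_simp
  ring

lemma abs_id_mul_gaussDens_sub_le (x : ℝ) {θ : ℝ} (hθ : 0 ≤ θ) :
    |x / Real.sqrt (1 + θ) * gaussDens (x / Real.sqrt (1 + θ)) - x * gaussDens x| ≤ 4 * θ := by
  have h := abs_sub_le_of_deriv_bound (δ := θ) (C := 4)
    (f := fun t => x / Real.sqrt (1 + t) * gaussDens (x / Real.sqrt (1 + t)))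
    (f' := fun t => ((1 - (x / Real.sqrt (1 + t)) ^ 2) * gaussDens (x / Real.sqrt (1 + t))) *
      (-(x / Real.sqrt (1 + t)) / (2 * (1 + t)))) ?_ ?_
  · simpa [abs_of_nonneg hθ] using h
  · intro t ht
    rw [Set.uIcc_of_le hθ] at ht
    exact (hasDerivAt_id_mul_gaussDens _).comp t (hasDerivAt_div_sqrt_one_add x ht.1)
  · intro t ht
    rw [Set.uIcc_of_le hθ] at ht
    set w := x / Real.sqrt (1 + t)
    have h := poly_mul_gaussDens_le w
    have hg := (gaussDens_pos w).le
    have e : |(1 - w ^ 2) * gaussDens w * (-w / (2 * (1 + t)))|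
        = |(1 - w ^ 2) * w| * gaussDens w / (2 * (1 + t)) := by
      rw [abs_mul, abs_mul, abs_mul, abs_div, abs_neg, abs_of_nonneg hg,
        abs_of_nonneg (by linarith [ht.1] : (0 : ℝ) ≤ 2 * (1 + t))]
      ring
    rw [e, div_le_iff₀ (by linarith [ht.1])]
    have h2 : |(1 - w ^ 2) * w| ≤ 1 + w ^ 2 + w ^ 4 := by
      rw [abs_le]
      constructor <;>
        nlinarith [sq_nonneg (w - 1), sq_nonneg (w + 1), sq_nonneg (w ^ 2 - w),
          sq_nonneg (w ^ 2 + w)]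
    have h3 := mul_le_mul_of_nonneg_right h2 hg
    linarith [ht.1]

lemma Qfun_time_taylor (x : ℝ) {θ : ℝ} (hθ : 0 ≤ θ) :
    |Qfun (x / Real.sqrt (1 + θ)) - Qfun x - x * gaussDens x / 2 * θ| ≤ 6 * θ ^ 2 := by
  have h := abs_sub_le_of_deriv_bound (δ := θ) (C := 6 * θ)
    (f := fun t => Qfun (x / Real.sqrt (1 + t)) - x * gaussDens x / 2 * t)
    (f' := fun t => -gaussDens (x / Real.sqrt (1 + t)) *
      (-(x / Real.sqrt (1 + t)) / (2 * (1 + t))) - x * gaussDens x / 2) ?_ ?_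
  · simp only [add_zero, Real.sqrt_one, div_one, mul_zero, sub_zero, abs_of_nonneg hθ] at h
    rw [mul_assoc, ← pow_two] at h
    convert h using 2
    ring
  · intro t ht
    rw [Set.uIcc_of_le hθ] at ht
    have h1 := (hasDerivAt_Qfun _).comp t (hasDerivAt_div_sqrt_one_add x ht.1)
    have h2 := (hasDerivAt_id t).const_mul (x * gaussDens x / 2)
    refine (h1.sub h2).congr_deriv ?_
    simp
  · intro t ht
    rw [Set.uIcc_of_le hθ] at ht
    have h1 := abs_id_mul_gaussDens_sub_le x ht.1
    set w := x / Real.sqrt (1 + t)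
    have hp : 0 < 1 + t := by linarith [ht.1]
    have e : -gaussDens w * (-w / (2 * (1 + t))) - x * gaussDens x / 2
        = ((w * gaussDens w - x * gaussDens x) / 2 - x * gaussDens x / 2 * t) / (1 + t) := by
      field_simp
      ring
    rw [e, abs_div, abs_of_pos hp, div_le_iff₀ hp]
    have h3 := abs_id_mul_gaussDens_le x
    have h4 : |(w * gaussDens w - x * gaussDens x) / 2 - x * gaussDens x / 2 * t|
        ≤ 2 * t + 4 * t := by
      refine (abs_sub _ _).trans (add_le_add ?_ ?_)
      · rw [abs_div, abs_two]; linarith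
      · rw [abs_mul, abs_div, abs_two, abs_of_nonneg ht.1]
        nlinarith [ht.1]
    nlinarith [ht.1, ht.2, mul_nonneg hθ ht.1]

/-- One Lindeberg replacement step for the heat-flow smoothing of the Gaussian tail. -/
lemma lindeberg_step {Ω : Type*} [Fintype Ω] {V B : ℝ} (hV : 0 < V) (hB : 0 ≤ B) :
    ∃ K > 0, ∀ (p ξ : Ω → ℝ), IsDist p → ∑ w, p w * ξ w = 0 → ∑ w, p w * ξ w ^ 2 = V →
      (∀ w, p w ≠ 0 → |ξ w| ≤ B) → ∀ τ, 1 ≤ τ → ∀ s,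
      |∑ w, p w * Qfun ((s + ξ w) / Real.sqrt τ) - Qfun (s / Real.sqrt (τ + V))|
        ≤ K * (1 / Real.sqrt τ - 1 / Real.sqrt (τ + V)) := by
  refine ⟨(8 * B ^ 3 + 6 * V ^ 2) * (2 * (1 + V) / V), by positivity, ?_⟩
  intro p ξ hp hmean hvar hb τ hτ s
  have hτ0 : 0 < τ := by linarith
  set r := Real.sqrt τ with hr
  have hr1 : 1 ≤ r := Real.one_le_sqrt.2 hτ
  have hr0 : 0 < r := by linarith
  have hr2 : r ^ 2 = τ := Real.sq_sqrt hτ0.le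
  set x := s / r
  set g := 1 / r with hg
  have hg0 : 0 < g := by positivity
  have hg1 : g ≤ 1 := by rw [hg, div_le_one hr0]; exact hr1
  have h1 : |∑ w, p w * Qfun ((s + ξ w) / r) - (Qfun x + x * gaussDens x / 2 * (g ^ 2 * V))|
      ≤ 8 * (g ^ 3 * B ^ 3) := by
    have e : ∑ w, p w * Qfun ((s + ξ w) / r) - (Qfun x + x * gaussDens x / 2 * (g ^ 2 * V))
        = ∑ w, p w * (Qfun (x + g * ξ w) - Qfun x + gaussDens x * (g * ξ w)
          - x * gaussDens x / 2 * (g * ξ w) ^ 2) := by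
      have e1 : ∀ w, p w * (Qfun (x + g * ξ w) - Qfun x + gaussDens x * (g * ξ w)
          - x * gaussDens x / 2 * (g * ξ w) ^ 2) = p w * Qfun ((s + ξ w) / r)
            - p w * Qfun x + gaussDens x * g * (p w * ξ w)
            - x * gaussDens x / 2 * g ^ 2 * (p w * ξ w ^ 2) := by
        intro w
        have : (s + ξ w) / r = x + g * ξ w := by simp only [x, g]; ring
        rw [this]; ring
      simp_rw [e1]
      rw [sum_sub_distrib, sum_add_distrib, sum_sub_distrib, ← sum_mul, ← mul_sum, ← mul_sum,
        hp.2, hmean, hvar]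
      ring
    rw [e]
    refine (abs_sum_le_sum_abs _ _).trans ?_
    calc ∑ w, |p w * (Qfun (x + g * ξ w) - Qfun x + gaussDens x * (g * ξ w)
          - x * gaussDens x / 2 * (g * ξ w) ^ 2)|
        ≤ ∑ w, p w * (8 * (g ^ 3 * B ^ 3)) := by
          refine sum_le_sum fun w _ => ?_
          rw [abs_mul, abs_of_nonneg (hp.1 w)]
          by_cases hw : p w = 0
          · simp [hw]
          refine mul_le_mul_of_nonneg_left ((Qfun_taylor x (g * ξ w)).trans ?_) (hp.1 w)
          rw [abs_mul, abs_of_pos hg0, mul_pow]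
          have := hb w hw
          gcongr
      _ = 8 * (g ^ 3 * B ^ 3) := by rw [← sum_mul, hp.2, one_mul]
  have h2 : |Qfun (s / Real.sqrt (τ + V)) - (Qfun x + x * gaussDens x / 2 * (g ^ 2 * V))|
      ≤ 6 * (g ^ 2 * V) ^ 2 := by
    have := Qfun_time_taylor x (θ := g ^ 2 * V) (by positivity)
    have e : x / Real.sqrt (1 + g ^ 2 * V) = s / Real.sqrt (τ + V) := by
      have : τ + V = r ^ 2 * (1 + g ^ 2 * V) := by
        rw [hg, ← hr2]; field_simp
      rw [this, Real.sqrt_mul (by positivity), Real.sqrt_sq hr0.le]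
      simp only [x]
      rw [div_div]
    rw [e] at this
    convert this using 2
    ring
  have h3 : |∑ w, p w * Qfun ((s + ξ w) / r) - Qfun (s / Real.sqrt (τ + V))|
      ≤ (8 * B ^ 3 + 6 * V ^ 2) * g ^ 3 := by
    have ht := abs_sub_le (∑ w, p w * Qfun ((s + ξ w) / r))
      (Qfun x + x * gaussDens x / 2 * (g ^ 2 * V)) (Qfun (s / Real.sqrt (τ + V)))
    rw [abs_sub_comm (Qfun (s / Real.sqrt (τ + V))) (Qfun x + _)] at h2
    have h4 : (g ^ 2 * V) ^ 2 ≤ g ^ 3 * V ^ 2 := by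
      have : g ^ 4 ≤ g ^ 3 := pow_le_pow_of_le_one hg0.le hg1 (by norm_num)
      nlinarith [sq_nonneg V]
    nlinarith
  refine h3.trans ?_
  rw [mul_assoc]
  refine mul_le_mul_of_nonneg_left ?_ (by positivity)
  set q := Real.sqrt (τ + V) with hq
  have hq2 : q ^ 2 = τ + V := Real.sq_sqrt (by linarith)
  have hq0 : 0 < q := Real.sqrt_pos.2 (by linarith)
  have hrq : r ≤ q := Real.sqrt_le_sqrt (by linarith)
  have hqq : q ^ 2 ≤ (1 + V) * r ^ 2 := by rw [hq2, hr2]; nlinarith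
  have e : 1 / r - 1 / q = V / (r * q * (r + q)) := by
    rw [eq_div_iff (by positivity)]
    field_simp
    nlinarith
  rw [e, hg]
  have e2 : 2 * (1 + V) / V * (V / (r * q * (r + q))) = 2 * (1 + V) / (r * q * (r + q)) := by
    field_simp
  rw [e2, div_pow, one_pow, div_le_div_iff₀ (by positivity) (by positivity)]
  have : q * (r + q) ≤ 2 * q ^ 2 := by nlinarith
  calc 1 * (r * q * (r + q)) = r * (q * (r + q)) := by ring
    _ ≤ r * (2 * ((1 + V) * r ^ 2)) := mul_le_mul_of_nonneg_left (by linarith) hr0.le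
    _ = 2 * (1 + V) * r ^ 3 := by ring

/-! ### Sums over causal strategies -/

section Strategies

variable {α β γ : Type*}

/-- The input at time `i` depends only on the two output sequences before time `i`. -/
def CausalStrategy {n : ℕ} (f : (Fin n → α) → (Fin n → β) → Fin n → γ) : Prop :=
  ∀ (y1 y1' : Fin n → α) (y2 y2' : Fin n → β) (i : Fin n),
    (∀ t, t < i → y1 t = y1' t) → (∀ t, t < i → y2 t = y2' t) → f y1 y2 i = f y1' y2' i

lemma CausalStrategy.tail {n : ℕ} {f : (Fin (n + 1) → α) → (Fin (n + 1) → β) → Fin (n + 1) → γ}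
    (hf : CausalStrategy f) (a : α) (b : β) :
    CausalStrategy (fun (y1 : Fin n → α) (y2 : Fin n → β) (i : Fin n) =>
      f (Fin.cons a y1) (Fin.cons b y2) i.succ) := by
  intro y1 y1' y2 y2' i h1 h2
  apply hf
  · intro t ht
    induction t using Fin.cases with
    | zero => rfl
    | succ t => simpa using h1 t (Fin.succ_lt_succ_iff.1 ht)
  · intro t ht
    induction t using Fin.cases with
    | zero => rfl
    | succ t => simpa using h2 t (Fin.succ_lt_succ_iff.1 ht)

lemma CausalStrategy.zero_eq {n : ℕ}
    {f : (Fin (n + 1) → α) → (Fin (n + 1) → β) → Fin (n + 1) → γ}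
    (hf : CausalStrategy f) (y1 y1' : Fin (n + 1) → α) (y2 y2' : Fin (n + 1) → β) :
    f y1 y2 0 = f y1' y2' 0 :=
  hf _ _ _ _ 0 (fun t ht => absurd ht (Fin.not_lt_zero t)) (fun t ht => absurd ht (Fin.not_lt_zero t))

variable [Fintype α] [Fintype β]

lemma sum_fin_succ_fun {n : ℕ} (F : (Fin (n + 1) → α) → ℝ) :
    ∑ y, F y = ∑ a, ∑ y : Fin n → α, F (Fin.cons a y) := by
  rw [← (Fin.consEquiv fun _ : Fin (n + 1) => α).sum_comp F, Fintype.sum_prod_type]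
  rfl

/-- Conditioning on the first pair of outputs. -/
lemma CausalStrategy.sum_succ [Nonempty α] [Nonempty β] {n : ℕ}
    {f : (Fin (n + 1) → α) → (Fin (n + 1) → β) → Fin (n + 1) → γ}
    (hf : CausalStrategy f) (w : γ → α → β → ℝ) (ξ : γ → α → β → ℝ) :
    ∃ x₀, ∀ F : ℝ → ℝ, ∑ y1, ∑ y2, (∏ i, w (f y1 y2 i) (y1 i) (y2 i)) *
          F (∑ i, ξ (f y1 y2 i) (y1 i) (y2 i))
      = ∑ a, ∑ b, w x₀ a b * ∑ y1 : Fin n → α, ∑ y2 : Fin n → β,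
          (∏ i, w (f (Fin.cons a y1) (Fin.cons b y2) i.succ) (y1 i) (y2 i)) *
          F (ξ x₀ a b + ∑ i, ξ (f (Fin.cons a y1) (Fin.cons b y2) i.succ) (y1 i) (y2 i)) := by
  obtain ⟨a₀⟩ := ‹Nonempty α›
  obtain ⟨b₀⟩ := ‹Nonempty β›
  refine ⟨f (fun _ => a₀) (fun _ => b₀) 0, fun F => ?_⟩
  rw [sum_fin_succ_fun]
  refine sum_congr rfl fun a _ => ?_
  simp_rw [sum_fin_succ_fun (α := β)]
  rw [sum_comm]
  refine sum_congr rfl fun b _ => ?_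
  rw [mul_sum]
  refine sum_congr rfl fun y1 _ => ?_
  rw [mul_sum]
  refine sum_congr rfl fun y2 _ => ?_
  rw [Fin.prod_univ_succ, Fin.sum_univ_succ,
    hf.zero_eq (Fin.cons a y1) (fun _ => a₀) (Fin.cons b y2) (fun _ => b₀)]
  simp only [Fin.cons_zero, Fin.cons_succ, mul_assoc]

lemma CausalStrategy.sum_law [Nonempty α] [Nonempty β] {w : γ → α → β → ℝ}
    (hw : ∀ x, ∑ a, ∑ b, w x a b = 1) {n : ℕ} :
    ∀ {f : (Fin n → α) → (Fin n → β) → Fin n → γ}, CausalStrategy f →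
    ∑ y1, ∑ y2, ∏ i, w (f y1 y2 i) (y1 i) (y2 i) = 1 := by
  induction n with
  | zero => intro f _; simp
  | succ n ih =>
    intro f hf
    obtain ⟨x₀, h⟩ := hf.sum_succ w (fun _ _ _ => 0)
    have h1 := h (fun _ => 1)
    simp only [mul_one] at h1
    rw [h1, ← hw x₀]
    refine sum_congr rfl fun a _ => sum_congr rfl fun b _ => ?_
    rw [ih (hf.tail a b), mul_one]

/-- Martingale Berry–Esseen estimate (smoothed): the sum of the centred increments of constant
conditional variance `V` along a causal strategy is compared with a Gaussian. -/
lemma CausalStrategy.lindeberg [Nonempty α] [Nonempty β] {V B : ℝ} (hV : 0 < V) (hB : 0 ≤ B) :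
    ∃ K > 0, ∀ (w ξ : γ → α → β → ℝ), (∀ x a b, 0 ≤ w x a b) →
      (∀ x, ∑ a, ∑ b, w x a b = 1) → (∀ x, ∑ a, ∑ b, w x a b * ξ x a b = 0) →
      (∀ x, ∑ a, ∑ b, w x a b * ξ x a b ^ 2 = V) → (∀ x a b, w x a b ≠ 0 → |ξ x a b| ≤ B) →
      ∀ τ, 1 ≤ τ → ∀ (n : ℕ) (f : (Fin n → α) → (Fin n → β) → Fin n → γ), CausalStrategy f →
      ∀ s, |∑ y1, ∑ y2, (∏ i, w (f y1 y2 i) (y1 i) (y2 i)) *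
          Qfun ((s + ∑ i, ξ (f y1 y2 i) (y1 i) (y2 i)) / Real.sqrt τ)
          - Qfun (s / Real.sqrt (τ + n * V))|
        ≤ K * (1 / Real.sqrt τ - 1 / Real.sqrt (τ + n * V)) := by
  obtain ⟨K, hK, hstep⟩ := lindeberg_step (Ω := α × β) hV hB
  refine ⟨K, hK, ?_⟩
  intro w ξ hw0 hw1 hmean hvar hb τ hτ n
  induction n with
  | zero => intro f _ s; simp
  | succ n ih =>
    intro f hf s
    obtain ⟨x₀, h⟩ := hf.sum_succ w ξ
    rw [h (fun z => Qfun ((s + z) / Real.sqrt τ))]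
    have hτn : 1 ≤ τ + n * V := by
      have : 0 ≤ (n : ℝ) * V := by positivity
      linarith
    have h1 := hstep (fun z => w x₀ z.1 z.2) (fun z => ξ x₀ z.1 z.2)
      ⟨fun z => hw0 _ _ _, by rw [Fintype.sum_prod_type]; exact hw1 x₀⟩
      (by rw [Fintype.sum_prod_type]; exact hmean x₀)
      (by rw [Fintype.sum_prod_type]; exact hvar x₀)
      (fun z hz => hb _ _ _ hz) (τ + n * V) hτn s
    have e : τ + n * V + V = τ + ((n + 1 : ℕ) : ℝ) * V := by push_cast; ring
    rw [e, Fintype.sum_prod_type] at h1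
    set R := Qfun (s / Real.sqrt (τ + ((n + 1 : ℕ) : ℝ) * V))
    set D := K * (1 / Real.sqrt τ - 1 / Real.sqrt (τ + n * V)) with hD
    have h2 : |∑ a, ∑ b, w x₀ a b * (∑ y1 : Fin n → α, ∑ y2 : Fin n → β,
          (∏ i, w (f (Fin.cons a y1) (Fin.cons b y2) i.succ) (y1 i) (y2 i)) *
          Qfun ((s + (ξ x₀ a b + ∑ i, ξ (f (Fin.cons a y1) (Fin.cons b y2) i.succ) (y1 i) (y2 i)))
            / Real.sqrt τ)) - ∑ a, ∑ b, w x₀ a b * Qfun ((s + ξ x₀ a b) / Real.sqrt (τ + n * V))|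
        ≤ D := by
      rw [← sum_sub_distrib]
      simp_rw [← sum_sub_distrib, ← mul_sub]
      calc _ ≤ ∑ a, ∑ b, w x₀ a b * D := by
            refine (abs_sum_le_sum_abs _ _).trans (sum_le_sum fun a _ => ?_)
            refine (abs_sum_le_sum_abs _ _).trans (sum_le_sum fun b _ => ?_)
            rw [abs_mul, abs_of_nonneg (hw0 _ _ _)]
            refine mul_le_mul_of_nonneg_left ?_ (hw0 _ _ _)
            have := ih _ (hf.tail a b) (s + ξ x₀ a b)
            simp only [add_assoc] at this ⊢
            exact this
        _ = D := by
            simp_rw [← sum_mul]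
            rw [hw1, one_mul]
    have h3 := (abs_sub_le _ _ R).trans (add_le_add h2 h1)
    refine h3.trans (le_of_eq ?_)
    rw [hD]
    ring

/-- Summing out the second output sequence of a causal strategy. -/
lemma sum_prod_causal_eq_one [Nonempty β] {w : γ → β → ℝ} (hw : ∀ x, ∑ b, w x b = 1) {n : ℕ} :
    ∀ {g : (Fin n → β) → Fin n → γ},
      (∀ y y' i, (∀ t, t < i → y t = y' t) → g y i = g y' i) →
      ∑ y, ∏ i, w (g y i) (y i) = 1 := by
  induction n with
  | zero => intro g _; simp
  | succ n ih =>
    intro g hg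
    rw [sum_fin_succ_fun]
    obtain ⟨b₀⟩ := ‹Nonempty β›
    rw [← hw (g (fun _ => b₀) 0)]
    refine sum_congr rfl fun b _ => ?_
    have h0 : ∀ y, g (Fin.cons b y) 0 = g (fun _ => b₀) 0 :=
      fun y => hg _ _ 0 fun t ht => absurd ht (Fin.not_lt_zero t)
    simp_rw [Fin.prod_univ_succ, Fin.cons_zero, Fin.cons_succ, h0]
    rw [← mul_sum, ih, mul_one]
    intro y y' i h
    apply hg
    intro t ht
    induction t using Fin.cases with
    | zero => rfl
    | succ t => simpa using h t (Fin.succ_lt_succ_iff.1 ht)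

end Strategies

/-- The distribution function of the sum of increments along a causal strategy is sandwiched
between smoothed Gaussian distribution functions. -/
lemma CausalStrategy.cdf_bounds {α β γ : Type*} [Fintype α] [Fintype β]
    [Nonempty α] [Nonempty β] {V B : ℝ} (hV : 0 < V) (hB : 0 ≤ B) :
    ∃ K > 0, ∀ (w ξ : γ → α → β → ℝ), (∀ x a b, 0 ≤ w x a b) →
      (∀ x, ∑ a, ∑ b, w x a b = 1) → (∀ x, ∑ a, ∑ b, w x a b * ξ x a b = 0) →
      (∀ x, ∑ a, ∑ b, w x a b * ξ x a b ^ 2 = V) → (∀ x a b, w x a b ≠ 0 → |ξ x a b| ≤ B) →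
      ∀ h, 1 ≤ h → ∀ (n : ℕ) (f : (Fin n → α) → (Fin n → β) → Fin n → γ), CausalStrategy f →
      ∀ t : ℝ,
        Qfun ((h ^ 2 - t) / Real.sqrt (h ^ 2 + n * V)) - K / h ≤
          ∑ y1, ∑ y2, (∏ i, w (f y1 y2 i) (y1 i) (y2 i)) *
            (if ∑ i, ξ (f y1 y2 i) (y1 i) (y2 i) ≤ t then 1 else 0) ∧
        ∑ y1, ∑ y2, (∏ i, w (f y1 y2 i) (y1 i) (y2 i)) *
            (if ∑ i, ξ (f y1 y2 i) (y1 i) (y2 i) ≤ t then 1 else 0) ≤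
          Qfun ((-h ^ 2 - t) / Real.sqrt (h ^ 2 + n * V)) + K / h := by
  obtain ⟨K, hK, hL⟩ := CausalStrategy.lindeberg (α := α) (β := β) (γ := γ) hV hB
  refine ⟨K + 8, by linarith, ?_⟩
  intro w ξ hw0 hw1 hmean hvar hb h hh n f hf t
  have hh0 : 0 < h := by linarith
  have hsq : Real.sqrt (h ^ 2) = h := Real.sqrt_sq hh0.le
  have hL1 := fun s => hL w ξ hw0 hw1 hmean hvar hb (h ^ 2) (by nlinarith) n f hf s
  rw [hsq] at hL1
  have hpos : 0 ≤ 1 / Real.sqrt (h ^ 2 + n * V) := by positivity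
  have hKh : K * (1 / h - 1 / Real.sqrt (h ^ 2 + n * V)) ≤ K / h := by
    rw [mul_sub, mul_one_div]
    have := mul_nonneg hK.le hpos
    linarith
  have hlaw := CausalStrategy.sum_law hw1 hf
  have hL0 : ∀ y1 y2, 0 ≤ ∏ i, w (f y1 y2 i) (y1 i) (y2 i) :=
    fun y1 y2 => prod_nonneg fun i _ => hw0 _ _ _
  have h8 : 0 ≤ 8 / h := by positivity
  rw [add_div]
  constructor
  · have h1 := (abs_le.1 ((hL1 (h ^ 2 - t)).trans hKh)).1
    have h2 : ∑ y1, ∑ y2, (∏ i, w (f y1 y2 i) (y1 i) (y2 i)) *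
          Qfun ((h ^ 2 - t + ∑ i, ξ (f y1 y2 i) (y1 i) (y2 i)) / h)
        ≤ ∑ y1, ∑ y2, (∏ i, w (f y1 y2 i) (y1 i) (y2 i)) *
            (if ∑ i, ξ (f y1 y2 i) (y1 i) (y2 i) ≤ t then 1 else 0)
          + ∑ y1, ∑ y2, (∏ i, w (f y1 y2 i) (y1 i) (y2 i)) * (8 / h) := by
      simp_rw [← sum_add_distrib, ← mul_add]
      refine sum_le_sum fun y1 _ => sum_le_sum fun y2 _ =>
        mul_le_mul_of_nonneg_left ?_ (hL0 y1 y2)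
      split_ifs with hs
      · linarith [Qfun_le_one ((h ^ 2 - t + ∑ i, ξ (f y1 y2 i) (y1 i) (y2 i)) / h)]
      · rw [zero_add]
        refine (Qfun_antitone ?_).trans (Qfun_le_inv hh0)
        rw [le_div_iff₀ hh0]
        push Not at hs
        nlinarith
    simp_rw [← sum_mul] at h2
    rw [hlaw] at h2
    linarith
  · have h1 := (abs_le.1 ((hL1 (-h ^ 2 - t)).trans hKh)).2
    have h2 : ∑ y1, ∑ y2, (∏ i, w (f y1 y2 i) (y1 i) (y2 i)) *
            (if ∑ i, ξ (f y1 y2 i) (y1 i) (y2 i) ≤ t then 1 else 0)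
        ≤ ∑ y1, ∑ y2, (∏ i, w (f y1 y2 i) (y1 i) (y2 i)) *
          Qfun ((-h ^ 2 - t + ∑ i, ξ (f y1 y2 i) (y1 i) (y2 i)) / h)
          + ∑ y1, ∑ y2, (∏ i, w (f y1 y2 i) (y1 i) (y2 i)) * (8 / h) := by
      simp_rw [← sum_add_distrib, ← mul_add]
      refine sum_le_sum fun y1 _ => sum_le_sum fun y2 _ =>
        mul_le_mul_of_nonneg_left ?_ (hL0 y1 y2)
      split_ifs with hs
      · have h3 := one_sub_Qfun_le_inv hh0
        have h4 : Qfun (-h) ≤ Qfun ((-h ^ 2 - t + ∑ i, ξ (f y1 y2 i) (y1 i) (y2 i)) / h) := by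
          apply Qfun_antitone
          rw [div_le_iff₀ hh0]
          nlinarith
        linarith
      · linarith [Qfun_nonneg ((-h ^ 2 - t + ∑ i, ξ (f y1 y2 i) (y1 i) (y2 i)) / h)]
    simp_rw [← sum_mul] at h2
    rw [hlaw] at h2
    linarith

/-! ### Elementary facts on channels -/

/-- `W` is a channel: each row is a probability distribution. -/
def IsChannel (W : 𝒳 → 𝒴 → ℝ) : Prop := ∀ x, IsDist (W x)

lemma IsChannel.outDist_nonneg {W : 𝒳 → 𝒴 → ℝ} (hW : IsChannel W) {P : 𝒳 → ℝ}
    (hP : ∀ x, 0 < P x) (y : 𝒴) : 0 ≤ outDist P W y :=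
  sum_nonneg fun x _ => mul_nonneg (hP x).le ((hW x).1 y)

lemma IsChannel.sum_outDist {W : 𝒳 → 𝒴 → ℝ} (hW : IsChannel W) {P : 𝒳 → ℝ}
    (hP : ∑ x, P x = 1) : ∑ y, outDist P W y = 1 := by
  unfold outDist
  rw [sum_comm]
  simp_rw [← mul_sum, (hW _).2, mul_one]
  exact hP

lemma IsChannel.mul_le_outDist {W : 𝒳 → 𝒴 → ℝ} (hW : IsChannel W) {P : 𝒳 → ℝ}
    (hP : ∀ x, 0 < P x) (x : 𝒳) (y : 𝒴) : P x * W x y ≤ outDist P W y :=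
  single_le_sum (f := fun x => P x * W x y)
    (fun x _ => mul_nonneg (hP x).le ((hW x).1 y)) (mem_univ x)

lemma IsChannel.outDist_pos {W : 𝒳 → 𝒴 → ℝ} (hW : IsChannel W) {P : 𝒳 → ℝ}
    (hP : ∀ x, 0 < P x) {x : 𝒳} {y : 𝒴} (h : W x y ≠ 0) : 0 < outDist P W y :=
  lt_of_lt_of_le (mul_pos (hP x) (lt_of_le_of_ne ((hW x).1 y) h.symm)) (hW.mul_le_outDist hP x y)

/-- Change of measure from the channel to its output distribution. -/
lemma IsChannel.eq_outDist_mul_exp {W : 𝒳 → 𝒴 → ℝ} (hW : IsChannel W) {P : 𝒳 → ℝ}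
    (hP : ∀ x, 0 < P x) {x : 𝒳} {y : 𝒴} (h : W x y ≠ 0) :
    W x y = outDist P W y * Real.exp (infoDens P W x y) := by
  have hq := hW.outDist_pos hP h
  have hw : 0 < W x y := lt_of_le_of_ne ((hW x).1 y) h.symm
  rw [infoDens, Real.exp_log (div_pos hw hq)]
  field_simp

lemma IsChannel.prod_eq {W : 𝒳 → 𝒴 → ℝ} (hW : IsChannel W) {P : 𝒳 → ℝ}
    (hP : ∀ x, 0 < P x) {n : ℕ} {x : Fin n → 𝒳} {y : Fin n → 𝒴} (h : ∀ i, W (x i) (y i) ≠ 0) :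
    ∏ i, W (x i) (y i)
      = (∏ i, outDist P W (y i)) * Real.exp (∑ i, infoDens P W (x i) (y i)) := by
  rw [Real.exp_sum, ← prod_mul_distrib]
  exact prod_congr rfl fun i _ => hW.eq_outDist_mul_exp hP (h i)

lemma IsChannel.prod_le {W : 𝒳 → 𝒴 → ℝ} (hW : IsChannel W) {P : 𝒳 → ℝ}
    (hP : ∀ x, 0 < P x) {n : ℕ} {x : Fin n → 𝒳} {y : Fin n → 𝒴} {θ : ℝ}
    (hθ : ∑ i, infoDens P W (x i) (y i) ≤ θ) :
    ∏ i, W (x i) (y i) ≤ Real.exp θ * ∏ i, outDist P W (y i) := by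
  have hq : 0 ≤ ∏ i, outDist P W (y i) := prod_nonneg fun i _ => hW.outDist_nonneg hP _
  by_cases h : ∀ i, W (x i) (y i) ≠ 0
  · rw [hW.prod_eq hP h, mul_comm]
    gcongr
  · push Not at h
    obtain ⟨i, hi⟩ := h
    rw [prod_eq_zero (mem_univ i) hi]
    positivity

lemma sum_prod_outDist {W : 𝒳 → 𝒴 → ℝ} (hW : IsChannel W) {P : 𝒳 → ℝ}
    (hP : ∑ x, P x = 1) (n : ℕ) : ∑ y : Fin n → 𝒴, ∏ i, outDist P W (y i) = 1 := by
  have h := Fintype.sum_pow (outDist P W) n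
  rw [hW.sum_outDist hP, one_pow] at h
  exact h.symm

/-! ### Converse -/

/-- Verdú–Han type converse for the first decoder in the presence of feedback. -/
lemma verdu_han {W1 W2 : 𝒳 → 𝒴 → ℝ} (hW1 : IsChannel W1) (hW2 : IsChannel W2)
    [Nonempty 𝒴] {P : 𝒳 → ℝ} (hP : ∀ x, 0 < P x) (hP1 : ∑ x, P x = 1) {n M : ℕ}
    {f : Fin M → (Fin n → 𝒴) → (Fin n → 𝒴) → Fin n → 𝒳} (hf : Causal n M f)
    (g : (Fin n → 𝒴) → Fin M) (θ : ℝ) :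
    ∑ j, ∑ y1, ∑ y2, codeLaw W1 W2 n M f j y1 y2 *
        (if ∑ i, infoDens P W1 (f j y1 y2 i) (y1 i) ≤ θ then 1 else 0)
      ≤ errProb1 W1 W2 n M f g + Real.exp θ / M := by
  have hM : (0 : ℝ) ≤ 1 / M := by positivity
  have hlaw0 : ∀ j y1 y2, 0 ≤ codeLaw W1 W2 n M f j y1 y2 := fun j y1 y2 =>
    mul_nonneg hM (prod_nonneg fun i _ => mul_nonneg ((hW1 _).1 _) ((hW2 _).1 _))
  have key : ∀ j y1 y2, codeLaw W1 W2 n M f j y1 y2 *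
        (if ∑ i, infoDens P W1 (f j y1 y2 i) (y1 i) ≤ θ then 1 else 0)
      ≤ (if g y1 = j then 0 else codeLaw W1 W2 n M f j y1 y2)
        + (if g y1 = j then Real.exp θ / M * ∏ i, outDist P W1 (y1 i) else 0) *
          ∏ i, W2 (f j y1 y2 i) (y2 i) := by
    intro j y1 y2
    have h2 : 0 ≤ ∏ i, W2 (f j y1 y2 i) (y2 i) := prod_nonneg fun i _ => (hW2 _).1 _
    have hq : 0 ≤ ∏ i, outDist P W1 (y1 i) := prod_nonneg fun i _ => hW1.outDist_nonneg hP _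
    by_cases hg : g y1 = j
    · simp only [hg, if_true, zero_add]
      split_ifs with hs
      · rw [mul_one, codeLaw, prod_mul_distrib]
        have := hW1.prod_le hP hs
        calc 1 / (M : ℝ) * ((∏ i, W1 (f j y1 y2 i) (y1 i)) * ∏ i, W2 (f j y1 y2 i) (y2 i))
            ≤ 1 / (M : ℝ) * ((Real.exp θ * ∏ i, outDist P W1 (y1 i)) *
              ∏ i, W2 (f j y1 y2 i) (y2 i)) := by gcongr
          _ = _ := by ring
      · rw [mul_zero]; positivity
    · simp only [hg, if_false, zero_mul, add_zero]
      split_ifs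
      · rw [mul_one]
      · rw [mul_zero]; exact hlaw0 _ _ _
  have hsum : ∀ j y1, ∑ y2, ∏ i, W2 (f j y1 y2 i) (y2 i) = 1 := fun j y1 =>
    sum_prod_causal_eq_one (w := W2) (fun x => (hW2 x).2) (g := fun y2 => f j y1 y2)
      (fun y y' i h => hf j y1 y1 y y' i (fun _ _ => rfl) h)
  calc _ ≤ ∑ j, ∑ y1, ∑ y2, ((if g y1 = j then 0 else codeLaw W1 W2 n M f j y1 y2)
        + (if g y1 = j then Real.exp θ / M * ∏ i, outDist P W1 (y1 i) else 0) *
          ∏ i, W2 (f j y1 y2 i) (y2 i)) :=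
        sum_le_sum fun j _ => sum_le_sum fun y1 _ => sum_le_sum fun y2 _ => key j y1 y2
    _ = errProb1 W1 W2 n M f g + Real.exp θ / M := by
        simp_rw [sum_add_distrib, ← mul_sum, hsum, mul_one]
        rw [errProb1]
        congr 1
        rw [sum_comm]
        simp_rw [sum_ite_eq, mem_univ, if_true]
        rw [← mul_sum, sum_prod_outDist hW1 hP1, mul_one]

lemma errProb2_eq_swap {𝒳 𝒴 : Type*} [Fintype 𝒴] (W1 W2 : 𝒳 → 𝒴 → ℝ) (n M : ℕ)
    (f : Fin M → (Fin n → 𝒴) → (Fin n → 𝒴) → Fin n → 𝒳) (g : (Fin n → 𝒴) → Fin M) :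
    errProb2 W1 W2 n M f g = errProb1 W2 W1 n M (fun j y2 y1 => f j y1 y2) g := by
  unfold errProb1 errProb2 codeLaw
  refine sum_congr rfl fun j _ => ?_
  rw [sum_comm]
  simp_rw [mul_comm (W2 _ _)]

/-- Every feedback code controls the probability that a convex combination of the two
accumulated information densities is small. -/
lemma converse_bound {W1 W2 : 𝒳 → 𝒴 → ℝ} (hW1 : IsChannel W1) (hW2 : IsChannel W2)
    [Nonempty 𝒴] {P : 𝒳 → ℝ} (hP : ∀ x, 0 < P x) (hP1 : ∑ x, P x = 1) {n M : ℕ} {ε : ℝ}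
    {f : Fin M → (Fin n → 𝒴) → (Fin n → 𝒴) → Fin n → 𝒳} (hf : Causal n M f)
    {g1 g2 : (Fin n → 𝒴) → Fin M} (h1 : errProb1 W1 W2 n M f g1 ≤ ε)
    (h2 : errProb2 W1 W2 n M f g2 ≤ ε) {η : ℝ} (hη0 : 0 < η) (hη1 : η < 1) (θ : ℝ) :
    ∑ j, ∑ y1, ∑ y2, codeLaw W1 W2 n M f j y1 y2 *
        (if ∑ i, (η * infoDens P W1 (f j y1 y2 i) (y1 i)
          + (1 - η) * infoDens P W2 (f j y1 y2 i) (y2 i)) ≤ θ then 1 else 0)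
      ≤ 2 * ε + 2 * Real.exp θ / M := by
  have v1 := verdu_han hW1 hW2 hP hP1 hf g1 θ
  have v2 := verdu_han hW2 hW1 hP hP1 (f := fun j y2 y1 => f j y1 y2)
    (fun j a a' b b' i ha hb => hf j b b' a a' i hb ha) g2 θ
  rw [← errProb2_eq_swap] at v2
  have e : ∑ j, ∑ y2, ∑ y1, codeLaw W2 W1 n M (fun j y2 y1 => f j y1 y2) j y2 y1 *
        (if ∑ i, infoDens P W2 (f j y1 y2 i) (y2 i) ≤ θ then (1 : ℝ) else 0)
      = ∑ j, ∑ y1, ∑ y2, codeLaw W1 W2 n M f j y1 y2 *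
        (if ∑ i, infoDens P W2 (f j y1 y2 i) (y2 i) ≤ θ then 1 else 0) := by
    refine sum_congr rfl fun j _ => ?_
    rw [sum_comm]
    unfold codeLaw
    simp_rw [mul_comm (W2 _ _)]
  rw [e] at v2
  have h3 : ∑ j, ∑ y1, ∑ y2, codeLaw W1 W2 n M f j y1 y2 *
        (if ∑ i, (η * infoDens P W1 (f j y1 y2 i) (y1 i)
          + (1 - η) * infoDens P W2 (f j y1 y2 i) (y2 i)) ≤ θ then (1 : ℝ) else 0)
      ≤ ∑ j, ∑ y1, ∑ y2, codeLaw W1 W2 n M f j y1 y2 *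
          (if ∑ i, infoDens P W1 (f j y1 y2 i) (y1 i) ≤ θ then 1 else 0)
        + ∑ j, ∑ y1, ∑ y2, codeLaw W1 W2 n M f j y1 y2 *
          (if ∑ i, infoDens P W2 (f j y1 y2 i) (y2 i) ≤ θ then 1 else 0) := by
    simp_rw [← sum_add_distrib, ← mul_add]
    refine sum_le_sum fun j _ => sum_le_sum fun y1 _ => sum_le_sum fun y2 _ => ?_
    refine mul_le_mul_of_nonneg_left ?_ (mul_nonneg (by positivity)
      (prod_nonneg fun i _ => mul_nonneg ((hW1 _).1 _) ((hW2 _).1 _)))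
    rw [sum_add_distrib, ← mul_sum, ← mul_sum]
    set a := ∑ i, infoDens P W1 (f j y1 y2 i) (y1 i)
    set b := ∑ i, infoDens P W2 (f j y1 y2 i) (y2 i)
    by_cases ha : a ≤ θ
    · simp only [ha, if_true]
      split_ifs <;> norm_num
    · by_cases hb : b ≤ θ
      · simp only [hb, if_true]
        split_ifs <;> norm_num
      · push Not at ha hb
        have : ¬ (η * a + (1 - η) * b ≤ θ) := by
          push Not
          nlinarith
        simp only [this, if_false]
        split_ifs <;> norm_num
  calc _ ≤ _ := h3
    _ ≤ _ := add_le_add v1 v2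
    _ ≤ 2 * ε + 2 * Real.exp θ / M := by
      rw [mul_div_assoc]
      linarith

/-- The sixth root of `n`, in terms of which all error terms are expressed. -/
def sixthRoot (n : ℕ) : ℝ := (n : ℝ) ^ ((1 : ℝ) / 6)

lemma sixthRoot_nonneg (n : ℕ) : 0 ≤ sixthRoot n := by unfold sixthRoot; positivity

lemma sixthRoot_pow_six (n : ℕ) : sixthRoot n ^ 6 = n := by
  unfold sixthRoot
  rw [← Real.rpow_natCast, ← Real.rpow_mul (by positivity)]
  norm_num

lemma sixthRoot_sq (n : ℕ) : sixthRoot n ^ 2 = (n : ℝ) ^ ((1 : ℝ) / 3) := by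
  unfold sixthRoot
  rw [← Real.rpow_natCast, ← Real.rpow_mul (by positivity)]
  norm_num

lemma tendsto_sixthRoot : Filter.Tendsto sixthRoot Filter.atTop Filter.atTop :=
  (tendsto_rpow_atTop (by norm_num)).comp tendsto_natCast_atTop_atTop

lemma eventually_one_le_log : ∀ᶠ n : ℕ in Filter.atTop, 1 ≤ Real.log n :=
  (Real.tendsto_log_atTop.comp tendsto_natCast_atTop_atTop).eventually_ge_atTop 1

lemma sqrt_mul_eq_sixthRoot (n : ℕ) (V : ℝ) :
    Real.sqrt (n * V) = sixthRoot n ^ 3 * Real.sqrt V := by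
  rw [Real.sqrt_mul (by positivity), ← sixthRoot_pow_six n]
  congr 1
  rw [show sixthRoot n ^ 6 = (sixthRoot n ^ 3) ^ 2 by ring]
  exact Real.sqrt_sq (pow_nonneg (sixthRoot_nonneg n) 3)

lemma sqrt_add_sq_le {h : ℝ} (hh : 0 ≤ h) {x : ℝ} (hx : 0 ≤ x) :
    Real.sqrt (h ^ 2 + x) ≤ h + Real.sqrt x := by
  rw [Real.sqrt_le_left (by positivity)]
  nlinarith [Real.sq_sqrt hx, mul_nonneg hh (Real.sqrt_nonneg x)]

lemma sum_mul_infoDens (P : 𝒳 → ℝ) (W : 𝒳 → 𝒴 → ℝ) (x : 𝒳) :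
    ∑ y, W x y * infoDens P W x y = relEnt (W x) (outDist P W) := rfl

section Moments

variable {W1 W2 : 𝒳 → 𝒴 → ℝ} {P : 𝒳 → ℝ} {η C V : ℝ}

/-- The centred weighted information density of one channel use. -/
def weightedDens (P : 𝒳 → ℝ) (W1 W2 : 𝒳 → 𝒴 → ℝ) (η C : ℝ) (x : 𝒳) (a b : 𝒴) : ℝ :=
  η * infoDens P W1 x a + (1 - η) * infoDens P W2 x b - C

lemma sum_sum_weightedDens (hW1 : IsChannel W1) (hW2 : IsChannel W2) {x : 𝒳}
    (hD : η * relEnt (W1 x) (outDist P W1) + (1 - η) * relEnt (W2 x) (outDist P W2) = C) :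
    ∑ a, ∑ b, W1 x a * W2 x b * weightedDens P W1 W2 η C x a b = 0 := by
  have e : ∀ a b, W1 x a * W2 x b * weightedDens P W1 W2 η C x a b
      = η * (W1 x a * infoDens P W1 x a) * W2 x b
        + (1 - η) * W1 x a * (W2 x b * infoDens P W2 x b) - C * W1 x a * W2 x b := by
    intro a b; unfold weightedDens; ring
  simp_rw [e, sum_sub_distrib, sum_add_distrib, ← mul_sum, (hW2 x).2, sum_mul_infoDens, mul_one,
    ← sum_mul, ← mul_sum, (hW1 x).2, sum_mul_infoDens]
  linarith

lemma sum_sum_weightedDens_sq (hW1 : IsChannel W1) (hW2 : IsChannel W2) {x : 𝒳}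
    (hD : η * relEnt (W1 x) (outDist P W1) + (1 - η) * relEnt (W2 x) (outDist P W2) = C) :
    ∑ a, ∑ b, W1 x a * W2 x b * weightedDens P W1 W2 η C x a b ^ 2
      = η ^ 2 * symbVar P W1 x + (1 - η) ^ 2 * symbVar P W2 x := by
  unfold symbVar
  simp_rw [sum_mul_infoDens]
  set d1 := relEnt (W1 x) (outDist P W1)
  set d2 := relEnt (W2 x) (outDist P W2)
  have m1 : ∑ a, W1 x a * (infoDens P W1 x a - d1) = 0 := by
    simp_rw [mul_sub, sum_sub_distrib, ← sum_mul, (hW1 x).2, sum_mul_infoDens]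
    simp [d1]
  have e : ∀ a b, W1 x a * W2 x b * weightedDens P W1 W2 η C x a b ^ 2
      = η ^ 2 * (W1 x a * (infoDens P W1 x a - d1) ^ 2) * W2 x b
        + (1 - η) ^ 2 * W1 x a * (W2 x b * (infoDens P W2 x b - d2) ^ 2)
        + 2 * η * (1 - η) * (W1 x a * (infoDens P W1 x a - d1)) *
          (W2 x b * (infoDens P W2 x b - d2)) := by
    intro a b; unfold weightedDens; rw [← hD]; ring
  simp_rw [e, sum_add_distrib, ← mul_sum, (hW2 x).2, mul_one, ← sum_mul, ← mul_sum, (hW1 x).2, m1]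
  ring

lemma exists_weightedDens_bound (P : 𝒳 → ℝ) (W1 W2 : 𝒳 → 𝒴 → ℝ) (η C : ℝ) :
    ∃ B, 0 ≤ B ∧ ∀ x a b, |weightedDens P W1 W2 η C x a b| ≤ B := by
  refine ⟨∑ z : 𝒳 × 𝒴 × 𝒴, |weightedDens P W1 W2 η C z.1 z.2.1 z.2.2|,
    sum_nonneg fun z _ => abs_nonneg _, fun x a b => ?_⟩
  exact single_le_sum (f := fun z : 𝒳 × 𝒴 × 𝒴 => |weightedDens P W1 W2 η C z.1 z.2.1 z.2.2|)
    (fun z _ => abs_nonneg _) (mem_univ (x, a, b))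

end Moments

set_option maxHeartbeats 1000000 in
/-- Second-order converse under the per-symbol variance condition. -/
lemma converse_asymptotic {W1 W2 : 𝒳 → 𝒴 → ℝ} (hW1 : IsChannel W1) (hW2 : IsChannel W2)
    [Nonempty 𝒴] {P : 𝒳 → ℝ} (hP : ∀ x, 0 < P x) (hP1 : ∑ x, P x = 1) {η C V ε : ℝ}
    (hη0 : 0 < η) (hη1 : η < 1)
    (hD : ∀ x, η * relEnt (W1 x) (outDist P W1) + (1 - η) * relEnt (W2 x) (outDist P W2) = C)
    (hV : 0 < V) (hvar : ∀ x, η ^ 2 * symbVar P W1 x + (1 - η) ^ 2 * symbVar P W2 x = V)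
    (hε0 : 0 < ε) (hε1 : ε < 1 / 2) :
    ∃ K > 0, ∀ᶠ n : ℕ in Filter.atTop, ∀ M, FLFExists W1 W2 n M ε →
      Real.log M ≤ n * C - Real.sqrt (n * V) * Qinv (2 * ε)
        + K * (sixthRoot n ^ 2 * Real.log n) := by
  obtain ⟨B, hB, hb⟩ := exists_weightedDens_bound P W1 W2 η C
  obtain ⟨K, hK, hcdf⟩ := CausalStrategy.cdf_bounds (α := 𝒴) (β := 𝒴) (γ := 𝒳) hV hB
  set q := Qinv (2 * ε)
  have hq : Qfun q = 2 * ε := Qfun_Qinv (by linarith) (by linarith)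
  obtain ⟨κ, hκ, hslope⟩ := exists_Qfun_slope q
  refine ⟨1 + |q| + (1 + Real.sqrt V) * ((K + 3) / κ) + 1, by positivity, ?_⟩
  filter_upwards [tendsto_sixthRoot.eventually_ge_atTop (1 + (K + 3) / κ), eventually_one_le_log]
    with n hn hlog M hM
  obtain ⟨f, hf, g1, g2, he1, he2⟩ := hM
  have hM0 : 0 < M := Fin.pos (g1 (fun _ => Classical.arbitrary 𝒴))
  have hMR : (0 : ℝ) < M := by exact_mod_cast hM0
  set h := sixthRoot n with hh
  have hKκ : 0 < (K + 3) / κ := by positivity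
  have h1 : 1 ≤ h := by linarith
  have hn6 : h ^ 6 = n := sixthRoot_pow_six n
  have hn1 : (1 : ℝ) ≤ n := by rw [← hn6]; exact one_le_pow₀ h1
  have hn0 : (0 : ℝ) < n := by linarith
  set θ := Real.log M - Real.log n with hθ
  have hexp : Real.exp θ / M = 1 / n := by
    rw [hθ, Real.exp_sub, Real.exp_log hMR, Real.exp_log hn0]
    field_simp
  have hconv := converse_bound hW1 hW2 hP hP1 hf he1 he2 hη0 hη1 θ
  rw [mul_div_assoc, hexp] at hconv
  set t := θ - n * C with ht
  set r := Real.sqrt (h ^ 2 + n * V) with hr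
  have hj : ∀ j, Qfun ((h ^ 2 - t) / r) - K / h ≤ ∑ y1, ∑ y2,
      (∏ i, (W1 (f j y1 y2 i) (y1 i) * W2 (f j y1 y2 i) (y2 i))) *
        (if ∑ i, (η * infoDens P W1 (f j y1 y2 i) (y1 i)
          + (1 - η) * infoDens P W2 (f j y1 y2 i) (y2 i)) ≤ θ then 1 else 0) := by
    intro j
    have := (hcdf (fun x a b => W1 x a * W2 x b) (weightedDens P W1 W2 η C)
      (fun x a b => mul_nonneg ((hW1 x).1 a) ((hW2 x).1 b))
      (fun x => by simp_rw [← mul_sum, (hW2 x).2, mul_one, (hW1 x).2])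
      (fun x => sum_sum_weightedDens hW1 hW2 (hD x))
      (fun x => (sum_sum_weightedDens_sq hW1 hW2 (hD x)).trans (hvar x))
      (fun x a b _ => hb x a b) h h1 n (f j) (hf j) t).1
    have e : ∀ y1 y2, (∑ i, weightedDens P W1 W2 η C (f j y1 y2 i) (y1 i) (y2 i) ≤ t) ↔
        ∑ i, (η * infoDens P W1 (f j y1 y2 i) (y1 i)
          + (1 - η) * infoDens P W2 (f j y1 y2 i) (y2 i)) ≤ θ := by
      intro y1 y2
      unfold weightedDens
      rw [sum_sub_distrib, sum_const, card_univ, Fintype.card_fin, nsmul_eq_mul, ht,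
        sub_le_sub_iff_right]
    simp only [e] at this
    exact this
  have hsum : Qfun ((h ^ 2 - t) / r) - K / h ≤ 2 * ε + 2 * (1 / n) := by
    refine le_trans ?_ hconv
    have hMinv : ∑ _j : Fin M, 1 / (M : ℝ) = 1 := by
      rw [sum_const, card_univ, Fintype.card_fin, nsmul_eq_mul]
      field_simp
    calc Qfun ((h ^ 2 - t) / r) - K / h
        = ∑ _j : Fin M, 1 / (M : ℝ) * (Qfun ((h ^ 2 - t) / r) - K / h) := by
          rw [← sum_mul, hMinv, one_mul]
      _ ≤ _ := by
          refine sum_le_sum fun j _ => ?_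
          refine (mul_le_mul_of_nonneg_left (hj j) (by positivity)).trans (le_of_eq ?_)
          rw [mul_sum]
          refine sum_congr rfl fun y1 _ => ?_
          rw [mul_sum]
          refine sum_congr rfl fun y2 _ => ?_
          rw [codeLaw, mul_assoc]
  have hnh : 1 / (n : ℝ) ≤ 1 / h := by
    apply one_div_le_one_div_of_le (by linarith)
    rw [← hn6]
    exact le_self_pow₀ h1 (by norm_num)
  set s := (K + 3) / κ / h with hs
  have hh0 : 0 < h := by linarith
  have hs0 : 0 < s := by positivity
  have hs1 : s ≤ 1 := by rw [hs, div_le_one hh0]; linarith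
  have hκs : κ * s = (K + 3) / h := by rw [hs]; field_simp
  have hlt : q - s < (h ^ 2 - t) / r := by
    by_contra hcon
    push Not at hcon
    have h2 := Qfun_antitone hcon
    have h3 := (hslope s hs0.le hs1).2
    rw [hq, hκs] at h3
    have h4 : (K + 3) / h = K / h + 3 * (1 / h) := by ring
    have h5 : 0 < 1 / h := by positivity
    linarith
  have hr0 : 0 < r := Real.sqrt_pos.2 (by positivity)
  rw [lt_div_iff₀ hr0] at hlt
  have hnV : 0 ≤ n * V := by positivity
  have hr1 : r ≤ h + Real.sqrt (n * V) := sqrt_add_sq_le hh0.le hnV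
  have hr2 : Real.sqrt (n * V) ≤ r := Real.sqrt_le_sqrt (by nlinarith)
  have hrs : r * s ≤ (1 + Real.sqrt V) * ((K + 3) / κ) * h ^ 2 := by
    rw [sqrt_mul_eq_sixthRoot] at hr1
    have hsV := Real.sqrt_nonneg V
    have e1 : h * s = (K + 3) / κ := by rw [hs]; field_simp
    calc r * s ≤ (h + h ^ 3 * Real.sqrt V) * s := by gcongr
      _ = (1 + h ^ 2 * Real.sqrt V) * (h * s) := by ring
      _ ≤ ((1 + Real.sqrt V) * h ^ 2) * ((K + 3) / κ) := by
        rw [e1]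
        refine mul_le_mul_of_nonneg_right ?_ hKκ.le
        nlinarith
      _ = _ := by ring
  have hrq : -(r * q) ≤ -(Real.sqrt (n * V) * q) + h ^ 2 * |q| := by
    have h2 : (r - Real.sqrt (n * V)) * (-q) ≤ h * |q| := by
      calc (r - Real.sqrt (n * V)) * (-q) ≤ (r - Real.sqrt (n * V)) * |q| :=
            mul_le_mul_of_nonneg_left (neg_le_abs q) (by linarith)
        _ ≤ h * |q| := mul_le_mul_of_nonneg_right (by linarith) (abs_nonneg q)
    have h3 : h * |q| ≤ h ^ 2 * |q| := mul_le_mul_of_nonneg_right (by nlinarith) (abs_nonneg q)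
    linarith
  have hfin : Real.log M ≤ n * C - Real.sqrt (n * V) * q
      + (1 + |q| + (1 + Real.sqrt V) * ((K + 3) / κ)) * h ^ 2 + Real.log n := by
    have : Real.log M = t + n * C + Real.log n := by rw [ht, hθ]; ring
    linarith
  have h6 : (1 : ℝ) ≤ h ^ 2 := one_le_pow₀ h1
  have h7 : h ^ 2 ≤ h ^ 2 * Real.log n := le_mul_of_one_le_right (by positivity) hlog
  have h8 : Real.log n ≤ h ^ 2 * Real.log n := le_mul_of_one_le_left (by linarith) h6
  have h9 : 0 ≤ 1 + |q| + (1 + Real.sqrt V) * ((K + 3) / κ) := by positivity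
  generalize (1 + |q| + (1 + Real.sqrt V) * ((K + 3) / κ)) = c at hfin h9
  have h10 := mul_le_mul_of_nonneg_left h7 h9
  linarith

/-! ### Random coding tools -/

lemma exists_le_of_sum_mul_le {α : Type*} [Fintype α] {p : α → ℝ} (hp : IsDist p) {F : α → ℝ}
    {b : ℝ} (h : ∑ c, p c * F c ≤ b) : ∃ c, F c ≤ b := by
  by_contra hcon
  push Not at hcon
  have h1 : ∑ c, p c * b = b := by rw [← sum_mul, hp.2, one_mul]
  have hne : ∃ c, 0 < p c := by
    by_contra h0
    push Not at h0
    have h2 : ∑ c, p c ≤ 0 := sum_nonpos fun c _ => h0 c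
    rw [hp.2] at h2
    linarith
  obtain ⟨c0, hc0⟩ := hne
  have h3 : ∑ c, p c * b < ∑ c, p c * F c :=
    sum_lt_sum (fun c _ => mul_le_mul_of_nonneg_left (hcon c).le (hp.1 c))
      ⟨c0, mem_univ _, mul_lt_mul_of_pos_left (hcon c0) hc0⟩
  linarith

/-- Random codebook argument: some codebook is at least as good as an i.i.d. one on average. -/
lemma exists_codebook {α : Type*} [Fintype α] {p : α → ℝ} (hp : IsDist p)
    (B : α → α → ℝ) (M : ℕ) : ∀ A : α → ℝ, ∃ ω : Fin M → α,
      ∑ j, A (ω j) + ∑ j, ∑ j', (if j' = j then 0 else B (ω j) (ω j'))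
        ≤ M * ∑ c, p c * A c + M * (M - 1) * ∑ c, ∑ c', p c * p c' * B c c' := by
  induction M with
  | zero => intro A; exact ⟨fun i => i.elim0, by simp⟩
  | succ M ih =>
    intro A
    obtain ⟨ω, hω⟩ := ih fun c => A c + ∑ c', p c' * (B c c' + B c' c)
    have havg : ∑ c, p c * (A c + ∑ j, (B (ω j) c + B c (ω j)))
        ≤ ∑ c, p c * A c + ∑ j, ∑ c', p c' * (B (ω j) c' + B c' (ω j)) := by
      rw [sum_comm (s := univ) (t := univ) (f := fun j c' => p c' * (B (ω j) c' + B c' (ω j))),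
        ← sum_add_distrib]
      refine le_of_eq (sum_congr rfl fun c _ => ?_)
      rw [mul_add, mul_sum]
    obtain ⟨c, hc⟩ := exists_le_of_sum_mul_le hp havg
    refine ⟨Fin.cons c ω, ?_⟩
    have hEB : ∑ c, p c * ∑ c', p c' * (B c c' + B c' c)
        = 2 * ∑ c, ∑ c', p c * p c' * B c c' := by
      have e1 : ∀ c, p c * ∑ c', p c' * (B c c' + B c' c)
          = ∑ c', p c * p c' * B c c' + ∑ c', p c' * p c * B c' c := by
        intro c
        rw [mul_sum, ← sum_add_distrib]
        exact sum_congr rfl fun c' _ => by ring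
      simp_rw [e1, sum_add_distrib]
      rw [sum_comm (f := fun c c' => p c' * p c * B c' c)]
      ring
    have hEA : ∑ c, p c * (A c + ∑ c', p c' * (B c c' + B c' c))
        = ∑ c, p c * A c + 2 * ∑ c, ∑ c', p c * p c' * B c c' := by
      rw [← hEB, ← sum_add_distrib]
      exact sum_congr rfl fun c _ => mul_add _ _ _
    rw [hEA, sum_add_distrib] at hω
    simp_rw [Fin.sum_univ_succ, Fin.cons_zero, Fin.cons_succ, Fin.succ_inj]
    have e2 : ∀ j : Fin M, (Fin.succ j = 0) = False := fun j => eq_false (Fin.succ_ne_zero j)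
    have e3 : ∀ j : Fin M, ((0 : Fin (M + 1)) = Fin.succ j) = False :=
      fun j => eq_false (Fin.succ_ne_zero j).symm
    simp_rw [e2, e3, if_true, if_false, sum_add_distrib]
    rw [sum_add_distrib] at hc
    push_cast
    linarith

/-- A finite family of numbers in `[0, 1]` can be split into two nearly balanced halves. -/
lemma exists_balanced_split (M : ℕ) : ∀ a : Fin M → ℝ, (∀ j, 0 ≤ a j) → (∀ j, a j ≤ 1) →
    ∃ m : Fin M → Bool, |∑ j, (if m j then a j else -a j)| ≤ 1 := by
  induction M with
  | zero => intro a _ _; exact ⟨fun _ => true, by simp⟩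
  | succ M ih =>
    intro a h0 h1
    obtain ⟨m, hm⟩ := ih (fun j => a j.succ) (fun j => h0 _) (fun j => h1 _)
    rw [abs_le] at hm
    have h0' := h0 0
    have h1' := h1 0
    rcases le_total (∑ j : Fin M, (if m j then a j.succ else -a j.succ)) 0 with hs | hs
    · refine ⟨Fin.cons true m, ?_⟩
      simp only [Fin.sum_univ_succ, Fin.cons_zero, Fin.cons_succ, if_true]
      rw [abs_le]; constructor <;> linarith
    · refine ⟨Fin.cons false m, ?_⟩
      simp only [Fin.sum_univ_succ, Fin.cons_zero, Fin.cons_succ, Bool.false_eq_true, if_false]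
      rw [abs_le]; constructor <;> linarith

lemma exists_balanced_split' {M : ℕ} {a : Fin M → ℝ} (h0 : ∀ j, 0 ≤ a j) (h1 : ∀ j, a j ≤ 1) :
    ∃ m : Fin M → Bool, ∀ b, ∑ j, (if m j ≠ b then a j else 0) ≤ (∑ j, a j) / 2 + 1 := by
  obtain ⟨m, hm⟩ := exists_balanced_split M a h0 h1
  refine ⟨m, fun b => ?_⟩
  have e : ∑ j, (if m j ≠ b then a j else 0)
      = (∑ j, a j) / 2 + (if b then -1 else 1) * (∑ j, (if m j then a j else -a j)) / 2 := by
    rw [mul_sum, sum_div, sum_div, ← sum_add_distrib]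
    refine sum_congr rfl fun j _ => ?_
    cases m j <;> cases b <;> simp <;> ring
  rw [e]
  rw [abs_le] at hm
  cases b <;> simp <;> linarith

/-- Marginals of a product distribution. -/
lemma sum_pi_marginal {ι α : Type*} [Fintype ι] [DecidableEq ι] [Fintype α] {p : ι → α → ℝ}
    (hp : ∀ s, ∑ a, p s a = 1) (t : ι) (G : α → ℝ) :
    ∑ v : ι → α, (∏ s, p s (v s)) * G (v t) = ∑ a, p t a * G a := by
  have h := Finset.prod_univ_sum (fun _ : ι => (univ : Finset α))
    (fun s a => p s a * if s = t then G a else 1)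
  rw [Fintype.piFinset_univ] at h
  have e1 : ∀ v : ι → α, ∏ s, (p s (v s) * if s = t then G (v s) else 1)
      = (∏ s, p s (v s)) * G (v t) := by
    intro v
    rw [prod_mul_distrib, prod_ite_eq' univ t fun s => G (v s)]
    simp
  simp_rw [e1] at h
  rw [← h, ← mul_prod_erase univ _ (mem_univ t)]
  have e2 : ∏ s ∈ univ.erase t, ∑ a, (p s a * if s = t then G a else 1) = 1 := by
    refine prod_eq_one fun s hs => ?_
    simp [ne_of_mem_erase hs, hp]
  rw [e2, mul_one]
  simp

lemma sum_pi_prod_eq_one {ι α : Type*} [Fintype ι] [DecidableEq ι] [Fintype α] {p : ι → α → ℝ}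
    (hp : ∀ s, ∑ a, p s a = 1) : ∑ v : ι → α, ∏ s, p s (v s) = 1 := by
  have h := Finset.prod_univ_sum (fun _ : ι => (univ : Finset α)) p
  rw [Fintype.piFinset_univ] at h
  rw [← h]
  exact prod_eq_one fun s _ => hp s

/-- A likelihood ratio exceeds `K` with probability at most `1 / K`. -/
lemma sum_likelihood_le {α : Type*} [Fintype α] {p l : α → ℝ} (hp : ∀ c, 0 ≤ p c)
    (hl : ∀ c, 0 ≤ l c) {q K : ℝ} (hK : 0 < K) (hq : ∑ c, p c * l c = q) :
    ∑ c, p c * (if K * q < l c then 1 else 0) ≤ 1 / K := by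
  have hq0 : 0 ≤ q := hq ▸ sum_nonneg fun c _ => mul_nonneg (hp c) (hl c)
  rcases hq0.eq_or_lt with h0 | h0
  · have hz := (Finset.sum_eq_zero_iff_of_nonneg (s := univ) (f := fun c => p c * l c)
      fun c _ => mul_nonneg (hp c) (hl c)).1 (hq.trans h0.symm)
    have : ∑ c, p c * (if K * q < l c then (1 : ℝ) else 0) = 0 := by
      refine sum_eq_zero fun c hc => ?_
      rw [← h0, mul_zero]
      rcases mul_eq_zero.1 (hz c hc) with h | h
      · rw [h, zero_mul]
      · rw [h]; simp
    rw [this]; positivity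
  · rw [le_div_iff₀ hK]
    refine le_of_mul_le_mul_right (a := q) ?_ h0
    rw [one_mul, mul_assoc, sum_mul]
    refine le_of_le_of_eq (sum_le_sum fun c _ => ?_) hq
    rw [mul_assoc]
    refine mul_le_mul_of_nonneg_left ?_ (hp c)
    split_ifs with h
    · linarith
    · simpa using hl c

/-- Chernoff bound for sums of i.i.d. bounded variables with nonnegative mean. -/
lemma chernoff {α : Type*} [Fintype α] {p g : α → ℝ} (hp : IsDist p) (hg : 0 ≤ ∑ z, p z * g z)
    {B l : ℝ} (hB : ∀ z, p z ≠ 0 → |g z| ≤ B) (hl : 0 ≤ l) (hlB : l * B ≤ 1) (n : ℕ) (A : ℝ) :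
    ∑ z : Fin n → α, (∏ i, p (z i)) * (if ∑ i, g (z i) ≤ -A then 1 else 0)
      ≤ Real.exp (n * (l * B) ^ 2 - l * A) := by
  have h1 : ∑ z, p z * Real.exp (-l * g z) ≤ Real.exp ((l * B) ^ 2) := by
    have h2 : ∀ z, p z * Real.exp (-l * g z) ≤ p z * (1 - l * g z + (l * B) ^ 2) := by
      intro z
      by_cases hz : p z = 0
      · simp [hz]
      refine mul_le_mul_of_nonneg_left ?_ (hp.1 z)
      have h3 : |-l * g z| ≤ l * B := by
        rw [abs_mul, abs_neg, abs_of_nonneg hl]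
        exact mul_le_mul_of_nonneg_left (hB z hz) hl
      have h4 := (abs_le.1 (Real.abs_exp_sub_one_sub_id_le (h3.trans hlB))).2
      have h5 : (-l * g z) ^ 2 ≤ (l * B) ^ 2 := sq_le_sq.2 (h3.trans (le_abs_self _))
      linarith
    refine (sum_le_sum fun z _ => h2 z).trans ?_
    have e : ∑ z, p z * (1 - l * g z + (l * B) ^ 2)
        = 1 + (l * B) ^ 2 - l * ∑ z, p z * g z := by
      have e2 : ∀ z, p z * (1 - l * g z + (l * B) ^ 2)
          = p z * (1 + (l * B) ^ 2) - l * (p z * g z) := fun z => by ring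
      simp_rw [e2, sum_sub_distrib, ← sum_mul, ← mul_sum, hp.2, one_mul]
    rw [e]
    have h6 := Real.add_one_le_exp ((l * B) ^ 2)
    have h7 := mul_nonneg hl hg
    linarith
  have h0 : 0 ≤ ∑ z, p z * Real.exp (-l * g z) :=
    sum_nonneg fun z _ => mul_nonneg (hp.1 z) (Real.exp_pos _).le
  calc ∑ z : Fin n → α, (∏ i, p (z i)) * (if ∑ i, g (z i) ≤ -A then (1 : ℝ) else 0)
      ≤ ∑ z : Fin n → α, Real.exp (-l * A) * ∏ i, (p (z i) * Real.exp (-l * g (z i))) := by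
        refine sum_le_sum fun z _ => ?_
        rw [prod_mul_distrib, ← Real.exp_sum, mul_left_comm, ← Real.exp_add]
        refine mul_le_mul_of_nonneg_left ?_ (prod_nonneg fun i _ => hp.1 _)
        split_ifs with h
        · rw [Real.one_le_exp_iff, ← mul_sum]
          nlinarith
        · positivity
    _ = Real.exp (-l * A) * (∑ z, p z * Real.exp (-l * g z)) ^ n := by
        rw [← mul_sum, Fintype.sum_pow]
    _ ≤ Real.exp (-l * A) * (Real.exp ((l * B) ^ 2)) ^ n := by gcongr
    _ = _ := by
        rw [← Real.exp_nat_mul, ← Real.exp_add]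
        congr 1; ring

/-! ### One-shot achievability with two operating modes -/

lemma le_sum_sum_bool {F : Bool → Bool → ℝ} (h : ∀ m k, 0 ≤ F m k) (m k : Bool) :
    F m k ≤ ∑ m, ∑ k, F m k :=
  (single_le_sum (f := fun k => F m k) (fun k _ => h m k) (mem_univ k)).trans
    (single_le_sum (f := fun m => ∑ k, F m k) (fun m _ => sum_nonneg fun k _ => h m k) (mem_univ m))

open Classical in
/-- One-shot random coding bound. In mode `m`, the encoder gives up on the receiver `!m` when the
event `Bad` occurs; assigning the two modes to two halves of the messages shares the probability of
`Bad` evenly between the receivers. -/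
lemma exists_two_mode_code {κ Y : Type*} [Fintype κ] [Fintype Y] {p : κ → ℝ} (hp : IsDist p)
    {L : Bool → κ → (Bool → Y) → ℝ} (hL0 : ∀ m c y, 0 ≤ L m c y) (hL1 : ∀ m c, ∑ y, L m c y = 1)
    {Bad : κ → (Bool → Y) → Prop} {a : κ → ℝ}
    (ha : ∀ m c, ∑ y, L m c y * (if Bad c y then 1 else 0) = a c)
    {Acc : Bool → κ → Y → Prop} {α β μ : ℝ} (hα : ∑ c, p c * a c ≤ α)
    (hβ : ∀ m k, ∑ c, p c * ∑ y, L m c y *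
      (if (Bad c y ∧ m ≠ k) ∨ Acc k c (y k) then 0 else 1) ≤ β)
    (hμ : ∀ k y, ∑ c, p c * (if Acc k c y then 1 else 0) ≤ μ) {M : ℕ} (hM : 0 < M) :
    ∃ (ω : Fin M → κ) (m : Fin M → Bool) (g : Bool → Y → Fin M), ∀ k,
      ∑ j, ∑ y, (if g k (y k) = j then 0 else L (m j) (ω j) y)
        ≤ M * (α / 2 + 4 * β + 4 * (M * μ)) + 1 := by
  set b : Bool → Bool → κ → ℝ := fun m k c => ∑ y, L m c y *
      (if (Bad c y ∧ m ≠ k) ∨ Acc k c (y k) then 0 else 1) with hb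
  set D : Bool → Bool → κ → κ → ℝ := fun m k c c' => ∑ y, L m c y *
      (if Acc k c' (y k) then 1 else 0) with hD
  have hb0 : ∀ m k c, 0 ≤ b m k c := fun m k c =>
    sum_nonneg fun y _ => mul_nonneg (hL0 _ _ _) (by split_ifs <;> norm_num)
  have hD0 : ∀ m k c c', 0 ≤ D m k c c' := fun m k c c' =>
    sum_nonneg fun y _ => mul_nonneg (hL0 _ _ _) (by split_ifs <;> norm_num)
  have hED : ∀ m k, ∑ c, ∑ c', p c * p c' * D m k c c' ≤ μ := by
    intro m k
    have h1 : ∀ c, ∑ c', p c * p c' * D m k c c' ≤ p c * μ := by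
      intro c
      simp_rw [mul_assoc, ← mul_sum]
      refine mul_le_mul_of_nonneg_left ?_ (hp.1 c)
      calc ∑ c', p c' * D m k c c'
          = ∑ y, L m c y * ∑ c', p c' * (if Acc k c' (y k) then 1 else 0) := by
            simp_rw [hD, mul_sum]
            rw [sum_comm]
            exact sum_congr rfl fun y _ => sum_congr rfl fun c' _ => by ring
        _ ≤ ∑ y, L m c y * μ := sum_le_sum fun y _ =>
            mul_le_mul_of_nonneg_left (hμ k (y k)) (hL0 _ _ _)
        _ = μ := by rw [← sum_mul, hL1, one_mul]
    refine (sum_le_sum fun c _ => h1 c).trans (le_of_eq ?_)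
    rw [← sum_mul, hp.2, one_mul]
  obtain ⟨ω, hω⟩ := exists_codebook hp (fun c c' => ∑ m, ∑ k, D m k c c') M
    (fun c => a c / 2 + ∑ m, ∑ k, b m k c)
  have ha0 : ∀ c, 0 ≤ a c := fun c => by
    rw [← ha true c]
    exact sum_nonneg fun y _ => mul_nonneg (hL0 _ _ _) (by split_ifs <;> norm_num)
  have ha1 : ∀ c, a c ≤ 1 := fun c => by
    rw [← ha true c]
    refine (sum_le_sum fun y _ => ?_).trans (hL1 true c).le
    split_ifs
    · rw [mul_one]
    · rw [mul_zero]; exact hL0 _ _ _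
  have hEA : ∑ c, p c * (a c / 2 + ∑ m, ∑ k, b m k c) ≤ α / 2 + 4 * β := by
    have e : ∀ c, p c * (a c / 2 + ∑ m, ∑ k, b m k c)
        = (p c * a c) / 2 + ((p c * b true true c + p c * b true false c)
          + (p c * b false true c + p c * b false false c)) := fun c => by
      simp only [Fintype.sum_bool]; ring
    simp_rw [e, sum_add_distrib, ← sum_div]
    have h1 := hβ true true
    have h2 := hβ true false
    have h3 := hβ false true
    have h4 := hβ false false
    linarith
  have hEDs : ∑ c, ∑ c', p c * p c' * ∑ m, ∑ k, D m k c c' ≤ 4 * μ := by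
    have e : ∀ c c', p c * p c' * ∑ m, ∑ k, D m k c c'
        = ((p c * p c' * D true true c c' + p c * p c' * D true false c c')
          + (p c * p c' * D false true c c' + p c * p c' * D false false c c')) := fun c c' => by
      simp only [Fintype.sum_bool]; ring
    simp_rw [e, sum_add_distrib]
    have h1 := hED true true
    have h2 := hED true false
    have h3 := hED false true
    have h4 := hED false false
    linarith
  have hEDs0 : 0 ≤ ∑ c, ∑ c', p c * p c' * ∑ m, ∑ k, D m k c c' :=
    sum_nonneg fun c _ => sum_nonneg fun c' _ => mul_nonneg (mul_nonneg (hp.1 _) (hp.1 _))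
      (sum_nonneg fun m _ => sum_nonneg fun k _ => hD0 m k c c')
  obtain ⟨m, hm⟩ := exists_balanced_split' (a := fun j => a (ω j)) (fun j => ha0 _) (fun j => ha1 _)
  refine ⟨ω, m, fun k y => if h : ∃ j, Acc k (ω j) y then h.choose else ⟨0, hM⟩, fun k => ?_⟩
  have hterm : ∀ j y, (if (if h : ∃ j, Acc k (ω j) (y k) then h.choose else ⟨0, hM⟩) = j then 0
        else L (m j) (ω j) y)
      ≤ (if m j ≠ k then L (m j) (ω j) y * (if Bad (ω j) y then 1 else 0) else 0)
        + L (m j) (ω j) y * (if (Bad (ω j) y ∧ m j ≠ k) ∨ Acc k (ω j) (y k) then 0 else 1)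
        + ∑ j', (if j' = j then 0
            else L (m j) (ω j) y * (if Acc k (ω j') (y k) then 1 else 0)) := by
    intro j y
    have hl := hL0 (m j) (ω j) y
    have t1 : 0 ≤ (if m j ≠ k then L (m j) (ω j) y * (if Bad (ω j) y then (1 : ℝ) else 0)
        else 0) := by split_ifs <;> simp [hl]
    have t2 : 0 ≤ L (m j) (ω j) y *
        (if (Bad (ω j) y ∧ m j ≠ k) ∨ Acc k (ω j) (y k) then (0 : ℝ) else 1) := by
      split_ifs <;> simp [hl]
    have t3 : ∀ j', 0 ≤ (if j' = j then 0
            else L (m j) (ω j) y * (if Acc k (ω j') (y k) then (1 : ℝ) else 0)) := by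
      intro j'; split_ifs <;> simp [hl]
    have t3s := sum_nonneg fun j' (_ : j' ∈ univ) => t3 j'
    by_cases hacc : Acc k (ω j) (y k)
    · have hex : ∃ j, Acc k (ω j) (y k) := ⟨j, hacc⟩
      rw [dif_pos hex]
      by_cases he : hex.choose = j
      · rw [if_pos he]; linarith
      · rw [if_neg he]
        have h5 := single_le_sum (fun j' _ => t3 j') (mem_univ hex.choose)
        rw [if_neg he, if_pos hex.choose_spec, mul_one] at h5
        linarith
    · refine (show _ ≤ L (m j) (ω j) y by split_ifs <;> simp [hl]).trans ?_
      by_cases hbad : Bad (ω j) y ∧ m j ≠ k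
      · have h6 : L (m j) (ω j) y ≤ (if m j ≠ k then L (m j) (ω j) y *
          (if Bad (ω j) y then (1 : ℝ) else 0) else 0) := by
          rw [if_pos hbad.2, if_pos hbad.1, mul_one]
        linarith
      · rw [if_neg (c := (Bad (ω j) y ∧ m j ≠ k) ∨ Acc k (ω j) (y k)) (by tauto), mul_one] at t2 ⊢
        linarith
  have hsumj : ∀ j, ∑ y, (if (if h : ∃ j, Acc k (ω j) (y k) then h.choose else ⟨0, hM⟩) = j then 0
        else L (m j) (ω j) y)
      ≤ (if m j ≠ k then a (ω j) else 0) + ∑ m, ∑ k, b m k (ω j)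
        + ∑ j', (if j' = j then 0 else ∑ m, ∑ k, D m k (ω j) (ω j')) := by
    intro j
    refine (sum_le_sum fun y _ => hterm j y).trans ?_
    rw [sum_add_distrib, sum_add_distrib]
    refine add_le_add (add_le_add ?_ ?_) ?_
    · split_ifs
      · rw [ha]
      · simp
    · exact le_sum_sum_bool (F := fun m k => b m k (ω j)) (fun m k => hb0 m k _) (m j) k
    · rw [sum_comm]
      refine sum_le_sum fun j' _ => ?_
      split_ifs
      · simp
      · exact le_sum_sum_bool (F := fun m k => D m k (ω j) (ω j')) (fun m k => hD0 m k _ _) (m j) k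
  refine (sum_le_sum fun j _ => hsumj j).trans ?_
  rw [sum_add_distrib, sum_add_distrib]
  have h7 := hm k
  rw [sum_add_distrib, ← sum_div] at hω
  have hMR : (1 : ℝ) ≤ M := by exact_mod_cast hM
  have h8 : (M : ℝ) * ∑ c, p c * (a c / 2 + ∑ m, ∑ k, b m k c) ≤ M * (α / 2 + 4 * β) :=
    mul_le_mul_of_nonneg_left hEA (by linarith)
  have h9 : (M : ℝ) * (M - 1) * ∑ c, ∑ c', p c * p c' * ∑ m, ∑ k, D m k c c'
      ≤ M * M * (4 * μ) := by
    refine mul_le_mul ?_ hEDs hEDs0 (by positivity)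
    nlinarith
  linarith

/-! ### Two-phase codes -/

lemma sum_bool_fun {α : Type*} [Fintype α] (F : α → α → ℝ) :
    ∑ y : Bool → α, F (y true) (y false) = ∑ a, ∑ b, F a b := by
  rw [← Fintype.sum_prod_type' F, ← (Equiv.prodComm α α).sum_comp,
    ← (Equiv.boolArrowEquivProd α).sum_comp]
  rfl

lemma sum_fun_prod {ι α β : Type*} [Fintype ι] [DecidableEq ι] [Fintype α] [Fintype β]
    (F : (ι → α) → (ι → β) → ℝ) :
    ∑ y : ι → α × β, F (fun k => (y k).1) (fun k => (y k).2) = ∑ a, ∑ b, F a b := by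
  rw [← Fintype.sum_prod_type' F,
    ← (Equiv.arrowProdEquivProdArrow ι (fun _ => α) (fun _ => β)).sum_comp]
  rfl

lemma sum_append {α : Type*} [Fintype α] {n1 n2 : ℕ} (F : (Fin (n1 + n2) → α) → ℝ) :
    ∑ y, F y = ∑ z : (Fin n1 → α) × (Fin n2 → α), F (Fin.append z.1 z.2) :=
  ((Fin.appendEquiv n1 n2).sum_comp F).symm

/-- Probability of the word `x` under independent letters with law `p`. -/
def seqProb {α : Type*} (p : α → ℝ) {n : ℕ} (x : Fin n → α) : ℝ := ∏ i, p (x i)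

/-- Probability of receiving `y` when `x` is sent without feedback. -/
def blockProb {α β : Type*} (w : α → β → ℝ) {n : ℕ} (x : Fin n → α) (y : Fin n → β) : ℝ :=
  ∏ i, w (x i) (y i)

lemma isDist_seqProb {α : Type*} [Fintype α] {p : α → ℝ} (hp : IsDist p) (n : ℕ) :
    IsDist (seqProb p (n := n)) :=
  ⟨fun _ => prod_nonneg fun _ _ => hp.1 _, sum_pi_prod_eq_one (p := fun _ : Fin n => p) fun _ => hp.2⟩

lemma IsChannel.blockProb {𝒳 : Type*} {W : 𝒳 → 𝒴 → ℝ} (hW : IsChannel W) {n : ℕ} (x : Fin n → 𝒳) :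
    IsDist (blockProb W x) :=
  ⟨fun _ => prod_nonneg fun _ _ => (hW _).1 _, sum_pi_prod_eq_one fun i => (hW (x i)).2⟩

lemma sum_seqProb_mul_blockProb {𝒴 : Type*} (P : 𝒳 → ℝ) (W : 𝒳 → 𝒴 → ℝ) {n : ℕ} (y : Fin n → 𝒴) :
    ∑ x : Fin n → 𝒳, seqProb P x * blockProb W x y = seqProb (outDist P W) y := by
  unfold seqProb blockProb outDist
  have h := Finset.prod_univ_sum (fun _ : Fin n => (univ : Finset 𝒳)) (fun i x => P x * W x (y i))
  rw [Fintype.piFinset_univ] at h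
  rw [h]
  exact sum_congr rfl fun x _ => prod_mul_distrib.symm

/-- Probability that the accumulated information density of one receiver is at most `θ`. -/
def infoTail (P : 𝒳 → ℝ) (W : 𝒳 → 𝒴 → ℝ) (n : ℕ) (θ : ℝ) : ℝ :=
  ∑ x : Fin n → 𝒳, seqProb P x * ∑ y, blockProb W x y *
    (if ∑ i, infoDens P W (x i) (y i) ≤ θ then 1 else 0)

lemma isDist_prod_bool {α : Type*} [Fintype α] {p : Bool → α → ℝ} (hp : ∀ k, IsDist (p k)) :
    IsDist (fun y : Bool → α => ∏ k, p k (y k)) :=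
  ⟨fun _ => prod_nonneg fun k _ => (hp k).1 _, sum_pi_prod_eq_one fun k => (hp k).2⟩

section TwoPhase

variable {ι : Type*} [Fintype ι] [DecidableEq ι] {n1 n2 : ℕ}

open Classical in
/-- The second phase is decoded incorrectly only if the accumulated information density is
too small. -/
lemma sum_missed_le {W : 𝒳 → 𝒴 → ℝ} (hW : IsChannel W) {P : 𝒳 → ℝ} (hP : ∀ x, 0 < P x)
    {Pt : 𝒳 → ℝ} (hPt : ∀ x, 0 < Pt x) {u : Fin n1 → 𝒳} {y : Fin n1 → 𝒴}
    (huy : blockProb W u y ≠ 0) (Γ : ℝ) :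
    ∑ w : Fin n2 → 𝒳, seqProb Pt w * ∑ y', blockProb W w y' *
        (if Real.exp Γ * (seqProb (outDist P W) y * seqProb (outDist Pt W) y')
          < blockProb W u y * blockProb W w y' then 0 else 1)
      ≤ infoTail Pt W n2 (Γ - ∑ i, infoDens P W (u i) (y i)) := by
  refine sum_le_sum fun w _ => mul_le_mul_of_nonneg_left (sum_le_sum fun y' _ => ?_)
    (prod_nonneg fun _ _ => (hPt _).le)
  by_cases hb : blockProb W w y' = 0
  · simp [hb]
  refine mul_le_mul_of_nonneg_left ?_ ((hW.blockProb w).1 y')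
  have h1 : ∀ i, W (u i) (y i) ≠ 0 := fun i => prod_ne_zero_iff.1 huy i (mem_univ i)
  have h2 : ∀ i, W (w i) (y' i) ≠ 0 := fun i => prod_ne_zero_iff.1 hb i (mem_univ i)
  have e1 : blockProb W u y = _ := hW.prod_eq hP h1
  have e2 : blockProb W w y' = _ := hW.prod_eq hPt h2
  have q1 : 0 < seqProb (outDist P W) y := prod_pos fun i _ => hW.outDist_pos hP (h1 i)
  have q2 : 0 < seqProb (outDist Pt W) y' := prod_pos fun i _ => hW.outDist_pos hPt (h2 i)
  by_cases ht : ∑ i, infoDens Pt W (w i) (y' i) ≤ Γ - ∑ i, infoDens P W (u i) (y i)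
  · rw [if_pos ht]
    split_ifs <;> norm_num
  · rw [if_neg ht, if_pos]
    push Not at ht
    rw [e1, e2]
    change _ < seqProb (outDist P W) y * _ * (seqProb (outDist Pt W) y' * _)
    rw [mul_mul_mul_comm, ← Real.exp_add, mul_comm]
    refine mul_lt_mul_of_pos_left (Real.exp_lt_exp.2 (by linarith)) (mul_pos q1 q2)

/-- Law of the two output pairs of a two-phase transmission. -/
def twoPhaseLaw (W : Bool → 𝒳 → 𝒴 → ℝ)
    (τ : Bool → (Fin n1 → 𝒳) → (Bool → Fin n1 → 𝒴) → ι) (m : Bool)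
    (c : (Fin n1 → 𝒳) × (ι → Fin n2 → 𝒳)) (y : Bool → (Fin n1 → 𝒴) × (Fin n2 → 𝒴)) : ℝ :=
  (∏ k, blockProb (W k) c.1 (y k).1) *
    ∏ k, blockProb (W k) (c.2 (τ m c.1 fun k => (y k).1)) (y k).2

lemma sum_twoPhaseLaw {𝒳 ι : Type*} (W : Bool → 𝒳 → 𝒴 → ℝ)
    (τ : Bool → (Fin n1 → 𝒳) → (Bool → Fin n1 → 𝒴) → ι) (m : Bool)
    (c : (Fin n1 → 𝒳) × (ι → Fin n2 → 𝒳))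
    (G : (Bool → Fin n1 → 𝒴) → (Bool → Fin n2 → 𝒴) → ℝ) :
    ∑ y, twoPhaseLaw W τ m c y * G (fun k => (y k).1) (fun k => (y k).2)
      = ∑ a : Bool → Fin n1 → 𝒴, (∏ k, blockProb (W k) c.1 (a k)) *
        ∑ b : Bool → Fin n2 → 𝒴, (∏ k, blockProb (W k) (c.2 (τ m c.1 a)) (b k)) * G a b := by
  simp_rw [mul_sum]
  rw [← sum_fun_prod]
  exact sum_congr rfl fun y _ => mul_assoc _ _ _

/-- A two-mode code for two-phase transmission yields a feedback code. -/
lemma flfExists_of_twoPhase {𝒳 ι : Type*} (W : Bool → 𝒳 → 𝒴 → ℝ)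
    (τ : Bool → (Fin n1 → 𝒳) → (Bool → Fin n1 → 𝒴) → ι) {M : ℕ} {ε : ℝ}
    (ω : Fin M → (Fin n1 → 𝒳) × (ι → Fin n2 → 𝒳)) (m : Fin M → Bool)
    (g : Bool → (Fin n1 → 𝒴) × (Fin n2 → 𝒴) → Fin M)
    (h : ∀ k, ∑ j, ∑ y, (if g k (y k) = j then 0 else twoPhaseLaw W τ (m j) (ω j) y) ≤ M * ε)
    (hM : 0 < M) :
    FLFExists (W true) (W false) (n1 + n2) M ε := by
  have hMR : (0 : ℝ) < M := by exact_mod_cast hM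
  set f : Fin M → (Fin (n1 + n2) → 𝒴) → (Fin (n1 + n2) → 𝒴) → Fin (n1 + n2) → 𝒳 :=
    fun j y1 y2 => Fin.append (ω j).1 ((ω j).2 (τ (m j) (ω j).1
      fun k i => (if k then y1 else y2) (Fin.castAdd n2 i))) with hf
  have hlaw : ∀ j (y : Bool → (Fin n1 → 𝒴) × (Fin n2 → 𝒴)),
      codeLaw (W true) (W false) (n1 + n2) M f j (Fin.append (y true).1 (y true).2)
        (Fin.append (y false).1 (y false).2) = 1 / M * twoPhaseLaw W τ (m j) (ω j) y := by
    intro j y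
    have hy : (fun (k : Bool) (i : Fin n1) => (if k then Fin.append (y true).1 (y true).2
        else Fin.append (y false).1 (y false).2) (Fin.castAdd n2 i)) = fun k => (y k).1 := by
      funext k i
      cases k <;> simp
    simp only [codeLaw, hf, twoPhaseLaw, hy, Fin.prod_univ_add, Fin.append_left, Fin.append_right,
      Fintype.prod_bool, blockProb, prod_mul_distrib]
    ring
  have hsum : ∀ F : (Fin (n1 + n2) → 𝒴) → (Fin (n1 + n2) → 𝒴) → ℝ, ∑ y1, ∑ y2, F y1 y2
      = ∑ y : Bool → (Fin n1 → 𝒴) × (Fin n2 → 𝒴), F (Fin.append (y true).1 (y true).2)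
        (Fin.append (y false).1 (y false).2) := by
    intro F
    rw [sum_append]
    simp_rw [sum_append (n1 := n1) (n2 := n2) (F (Fin.append _ _))]
    rw [← sum_bool_fun]
  have hap : ∀ z : (Fin n1 → 𝒴) × (Fin n2 → 𝒴),
      ((fun i => Fin.append z.1 z.2 (Fin.castAdd n2 i)),
        fun i => Fin.append z.1 z.2 (Fin.natAdd n1 i)) = z := by
    intro z; simp
  have hmul : ∀ F : Fin M → (Bool → (Fin n1 → 𝒴) × (Fin n2 → 𝒴)) → ℝ, ∀ k,
      ∑ j, ∑ y, (if g k (y k) = j then 0 else 1 / (M : ℝ) * F j y)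
        = 1 / M * ∑ j, ∑ y, (if g k (y k) = j then 0 else F j y) := by
    intro F k
    simp_rw [mul_sum, mul_ite, mul_zero]
  refine ⟨f, ?_, fun y => g true (fun i => y (Fin.castAdd n2 i), fun i => y (Fin.natAdd n1 i)),
    fun y => g false (fun i => y (Fin.castAdd n2 i), fun i => y (Fin.natAdd n1 i)), ?_, ?_⟩
  · intro j y1 y1' y2 y2' i h1 h2
    induction i using Fin.addCases with
    | left i => simp [hf]
    | right i =>
      simp only [hf, Fin.append_right]
      have hlt : ∀ t : Fin n1, Fin.castAdd n2 t < Fin.natAdd n1 i := fun t => by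
        rw [Fin.lt_def]
        simp only [Fin.val_castAdd, Fin.val_natAdd]
        omega
      have hfun : (fun (k : Bool) (t : Fin n1) => (if k then y1 else y2) (Fin.castAdd n2 t))
          = fun k t => (if k then y1' else y2') (Fin.castAdd n2 t) := by
        funext k t
        cases k
        · exact h2 _ (hlt t)
        · exact h1 _ (hlt t)
      rw [hfun]
  · unfold errProb1
    simp_rw [hsum, hlaw, hap]
    rw [hmul, one_div, inv_mul_le_iff₀ hMR]
    exact h true
  · unfold errProb2
    simp_rw [hsum, hlaw, hap]
    rw [hmul, one_div, inv_mul_le_iff₀ hMR]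
    exact h false

/-- Law of the random codeword: i.i.d. with law `P` in the first phase, and for each tilt `t`
i.i.d. with law `Pt t` in the second phase. -/
def codewordProb {𝒳 : Type*} (P : 𝒳 → ℝ) (Pt : ι → 𝒳 → ℝ)
    (c : (Fin n1 → 𝒳) × (ι → Fin n2 → 𝒳)) : ℝ :=
  seqProb P c.1 * ∏ t, seqProb (Pt t) (c.2 t)

lemma sum_tilt_marginal {Pt : ι → 𝒳 → ℝ} (hPt : ∀ t, IsDist (Pt t)) (t : ι)
    (G : (Fin n2 → 𝒳) → ℝ) :
    ∑ v : ι → Fin n2 → 𝒳, (∏ t, seqProb (Pt t) (v t)) * G (v t)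
      = ∑ w, seqProb (Pt t) w * G w :=
  sum_pi_marginal (fun s => (isDist_seqProb (hPt s) n2).2) t G

lemma sum_codewordProb (P : 𝒳 → ℝ) (Pt : ι → 𝒳 → ℝ)
    (G : (Fin n1 → 𝒳) → (ι → Fin n2 → 𝒳) → ℝ) :
    ∑ c, codewordProb P Pt c * G c.1 c.2
      = ∑ u, seqProb P u * ∑ v, (∏ t, seqProb (Pt t) (v t)) * G u v := by
  rw [Fintype.sum_prod_type]
  refine sum_congr rfl fun u _ => ?_
  rw [mul_sum]
  exact sum_congr rfl fun v _ => mul_assoc _ _ _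

lemma isDist_codewordProb {P : 𝒳 → ℝ} (hP : IsDist P) {Pt : ι → 𝒳 → ℝ}
    (hPt : ∀ t, IsDist (Pt t)) : IsDist (codewordProb P Pt (n1 := n1) (n2 := n2)) := by
  refine ⟨fun c => mul_nonneg ((isDist_seqProb hP n1).1 _)
    (prod_nonneg fun t _ => (isDist_seqProb (hPt t) n2).1 _), ?_⟩
  have h := sum_codewordProb (n1 := n1) (n2 := n2) P Pt fun _ _ => 1
  simp only [mul_one, sum_pi_prod_eq_one fun t => (isDist_seqProb (hPt t) n2).2,
    (isDist_seqProb hP n1).2] at h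
  exact h

/-- Acceptance rule: for some tilt, the codeword has a large likelihood ratio. -/
def Accepts (P : 𝒳 → ℝ) (Pt : ι → 𝒳 → ℝ) (W : 𝒳 → 𝒴 → ℝ) (Γ : ℝ)
    (c : (Fin n1 → 𝒳) × (ι → Fin n2 → 𝒳)) (y : (Fin n1 → 𝒴) × (Fin n2 → 𝒴)) : Prop :=
  ∃ t, Real.exp Γ * (seqProb (outDist P W) y.1 * seqProb (outDist (Pt t) W) y.2)
    < blockProb W c.1 y.1 * blockProb W (c.2 t) y.2

open Classical in
lemma sum_accepts_le {W : 𝒳 → 𝒴 → ℝ} (hW : IsChannel W) {P : 𝒳 → ℝ} (hP : IsDist P)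
    {Pt : ι → 𝒳 → ℝ} (hPt : ∀ t, IsDist (Pt t)) (Γ : ℝ) (y : (Fin n1 → 𝒴) × (Fin n2 → 𝒴)) :
    ∑ c, codewordProb P Pt c * (if Accepts P Pt W Γ c y then 1 else 0)
      ≤ Fintype.card ι * Real.exp (-Γ) := by
  have hpd := isDist_codewordProb (n1 := n1) (n2 := n2) hP hPt
  set Λ : ι → ℝ := fun t => seqProb (outDist P W) y.1 * seqProb (outDist (Pt t) W) y.2 with hΛ
  set l : ι → (Fin n1 → 𝒳) × (ι → Fin n2 → 𝒳) → ℝ :=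
    fun t c => blockProb W c.1 y.1 * blockProb W (c.2 t) y.2 with hl
  have hone : ∀ t, ∑ c, codewordProb P Pt c * (if Real.exp Γ * Λ t < l t c then 1 else 0)
      ≤ Real.exp (-Γ) := by
    intro t
    rw [Real.exp_neg, ← one_div]
    refine sum_likelihood_le hpd.1
      (fun c => mul_nonneg ((hW.blockProb _).1 _) ((hW.blockProb _).1 _)) (Real.exp_pos Γ) ?_
    rw [sum_codewordProb P Pt fun u v => blockProb W u y.1 * blockProb W (v t) y.2]
    have h : ∀ u : Fin n1 → 𝒳, ∑ v : ι → Fin n2 → 𝒳, (∏ s, seqProb (Pt s) (v s)) *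
        (blockProb W u y.1 * blockProb W (v t) y.2)
        = ∑ w, seqProb (Pt t) w * (blockProb W u y.1 * blockProb W w y.2) := fun u =>
      sum_tilt_marginal hPt t fun w => blockProb W u y.1 * blockProb W w y.2
    simp_rw [h, hΛ, ← sum_seqProb_mul_blockProb, sum_mul_sum, mul_sum]
    refine sum_congr rfl fun u _ => sum_congr rfl fun w _ => ?_
    ring
  calc ∑ c, codewordProb P Pt c * (if Accepts P Pt W Γ c y then (1 : ℝ) else 0)
      ≤ ∑ c, codewordProb P Pt c * ∑ t, (if Real.exp Γ * Λ t < l t c then 1 else 0) := by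
        refine sum_le_sum fun c _ => mul_le_mul_of_nonneg_left ?_ (hpd.1 c)
        by_cases hacc : Accepts P Pt W Γ c y
        · obtain ⟨t, ht⟩ := id hacc
          rw [if_pos hacc]
          refine le_trans ?_ (single_le_sum (fun t _ => ?_) (mem_univ t))
          · rw [if_pos ht]
          · split_ifs <;> norm_num
        · rw [if_neg hacc]
          exact sum_nonneg fun t _ => by split_ifs <;> norm_num
    _ = ∑ t, ∑ c, codewordProb P Pt c * (if Real.exp Γ * Λ t < l t c then 1 else 0) := by
        simp_rw [mul_sum]
        rw [sum_comm]
    _ ≤ ∑ _t : ι, Real.exp (-Γ) := sum_le_sum fun t _ => hone t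
    _ = _ := by rw [sum_const, card_univ, nsmul_eq_mul]

open Classical in
lemma sum_rejected_le {W : Bool → 𝒳 → 𝒴 → ℝ} (hW : ∀ k, IsChannel (W k))
    {P : 𝒳 → ℝ} (hP : ∀ x, 0 < P x) {Pt : ι → 𝒳 → ℝ} (hPt : ∀ t x, 0 < Pt t x)
    (hPt1 : ∀ t, ∑ x, Pt t x = 1) {u : Fin n1 → 𝒳} {a : Bool → Fin n1 → 𝒴} (t : ι) (k : Bool)
    (hz : blockProb (W k) u (a k) ≠ 0) (Γ : ℝ) :
    ∑ v : ι → Fin n2 → 𝒳, (∏ s, seqProb (Pt s) (v s)) *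
      ∑ b : Bool → Fin n2 → 𝒴, (∏ k, blockProb (W k) (v t) (b k)) *
        (if Accepts P Pt (W k) Γ (u, v) (a k, b k) then 0 else 1)
      ≤ infoTail (Pt t) (W k) n2 (Γ - ∑ i, infoDens P (W k) (u i) (a k i)) := by
  have hPtd : ∀ t, IsDist (Pt t) := fun t => ⟨fun x => (hPt t x).le, hPt1 t⟩
  refine le_trans ?_ (sum_missed_le (hW k) hP (hPt t) hz Γ)
  rw [← sum_tilt_marginal hPtd t fun w => ∑ y', blockProb (W k) w y' *
    (if Real.exp Γ * (seqProb (outDist P (W k)) (a k) * seqProb (outDist (Pt t) (W k)) y')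
      < blockProb (W k) u (a k) * blockProb (W k) w y' then 0 else 1)]
  refine sum_le_sum fun v _ => mul_le_mul_of_nonneg_left ?_
    (prod_nonneg fun s _ => (isDist_seqProb (hPtd s) n2).1 _)
  rw [← sum_pi_marginal (p := fun k => blockProb (W k) (v t))
    (fun k => ((hW k).blockProb _).2) k]
  refine sum_le_sum fun b _ => mul_le_mul_of_nonneg_left ?_
    ((isDist_prod_bool fun k => (hW k).blockProb (v t)).1 b)
  by_cases hacc : Real.exp Γ * (seqProb (outDist P (W k)) (a k) *
      seqProb (outDist (Pt t) (W k)) (b k))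
      < blockProb (W k) u (a k) * blockProb (W k) (v t) (b k)
  · rw [if_pos hacc, if_pos]
    exact ⟨t, hacc⟩
  · rw [if_neg hacc]
    split_ifs <;> norm_num

open Classical in
/-- Achievability for two-phase codes. -/
lemma flfExists_twoPhase {W : Bool → 𝒳 → 𝒴 → ℝ} (hW : ∀ k, IsChannel (W k))
    {P : 𝒳 → ℝ} (hP : ∀ x, 0 < P x) (hP1 : ∑ x, P x = 1)
    {Pt : ι → 𝒳 → ℝ} (hPt : ∀ t x, 0 < Pt t x) (hPt1 : ∀ t, ∑ x, Pt t x = 1)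
    (τ : Bool → (Fin n1 → 𝒳) → (Bool → Fin n1 → 𝒴) → ι)
    (Bad : (Fin n1 → 𝒳) → (Bool → Fin n1 → 𝒴) → Prop) {α β Γ ε : ℝ}
    (hα : ∑ u : Fin n1 → 𝒳, seqProb P u * ∑ y : Bool → Fin n1 → 𝒴,
      (∏ k, blockProb (W k) u (y k)) * (if Bad u y then 1 else 0) ≤ α)
    (hβ : ∀ m k, ∑ u : Fin n1 → 𝒳, seqProb P u * ∑ y : Bool → Fin n1 → 𝒴,
      (∏ k, blockProb (W k) u (y k)) * (if Bad u y ∧ m ≠ k then 0 else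
        infoTail (Pt (τ m u y)) (W k) n2 (Γ - ∑ i, infoDens P (W k) (u i) (y k i))) ≤ β)
    {M : ℕ} (hM : 0 < M)
    (hε : α / 2 + 4 * β + 4 * (M * (Fintype.card ι * Real.exp (-Γ))) + 1 / M ≤ ε) :
    FLFExists (W true) (W false) (n1 + n2) M ε := by
  have hMR : (0 : ℝ) < M := by exact_mod_cast hM
  have hPd : IsDist P := ⟨fun x => (hP x).le, hP1⟩
  have hPtd : ∀ t, IsDist (Pt t) := fun t => ⟨fun x => (hPt t x).le, hPt1 t⟩
  have hpv1 : ∑ v : ι → Fin n2 → 𝒳, ∏ t, seqProb (Pt t) (v t) = 1 :=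
    sum_pi_prod_eq_one fun t => (isDist_seqProb (hPtd t) n2).2
  have hblock : ∀ n (x : Fin n → 𝒳), IsDist fun y : Bool → Fin n → 𝒴 =>
      ∏ k, blockProb (W k) x (y k) := fun n x => isDist_prod_bool fun k => (hW k).blockProb x
  have hrej : ∀ m k, ∑ c : (Fin n1 → 𝒳) × (ι → Fin n2 → 𝒳), codewordProb P Pt c * ∑ y, twoPhaseLaw W τ m c y *
      (if ((Bad c.1 fun k => (y k).1) ∧ m ≠ k) ∨ Accepts P Pt (W k) Γ c (y k) then 0 else 1)
      ≤ β := by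
    intro m k
    refine le_trans ?_ (hβ m k)
    calc ∑ c : (Fin n1 → 𝒳) × (ι → Fin n2 → 𝒳),
            codewordProb P Pt c * ∑ y, twoPhaseLaw W τ m c y *
            (if ((Bad c.1 fun k => (y k).1) ∧ m ≠ k) ∨ Accepts P Pt (W k) Γ c (y k) then 0 else 1)
        = ∑ u, seqProb P u * ∑ v, (∏ t, seqProb (Pt t) (v t)) *
            ∑ a : Bool → Fin n1 → 𝒴, (∏ k, blockProb (W k) u (a k)) *
            ∑ b : Bool → Fin n2 → 𝒴, (∏ k, blockProb (W k) (v (τ m u a)) (b k)) *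
            (if (Bad u a ∧ m ≠ k) ∨ Accepts P Pt (W k) Γ (u, v) (a k, b k) then 0 else 1) := by
          rw [← sum_codewordProb]
          refine sum_congr rfl fun c _ => ?_
          rw [← sum_twoPhaseLaw W τ m c fun a b =>
            if (Bad c.1 a ∧ m ≠ k) ∨ Accepts P Pt (W k) Γ c (a k, b k) then 0 else 1]
      _ = ∑ u, seqProb P u * ∑ a : Bool → Fin n1 → 𝒴, (∏ k, blockProb (W k) u (a k)) *
            ∑ v, (∏ t, seqProb (Pt t) (v t)) *
            ∑ b : Bool → Fin n2 → 𝒴, (∏ k, blockProb (W k) (v (τ m u a)) (b k)) *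
            (if (Bad u a ∧ m ≠ k) ∨ Accepts P Pt (W k) Γ (u, v) (a k, b k) then 0 else 1) := by
          refine sum_congr rfl fun u _ => congrArg _ ?_
          simp_rw [mul_sum]
          rw [sum_comm]
          refine sum_congr rfl fun a _ => sum_congr rfl fun v _ => sum_congr rfl fun b _ => ?_
          ring
      _ ≤ _ := by
          refine sum_le_sum fun u _ => mul_le_mul_of_nonneg_left (sum_le_sum fun a _ => ?_)
            ((isDist_seqProb hPd n1).1 u)
          by_cases hz : ∏ k, blockProb (W k) u (a k) = 0
          · rw [hz, zero_mul, zero_mul]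
          refine mul_le_mul_of_nonneg_left ?_ ((hblock n1 u).1 a)
          by_cases hbad : Bad u a ∧ m ≠ k
          · simp [hbad]
          · simp only [hbad, false_or, if_false]
            exact sum_rejected_le hW hP hPt hPt1 (τ m u a) k
              (prod_ne_zero_iff.1 hz k (mem_univ k)) Γ
  obtain ⟨ω, m, g, hg⟩ := exists_two_mode_code
    (isDist_codewordProb (n1 := n1) (n2 := n2) hPd hPtd) (L := twoPhaseLaw W τ)
    (fun m c y => mul_nonneg (prod_nonneg fun k _ => ((hW k).blockProb _).1 _)
      (prod_nonneg fun k _ => ((hW k).blockProb _).1 _))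
    (fun m c => by
      have h := sum_twoPhaseLaw W τ m c fun _ _ => 1
      simp_rw [mul_one, (hblock n2 _).2, mul_one, (hblock n1 _).2] at h
      exact h)
    (Bad := fun c y => Bad c.1 fun k => (y k).1)
    (a := fun c => ∑ a : Bool → Fin n1 → 𝒴, (∏ k, blockProb (W k) c.1 (a k)) *
      (if Bad c.1 a then 1 else 0))
    (fun m c => by
      have h := sum_twoPhaseLaw W τ m c fun a _ => if Bad c.1 a then 1 else 0
      simp_rw [← sum_mul, (hblock n2 _).2, one_mul] at h
      exact h)
    (Acc := fun k c y => Accepts P Pt (W k) Γ c y) (α := α)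
    (by
      rw [sum_codewordProb P Pt fun u _ => ∑ a : Bool → Fin n1 → 𝒴,
        (∏ k, blockProb (W k) u (a k)) * (if Bad u a then 1 else 0)]
      simp_rw [← sum_mul, hpv1, one_mul]
      exact hα)
    hrej (fun k y => sum_accepts_le (hW k) hPd hPtd Γ y) hM
  refine flfExists_of_twoPhase W τ ω m g (fun k => (hg k).trans ?_) hM
  have h1 : (M : ℝ) * (1 / M) = 1 := by field_simp
  have h2 := mul_le_mul_of_nonneg_left hε hMR.le
  rw [mul_add, h1] at h2
  exact h2

end TwoPhase

section Perturbation

variable {W : 𝒳 → 𝒴 → ℝ} {P : 𝒳 → ℝ}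

lemma mutInfo_eq_sum_relEnt (P : 𝒳 → ℝ) (W : 𝒳 → 𝒴 → ℝ) :
    mutInfo P W = ∑ x, P x * relEnt (W x) (outDist P W) := by
  unfold mutInfo relEnt
  simp_rw [mul_sum, mul_assoc]

lemma sum_mul_relEnt_eq (hW : IsChannel W) (hP : ∀ x, 0 < P x) {P' : 𝒳 → ℝ} (hP' : IsDist P') :
    ∑ x, P' x * relEnt (W x) (outDist P W)
      = mutInfo P' W + relEnt (outDist P' W) (outDist P W) := by
  have h : relEnt (outDist P' W) (outDist P W)
      = ∑ x, ∑ y, P' x * W x y * Real.log (outDist P' W y / outDist P W y) := by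
    rw [sum_comm]
    refine sum_congr rfl fun y _ => ?_
    rw [← sum_mul]
    rfl
  rw [h, mutInfo, ← sum_add_distrib]
  refine sum_congr rfl fun x _ => ?_
  rw [relEnt, mul_sum, ← sum_add_distrib]
  refine sum_congr rfl fun y _ => ?_
  by_cases hx : P' x = 0
  · simp [hx]
  by_cases hy : W x y = 0
  · simp [hy]
  have hx0 : 0 < P' x := lt_of_le_of_ne (hP'.1 x) (Ne.symm hx)
  have hy0 : 0 < W x y := lt_of_le_of_ne ((hW x).1 y) (Ne.symm hy)
  have hq := hW.outDist_pos hP hy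
  have hq' : 0 < outDist P' W y := lt_of_lt_of_le (mul_pos hx0 hy0)
    (single_le_sum (f := fun x => P' x * W x y)
      (fun x _ => mul_nonneg (hP'.1 x) ((hW x).1 y)) (mem_univ x))
  rw [Real.log_div hy0.ne' hq.ne', Real.log_div hy0.ne' hq'.ne', Real.log_div hq'.ne' hq.ne']
  ring

lemma relEnt_nonneg {p q : 𝒴 → ℝ} (hp : IsDist p) (hq : IsDist q)
    (h : ∀ y, q y = 0 → p y = 0) : 0 ≤ relEnt p q := by
  have h1 : ∑ y, (p y - q y) ≤ relEnt p q := by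
    refine sum_le_sum fun y _ => ?_
    rcases (hp.1 y).eq_or_lt with h0 | h0
    · rw [← h0]
      simpa using hq.1 y
    have hq0 : 0 < q y := lt_of_le_of_ne (hq.1 y) fun hz => h0.ne' (h y hz.symm)
    have h2 := Real.one_sub_inv_le_log_of_pos (div_pos h0 hq0)
    have h3 := mul_le_mul_of_nonneg_left h2 h0.le
    rwa [inv_div, mul_sub, mul_one, mul_div_cancel₀ _ h0.ne'] at h3
  rw [sum_sub_distrib, hp.2, hq.2] at h1
  linarith

lemma relEnt_le {p q : 𝒴 → ℝ} (hp : IsDist p) (hq : IsDist q)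
    (h : ∀ y, q y = 0 → p y = 0) : relEnt p q ≤ ∑ y, (p y - q y) ^ 2 / q y := by
  have h1 : relEnt p q ≤ ∑ y, ((p y - q y) ^ 2 / q y + (p y - q y)) := by
    refine sum_le_sum fun y _ => ?_
    rcases (hq.1 y).eq_or_lt with h0 | h0
    · rw [h y h0.symm, ← h0]
      simp
    rcases (hp.1 y).eq_or_lt with h2 | h2
    · rw [← h2]
      field_simp
      simp
    have h3 := mul_le_mul_of_nonneg_left (Real.log_le_sub_one_of_pos (div_pos h2 h0)) h2.le
    refine h3.trans (le_of_eq ?_)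
    field_simp
    ring
  rw [sum_add_distrib, sum_sub_distrib, hp.2, hq.2] at h1
  linarith

lemma IsChannel.outDist_isDist (hW : IsChannel W) {P : 𝒳 → ℝ} (hP : IsDist P) :
    IsDist (outDist P W) :=
  ⟨fun y => sum_nonneg fun x _ => mul_nonneg (hP.1 x) ((hW x).1 y), hW.sum_outDist hP.2⟩

lemma IsChannel.outDist_eq_zero (hW : IsChannel W) (hP : ∀ x, 0 < P x) (P' : 𝒳 → ℝ) {y : 𝒴}
    (hy : outDist P W y = 0) : outDist P' W y = 0 :=
  sum_eq_zero fun x _ => by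
    by_cases h : W x y = 0
    · simp [h]
    · exact absurd hy (hW.outDist_pos hP h).ne'

/-- Mutual information is dominated by its linearization at an interior input distribution. -/
lemma mutInfo_le_sum_relEnt (hW : IsChannel W) (hP : ∀ x, 0 < P x) (hP1 : ∑ x, P x = 1)
    {P' : 𝒳 → ℝ} (hP' : IsDist P') :
    mutInfo P' W ≤ ∑ x, P' x * relEnt (W x) (outDist P W) := by
  rw [sum_mul_relEnt_eq hW hP hP']
  linarith [relEnt_nonneg (hW.outDist_isDist hP')
    (hW.outDist_isDist ⟨fun x => (hP x).le, hP1⟩) fun y => hW.outDist_eq_zero hP P']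

/-- Second-order lower bound for the mutual information along a direction. -/
lemma exists_mutInfo_perturb (hW : IsChannel W) (hP : ∀ x, 0 < P x) (hP1 : ∑ x, P x = 1)
    {v : 𝒳 → ℝ} (hv : ∑ x, v x = 0) :
    ∃ c, 0 ≤ c ∧ ∀ δ : ℝ, (∀ x, 0 < P x + δ * v x) →
      mutInfo P W + δ * gradI P W v - c * δ ^ 2 ≤ mutInfo (fun x => P x + δ * v x) W := by
  have hQ := hW.outDist_isDist (P := P) ⟨fun x => (hP x).le, hP1⟩
  refine ⟨∑ y, outDist v W y ^ 2 / outDist P W y,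
    sum_nonneg fun y _ => div_nonneg (sq_nonneg _) (hQ.1 y), fun δ hδ => ?_⟩
  have hP' : IsDist fun x => P x + δ * v x := ⟨fun x => (hδ x).le, by
    rw [sum_add_distrib, ← mul_sum, hP1, hv]; simp⟩
  have hout : ∀ y, outDist (fun x => P x + δ * v x) W y
      = outDist P W y + δ * outDist v W y := by
    intro y
    unfold outDist
    rw [mul_sum, ← sum_add_distrib]
    exact sum_congr rfl fun x _ => by ring
  have h1 := sum_mul_relEnt_eq hW hP hP'
  have h2 := relEnt_le (hW.outDist_isDist hP') hQ fun y => hW.outDist_eq_zero hP _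
  have h3 : ∑ y, (outDist (fun x => P x + δ * v x) W y - outDist P W y) ^ 2 / outDist P W y
      = (∑ y, outDist v W y ^ 2 / outDist P W y) * δ ^ 2 := by
    rw [sum_mul]
    refine sum_congr rfl fun y _ => ?_
    rw [hout]
    ring
  have h4 : ∑ x, (P x + δ * v x) * relEnt (W x) (outDist P W)
      = mutInfo P W + δ * gradI P W v := by
    rw [mutInfo_eq_sum_relEnt, gradI, mul_sum, ← sum_add_distrib]
    exact sum_congr rfl fun x _ => by ring
  rw [h4] at h1
  linarith

/-- The information density is bounded uniformly over inputs that dominate half of `P`. -/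
lemma exists_infoDens_bound (hW : IsChannel W) (hP : ∀ x, 0 < P x) :
    ∃ B, 0 ≤ B ∧ ∀ P' : 𝒳 → ℝ, IsDist P' → (∀ x, P x / 2 ≤ P' x) →
      ∀ x y, W x y ≠ 0 → |infoDens P' W x y| ≤ B := by
  refine ⟨∑ z : 𝒳 × 𝒴, (|Real.log (W z.1 z.2)| + |Real.log (2 / P z.1)|),
    sum_nonneg fun z _ => by positivity, fun P' hP' hle x y hy => ?_⟩
  refine le_trans ?_ (single_le_sum
    (f := fun z : 𝒳 × 𝒴 => |Real.log (W z.1 z.2)| + |Real.log (2 / P z.1)|)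
    (fun z _ => by positivity) (mem_univ (x, y)))
  have hpos : ∀ x, 0 < P' x := fun x => lt_of_lt_of_le (half_pos (hP x)) (hle x)
  have hy0 : 0 < W x y := lt_of_le_of_ne ((hW x).1 y) (Ne.symm hy)
  have hq := hW.outDist_pos hpos hy
  have hd := hW.outDist_isDist hP'
  have hq1 : outDist P' W y ≤ 1 := hd.2 ▸ single_le_sum (fun y _ => hd.1 y) (mem_univ y)
  have hq2 : P x / 2 * W x y ≤ outDist P' W y :=
    (mul_le_mul_of_nonneg_right (hle x) hy0.le).trans (hW.mul_le_outDist hpos x y)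
  have h1 : infoDens P' W x y ≤ Real.log (2 / P x) := by
    refine Real.log_le_log (div_pos hy0 hq) ?_
    have := hP x
    rw [div_le_div_iff₀ hq this]
    linarith
  have h2 : Real.log (W x y) ≤ infoDens P' W x y := by
    refine Real.log_le_log hy0 ?_
    rw [le_div_iff₀ hq]
    exact mul_le_of_le_one_right hy0.le hq1
  rw [abs_le]
  constructor
  · linarith [neg_abs_le (Real.log (W x y)), abs_nonneg (Real.log (2 / P x))]
  · linarith [le_abs_self (Real.log (2 / P x)), abs_nonneg (Real.log (W x y))]

end Perturbation

/-- At a max-min input distribution, no user has slack if each user could do better alone. -/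
lemma mutInfo_le_of_maxmin {W1 W2 : 𝒳 → 𝒴 → ℝ} (hW1 : IsChannel W1) (hW2 : IsChannel W2)
    {P : 𝒳 → ℝ} (hP : ∀ x, 0 < P x) (hP1 : ∑ x, P x = 1) {C : ℝ}
    (hmax : ∀ P', IsDist P' → min (mutInfo P' W1) (mutInfo P' W2) ≤ C)
    (hbetter : ∃ P', IsDist P' ∧ C < mutInfo P' W2) (h2 : mutInfo P W2 = C) :
    mutInfo P W1 ≤ C := by
  by_contra! h1
  have hgrad : ∀ v : 𝒳 → ℝ, ∑ x, v x = 0 → gradI P W2 v ≤ 0 := by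
    intro v hv
    by_contra! hg
    obtain ⟨c1, -, hc1⟩ := exists_mutInfo_perturb hW1 hP hP1 hv
    obtain ⟨c2, -, hc2⟩ := exists_mutInfo_perturb hW2 hP hP1 hv
    have e1 : ∀ᶠ δ in nhds (0 : ℝ), ∀ x, 0 < P x + δ * v x := by
      rw [Filter.eventually_all]
      intro x
      have : Continuous fun δ : ℝ => P x + δ * v x := by fun_prop
      exact (this.tendsto 0).eventually_const_lt (by simpa using hP x)
    have e2 : ∀ᶠ δ in nhds (0 : ℝ), C < mutInfo P W1 + δ * gradI P W1 v - c1 * δ ^ 2 := by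
      have : Continuous fun δ : ℝ => mutInfo P W1 + δ * gradI P W1 v - c1 * δ ^ 2 := by fun_prop
      exact (this.tendsto 0).eventually_const_lt (by simpa using h1)
    have e3 : ∀ᶠ δ in nhds (0 : ℝ), 0 < gradI P W2 v - c2 * δ := by
      have : Continuous fun δ : ℝ => gradI P W2 v - c2 * δ := by fun_prop
      exact (this.tendsto 0).eventually_const_lt (by simpa using hg)
    obtain ⟨δ, ⟨⟨hδ1, hδ2⟩, hδ3⟩, hδ0⟩ := ((((e1.and e2).and e3).filter_mono
      nhdsWithin_le_nhds).and self_mem_nhdsWithin : ∀ᶠ δ in nhdsWithin (0 : ℝ) (Set.Ioi 0), _).exists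
    have hδ0 : 0 < δ := hδ0
    refine absurd (hmax (fun x => P x + δ * v x) ⟨fun x => (hδ1 x).le, by
      rw [sum_add_distrib, ← mul_sum, hP1, hv]; simp⟩) (not_le.2 (lt_min ?_ ?_))
    · exact hδ2.trans_le (hc1 δ hδ1)
    · refine lt_of_lt_of_le ?_ (hc2 δ hδ1)
      rw [h2]
      nlinarith [mul_pos hδ0 hδ3]
  obtain ⟨P', hP', hlt⟩ := hbetter
  have h3 := hgrad (fun x => P' x - P x) (by rw [sum_sub_distrib, hP'.2, hP1, sub_self])
  have h4 := mutInfo_le_sum_relEnt hW2 hP hP1 hP'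
  rw [gradI] at h3
  simp_rw [sub_mul, sum_sub_distrib] at h3
  rw [← mutInfo_eq_sum_relEnt, h2] at h3
  linarith

lemma maxmin_structure {W1 W2 : 𝒳 → 𝒴 → ℝ} (hW1 : IsChannel W1) (hW2 : IsChannel W2)
    {P : 𝒳 → ℝ} (hP : ∀ x, 0 < P x) (hP1 : ∑ x, P x = 1) {C η : ℝ}
    (hmin : min (mutInfo P W1) (mutInfo P W2) = C)
    (hmax : ∀ P', IsDist P' → min (mutInfo P' W1) (mutInfo P' W2) ≤ C)
    (hb1 : ∃ P', IsDist P' ∧ C < mutInfo P' W1) (hb2 : ∃ P', IsDist P' ∧ C < mutInfo P' W2)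
    (hη : ∀ v : 𝒳 → ℝ, ∑ x, v x = 0 → η * gradI P W1 v + (1 - η) * gradI P W2 v = 0) :
    mutInfo P W1 = C ∧ mutInfo P W2 = C ∧
      (∀ x, η * relEnt (W1 x) (outDist P W1) + (1 - η) * relEnt (W2 x) (outDist P W2) = C) ∧
      ∃ v : 𝒳 → ℝ, ∑ x, v x = 0 ∧ 0 < gradI P W1 v := by
  classical
  have hge1 : C ≤ mutInfo P W1 := hmin ▸ min_le_left _ _
  have hge2 : C ≤ mutInfo P W2 := hmin ▸ min_le_right _ _
  have hmax' : ∀ P', IsDist P' → min (mutInfo P' W2) (mutInfo P' W1) ≤ C := fun P' hP' => by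
    rw [min_comm]; exact hmax P' hP'
  have h12 : mutInfo P W1 = C ∧ mutInfo P W2 = C := by
    rcases min_choice (mutInfo P W1) (mutInfo P W2) with h | h
    · have h1 : mutInfo P W1 = C := h.symm.trans hmin
      exact ⟨h1, (mutInfo_le_of_maxmin hW2 hW1 hP hP1 hmax' hb1 h1).antisymm hge2⟩
    · have h2 : mutInfo P W2 = C := h.symm.trans hmin
      exact ⟨(mutInfo_le_of_maxmin hW1 hW2 hP hP1 hmax hb2 h2).antisymm hge1, h2⟩
  obtain ⟨h1, h2⟩ := h12
  have hgrad : ∀ (W : 𝒳 → 𝒴 → ℝ) (Q : 𝒳 → ℝ), gradI P W (fun x => Q x - P x)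
      = ∑ x, Q x * relEnt (W x) (outDist P W) - mutInfo P W := by
    intro W Q
    rw [gradI, mutInfo_eq_sum_relEnt]
    simp_rw [sub_mul, sum_sub_distrib]
  refine ⟨h1, h2, fun x => ?_, ?_⟩
  · have h := hη (fun z => (if z = x then 1 else 0) - P z) (by
      rw [sum_sub_distrib, hP1]; simp)
    rw [hgrad, hgrad, h1, h2] at h
    simp only [ite_mul, one_mul, zero_mul, sum_ite_eq', mem_univ, if_true] at h
    linarith
  · obtain ⟨Q, hQ, hlt⟩ := hb1
    refine ⟨fun x => Q x - P x, by rw [sum_sub_distrib, hQ.2, hP1, sub_self], ?_⟩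
    rw [hgrad]
    linarith [mutInfo_le_sum_relEnt hW1 hP hP1 hQ]

lemma abs_mutInfo_le {W : 𝒳 → 𝒴 → ℝ} (hW : IsChannel W) {P : 𝒳 → ℝ} (hP : IsDist P) {B : ℝ}
    (hB : ∀ x y, W x y ≠ 0 → |infoDens P W x y| ≤ B) : |mutInfo P W| ≤ B := by
  have h : ∑ x, ∑ y, P x * W x y * B = B := by
    simp_rw [← sum_mul, ← mul_sum, (hW _).2, mul_one, hP.2, one_mul]
  refine le_trans ((abs_sum_le_sum_abs _ _).trans (sum_le_sum fun x _ =>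
    (abs_sum_le_sum_abs _ _).trans (sum_le_sum fun y _ => ?_))) h.le
  have hpos := mul_nonneg (hP.1 x) ((hW x).1 y)
  by_cases hy : W x y = 0
  · simp [hy]
  rw [abs_mul, abs_of_nonneg hpos]
  exact mul_le_mul_of_nonneg_left (hB x y hy) hpos

/-- Chernoff bound for the lower tail of the accumulated information density. -/
lemma infoTail_le {W : 𝒳 → 𝒴 → ℝ} (hW : IsChannel W) {P : 𝒳 → ℝ} (hP : IsDist P) {B l : ℝ}
    (hB : ∀ x y, W x y ≠ 0 → |infoDens P W x y| ≤ B)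
    (hl : 0 ≤ l) (hlB : l * (2 * B) ≤ 1) (n : ℕ) {θ A : ℝ} (hθ : θ ≤ n * mutInfo P W - A) :
    infoTail P W n θ ≤ Real.exp (n * (l * (2 * B)) ^ 2 - l * A) := by
  have hpd : IsDist fun z : 𝒳 × 𝒴 => P z.1 * W z.1 z.2 := by
    refine ⟨fun z => mul_nonneg (hP.1 _) ((hW _).1 _), ?_⟩
    rw [Fintype.sum_prod_type]
    simp_rw [← mul_sum, (hW _).2, mul_one, hP.2]
  have hmean : 0 ≤ ∑ z : 𝒳 × 𝒴, P z.1 * W z.1 z.2 * (infoDens P W z.1 z.2 - mutInfo P W) := by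
    simp_rw [mul_sub, sum_sub_distrib, ← sum_mul]
    rw [hpd.2, one_mul, Fintype.sum_prod_type, sub_nonneg]
    exact le_rfl
  have h := chernoff hpd hmean (B := 2 * B) (l := l) (fun z hz => by
    refine (abs_sub _ _).trans ?_
    linarith [hB z.1 z.2 (right_ne_zero_of_mul hz), abs_mutInfo_le hW hP hB]) hl hlB n A
  refine le_trans (b := ∑ z : Fin n → 𝒳 × 𝒴, (∏ i, (P (z i).1 * W (z i).1 (z i).2)) *
      (if ∑ i, infoDens P W (z i).1 (z i).2 ≤ θ then 1 else 0)) (le_of_eq ?_)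
    ((sum_le_sum fun z _ => ?_).trans h)
  · have e := sum_fun_prod (ι := Fin n) fun (x : Fin n → 𝒳) (y : Fin n → 𝒴) =>
      (∏ i, (P (x i) * W (x i) (y i))) * (if ∑ i, infoDens P W (x i) (y i) ≤ θ then (1:ℝ) else 0)
    rw [e, infoTail]
    refine sum_congr rfl fun x _ => ?_
    rw [mul_sum]
    refine sum_congr rfl fun y _ => ?_
    rw [prod_mul_distrib, seqProb, _root_.blockProb, mul_assoc]
  · refine mul_le_mul_of_nonneg_left ?_ (prod_nonneg fun i _ => hpd.1 _)
    by_cases hz : ∑ i, infoDens P W (z i).1 (z i).2 ≤ θ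
    · rw [if_pos hz, if_pos]
      rw [sum_sub_distrib, sum_const, card_univ, Fintype.card_fin, nsmul_eq_mul]
      linarith
    · rw [if_neg hz]
      split_ifs <;> norm_num

lemma infoTail_le_one {W : 𝒳 → 𝒴 → ℝ} (hW : IsChannel W) {P : 𝒳 → ℝ} (hP : IsDist P) (n : ℕ)
    (θ : ℝ) : infoTail P W n θ ≤ 1 := by
  rw [← (isDist_seqProb hP n).2]
  refine sum_le_sum fun x _ => mul_le_of_le_one_right ((isDist_seqProb hP n).1 x) ?_
  refine le_trans (sum_le_sum fun y _ => ?_) (hW.blockProb x).2.le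
  refine mul_le_of_le_one_right ((hW.blockProb x).1 y) ?_
  split_ifs <;> norm_num

/-- The tilt that balances two accumulated information densities, clipped to `[-R, R]`. -/
def balancingTilt (R : ℕ) (r : ℝ) : Set.Icc (-(R : ℤ)) R :=
  Set.projIcc _ _ (by omega) (round r)

lemma balancingTilt_lower (R : ℕ) (r : ℝ) :
    (R : ℝ) ≤ (balancingTilt R r : ℤ) ∨ r - 1 ≤ (balancingTilt R r : ℤ) := by
  have h1 : r - 1 ≤ round r := by
    have := (abs_le.1 (abs_sub_round r)).2
    linarith
  have h2 : ((R : ℤ) ≤ balancingTilt R r) ∨ (round r ≤ (balancingTilt R r : ℤ)) := by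
    unfold balancingTilt
    rw [Set.coe_projIcc]
    omega
  rcases h2 with h2 | h2
  · left; exact_mod_cast h2
  · right
    refine h1.trans ?_
    exact_mod_cast h2

lemma balancingTilt_upper (R : ℕ) (r : ℝ) :
    ((balancingTilt R r : ℤ) : ℝ) ≤ -R ∨ ((balancingTilt R r : ℤ) : ℝ) ≤ r + 1 := by
  have h1 : (round r : ℝ) ≤ r + 1 := by
    have := (abs_le.1 (abs_sub_round r)).1
    linarith
  have h2 : ((balancingTilt R r : ℤ) ≤ -R) ∨ ((balancingTilt R r : ℤ) ≤ round r) := by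
    unfold balancingTilt
    rw [Set.coe_projIcc]
    omega
  rcases h2 with h2 | h2
  · left; exact_mod_cast h2
  · right
    refine le_trans ?_ h1
    exact_mod_cast h2

/-- After the balancing tilt, both accumulated information densities are essentially at least
their weighted average. -/
lemma le_add_balancingTilt {g1 g2 η s1 s2 T : ℝ} (hg1 : 0 < g1) (hg2 : g2 < 0)
    (hη : η * g1 + (1 - η) * g2 = 0) (R : ℕ) :
    (T ≤ s1 + R * g1 → T ≤ η * s1 + (1 - η) * s2 - g1 →
      T ≤ s1 + (balancingTilt R ((s2 - s1) / (g1 - g2)) : ℤ) * g1) ∧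
    (T ≤ s2 - R * g2 → T ≤ η * s1 + (1 - η) * s2 + g2 →
      T ≤ s2 + (balancingTilt R ((s2 - s1) / (g1 - g2)) : ℤ) * g2) := by
  set r := (s2 - s1) / (g1 - g2) with hr
  have hr' : r * (g1 - g2) = s2 - s1 := div_mul_cancel₀ _ (by linarith)
  have e1 : s1 + r * g1 = η * s1 + (1 - η) * s2 := by
    have : (1 - η) * (r * (g1 - g2)) = r * g1 := by linear_combination -r * hη
    rw [hr'] at this
    linarith
  have e2 : s2 + r * g2 = η * s1 + (1 - η) * s2 := by linarith
  constructor
  · intro ha hb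
    rcases balancingTilt_lower R r with h | h
    · nlinarith [mul_le_mul_of_nonneg_right h hg1.le]
    · nlinarith [mul_le_mul_of_nonneg_right h hg1.le]
  · intro ha hb
    rcases balancingTilt_upper R r with h | h
    · nlinarith [mul_le_mul_of_nonpos_right h hg2.le]
    · nlinarith [mul_le_mul_of_nonpos_right h hg2.le]

lemma natCard_symm_Icc (R : ℕ) : Nat.card (Set.Icc (-(R : ℤ)) R) = 2 * R + 1 := by
  have h := Int.card_fintype_Icc_of_le (a := -(R : ℤ)) (b := R) (by omega)
  rw [Fintype.card_eq_nat_card] at h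
  omega

open Classical in
/-- Non-asymptotic achievability with a balancing second phase. -/
lemma flfExists_of_tilts {W : Bool → 𝒳 → 𝒴 → ℝ} (hW : ∀ k, IsChannel (W k))
    {P : 𝒳 → ℝ} (hP : ∀ x, 0 < P x) (hP1 : ∑ x, P x = 1) {v : 𝒳 → ℝ} (hv : ∑ x, v x = 0)
    {C η B c G gm : ℝ} (hI : ∀ k, mutInfo P (W k) = C)
    (hg1 : 0 < gradI P (W true) v) (hg2 : gradI P (W false) v < 0)
    (hbal : η * gradI P (W true) v + (1 - η) * gradI P (W false) v = 0)
    (hB : ∀ k, ∀ P' : 𝒳 → ℝ, IsDist P' → (∀ x, P x / 2 ≤ P' x) →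
      ∀ x y, W k x y ≠ 0 → |infoDens P' (W k) x y| ≤ B)
    (hc0 : 0 ≤ c)
    (hc : ∀ k, ∀ δ : ℝ, (∀ x, 0 < P x + δ * v x) → mutInfo P (W k) + δ * gradI P (W k) v
      - c * δ ^ 2 ≤ mutInfo (fun x => P x + δ * v x) (W k))
    (hG : ∀ k, |gradI P (W k) v| ≤ G) (hgm : ∀ k, gm ≤ |gradI P (W k) v|)
    {n1 n2 R M : ℕ} (hn2 : 0 < n2) (hM : 0 < M) {l1 l2 A1 A2 t0 α Γ ε : ℝ}
    (hR : ∀ x, R * |v x| ≤ n2 * (P x / 2))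
    (hl1 : 0 ≤ l1) (hl1B : l1 * (2 * B) ≤ 1) (hl2 : 0 ≤ l2) (hl2B : l2 * (2 * B) ≤ 1)
    (hT : t0 - G ≤ n1 * C - A1 + R * gm)
    (hΓ : Γ + c * (R ^ 2 / n2) + A2 ≤ n2 * C + (t0 - G))
    (hα : ∑ u : Fin n1 → 𝒳, seqProb P u * ∑ a, ∑ b,
      blockProb (W true) u a * blockProb (W false) u b *
      (if η * ∑ i, infoDens P (W true) (u i) (a i)
        + (1 - η) * ∑ i, infoDens P (W false) (u i) (b i) ≤ t0 then 1 else 0) ≤ α)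
    (hε : α / 2 + 4 * (Real.exp (n1 * (l1 * (2 * B)) ^ 2 - l1 * A1)
        + Real.exp (n2 * (l2 * (2 * B)) ^ 2 - l2 * A2))
      + 4 * (M * ((2 * R + 1) * Real.exp (-Γ))) + 1 / M ≤ ε) :
    FLFExists (W true) (W false) (n1 + n2) M ε := by
  have hPd : IsDist P := ⟨fun x => (hP x).le, hP1⟩
  have hn2R : (0 : ℝ) < n2 := by exact_mod_cast hn2
  set Pt : Set.Icc (-(R : ℤ)) R → 𝒳 → ℝ := fun t x => P x + ((t : ℤ) : ℝ) / n2 * v x with hPtdef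
  have htR : ∀ t : Set.Icc (-(R : ℤ)) R, |((t : ℤ) : ℝ)| ≤ R := by
    intro t
    rw [abs_le]
    exact ⟨by exact_mod_cast t.2.1, by exact_mod_cast t.2.2⟩
  have hhalf : ∀ t x, P x / 2 ≤ Pt t x := by
    intro t x
    have h1 : |((t : ℤ) : ℝ) / n2 * v x| ≤ P x / 2 := by
      rw [abs_mul, abs_div, abs_of_pos hn2R, div_mul_eq_mul_div, div_le_iff₀ hn2R]
      calc _ ≤ R * |v x| := mul_le_mul_of_nonneg_right (htR t) (abs_nonneg _)
        _ ≤ _ := by rw [mul_comm (P x / 2)]; exact hR x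
    have h2 := (abs_le.1 h1).1
    simp only [hPtdef]
    linarith
  have hPt : ∀ t x, 0 < Pt t x := fun t x => (half_pos (hP x)).trans_le (hhalf t x)
  have hPt1 : ∀ t, ∑ x, Pt t x = 1 := by
    intro t
    simp only [hPtdef]
    rw [sum_add_distrib, ← mul_sum, hP1, hv]
    simp
  have hPtd : ∀ t, IsDist (Pt t) := fun t => ⟨fun x => (hPt t x).le, hPt1 t⟩
  set s : Bool → (Fin n1 → 𝒳) → (Bool → Fin n1 → 𝒴) → ℝ :=
    fun k u y => ∑ i, infoDens P (W k) (u i) (y k i) with hs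
  set Bad : (Fin n1 → 𝒳) → (Bool → Fin n1 → 𝒴) → Prop :=
    fun u y => η * s true u y + (1 - η) * s false u y ≤ t0 with hBad
  set τ : Bool → (Fin n1 → 𝒳) → (Bool → Fin n1 → 𝒴) → Set.Icc (-(R : ℤ)) R := fun m u y =>
    if Bad u y then (if m then ⟨R, by simp⟩ else ⟨-R, by simp⟩)
    else balancingTilt R ((s false u y - s true u y) /
      (gradI P (W true) v - gradI P (W false) v)) with hτ
  have hcard : (Fintype.card (Set.Icc (-(R : ℤ)) R) : ℝ) = 2 * R + 1 := by
    rw [Fintype.card_eq_nat_card, natCard_symm_Icc]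
    push_cast
    ring
  have habs1 : |gradI P (W true) v| = gradI P (W true) v := abs_of_pos hg1
  have habs2 : |gradI P (W false) v| = -gradI P (W false) v := abs_of_neg hg2
  have hserve : ∀ m k u y, ¬(Bad u y ∧ m ≠ k) → n1 * C - A1 ≤ s k u y →
      t0 - G ≤ s k u y + ((τ m u y : ℤ) : ℝ) * gradI P (W k) v := by
    intro m k u y hmk hsk
    have hgR := mul_le_mul_of_nonneg_left (hgm k) (Nat.cast_nonneg (α := ℝ) R)
    by_cases hbad : Bad u y
    · have hm : m = k := by
        by_contra hne
        exact hmk ⟨hbad, hne⟩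
      subst hm
      simp only [hτ, if_pos hbad]
      cases m
      · simp only [Bool.false_eq_true, if_false]
        push_cast
        rw [habs2] at hgR
        linarith
      · simp only [if_true]
        push_cast
        rw [habs1] at hgR
        linarith
    · simp only [hτ, if_neg hbad]
      have hbad' : t0 < η * s true u y + (1 - η) * s false u y := not_le.1 hbad
      have hsel := le_add_balancingTilt (s1 := s true u y) (s2 := s false u y) (T := t0 - G)
        hg1 hg2 hbal R
      cases k
      · rw [habs2] at hgR
        have := hG false
        rw [habs2] at this
        exact hsel.2 (by linarith) (by linarith)
      · rw [habs1] at hgR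
        have := hG true
        rw [habs1] at this
        exact hsel.1 (by linarith) (by linarith)
  have htail : ∀ m k u y, (if Bad u y ∧ m ≠ k then 0 else
      infoTail (Pt (τ m u y)) (W k) n2 (Γ - s k u y))
      ≤ (if s k u y ≤ n1 * C - A1 then 1 else 0)
        + Real.exp (n2 * (l2 * (2 * B)) ^ 2 - l2 * A2) := by
    intro m k u y
    have he := (Real.exp_pos (n2 * (l2 * (2 * B)) ^ 2 - l2 * A2)).le
    by_cases hmk : Bad u y ∧ m ≠ k
    · rw [if_pos hmk]
      split_ifs <;> linarith
    rw [if_neg hmk]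
    by_cases hsk : s k u y ≤ n1 * C - A1
    · rw [if_pos hsk]
      linarith [infoTail_le_one (hW k) (hPtd (τ m u y)) n2 (Γ - s k u y)]
    rw [if_neg hsk, zero_add]
    refine infoTail_le (hW k) (hPtd _) (hB k _ (hPtd _) (hhalf _)) hl2 hl2B n2 ?_
    have h1 := hserve m k u y hmk (not_le.1 hsk).le
    have h2 := hc k (((τ m u y : ℤ) : ℝ) / n2) (hPt _)
    rw [hI k] at h2
    have h3 := mul_le_mul_of_nonneg_left h2 hn2R.le
    have h4 : (n2 : ℝ) * (C + ((τ m u y : ℤ) : ℝ) / n2 * gradI P (W k) v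
        - c * (((τ m u y : ℤ) : ℝ) / n2) ^ 2)
        = n2 * C + ((τ m u y : ℤ) : ℝ) * gradI P (W k) v
          - c * (((τ m u y : ℤ) : ℝ) ^ 2 / n2) := by
      field_simp
    rw [h4] at h3
    have h5 : c * (((τ m u y : ℤ) : ℝ) ^ 2 / n2) ≤ c * (R ^ 2 / n2) := by
      refine mul_le_mul_of_nonneg_left (div_le_div_of_nonneg_right ?_ hn2R.le) hc0
      rw [← sq_abs]
      exact pow_le_pow_left₀ (abs_nonneg _) (htR _) 2
    linarith
  have hfirst : ∀ k, ∑ u : Fin n1 → 𝒳, seqProb P u * ∑ y : Bool → Fin n1 → 𝒴,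
      (∏ k, blockProb (W k) u (y k)) * (if s k u y ≤ n1 * C - A1 then 1 else 0)
      ≤ Real.exp (n1 * (l1 * (2 * B)) ^ 2 - l1 * A1) := by
    intro k
    have h := infoTail_le (hW k) hPd
      (hB k P hPd fun x => by linarith [hP x]) hl1 hl1B n1 (θ := n1 * C - A1) (A := A1)
      (by rw [hI k])
    refine le_trans (le_of_eq (sum_congr rfl fun u _ => ?_)) h
    rw [← sum_pi_marginal (p := fun k => blockProb (W k) u) (fun k => ((hW k).blockProb u).2) k]
  refine flfExists_twoPhase hW hP hP1 hPt hPt1 τ Bad (α := α)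
    (β := Real.exp (n1 * (l1 * (2 * B)) ^ 2 - l1 * A1)
      + Real.exp (n2 * (l2 * (2 * B)) ^ 2 - l2 * A2)) (Γ := Γ) ?_ ?_ hM ?_
  · refine le_trans (le_of_eq (sum_congr rfl fun u _ => ?_)) hα
    rw [← sum_bool_fun]
    refine congrArg _ (sum_congr rfl fun y _ => ?_)
    rw [Fintype.prod_bool]
  · intro m k
    have hd : ∀ u : Fin n1 → 𝒳, IsDist fun y : Bool → Fin n1 → 𝒴 =>
      ∏ k, blockProb (W k) u (y k) := fun u => isDist_prod_bool fun k => (hW k).blockProb u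
    have hu := isDist_seqProb hPd n1
    refine le_trans (sum_le_sum fun u _ => mul_le_mul_of_nonneg_left (sum_le_sum fun y _ =>
      mul_le_mul_of_nonneg_left (htail m k u y) ((hd u).1 y)) (hu.1 u)) ?_
    simp_rw [mul_add, sum_add_distrib, ← sum_mul, (hd _).2, one_mul, mul_add, sum_add_distrib,
      ← sum_mul, hu.2, one_mul]
    linarith [hfirst k]
  · rw [hcard]
    exact hε

lemma flfExists_one {𝒳 : Type*} [Nonempty 𝒳] (W1 W2 : 𝒳 → 𝒴 → ℝ) (n : ℕ) {ε : ℝ} (hε : 0 ≤ ε) :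
    FLFExists W1 W2 n 1 ε :=
  ⟨fun _ _ _ _ => Classical.arbitrary 𝒳, fun _ _ _ _ _ _ _ _ => rfl, fun _ => 0, fun _ => 0, by
    simpa [errProb1, Subsingleton.elim (0 : Fin 1)] using hε, by
    simpa [errProb2, Subsingleton.elim (0 : Fin 1)] using hε⟩

lemma eventually_mul_log_le_sixthRoot (a : ℝ) :
    ∀ᶠ n : ℕ in Filter.atTop, a * Real.log n ≤ sixthRoot n := by
  have h := (isLittleO_log_rpow_atTop (by norm_num : (0 : ℝ) < 1 / 6)).comp_tendsto
    tendsto_natCast_atTop_atTop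
  have hb := h.bound (by positivity : 0 < 1 / (|a| + 1))
  filter_upwards [hb, eventually_one_le_log] with n hn hlog
  simp only [Function.comp, Real.norm_eq_abs] at hn
  have h6 : |(n : ℝ) ^ ((1 : ℝ) / 6)| = sixthRoot n := abs_of_nonneg (by positivity)
  rw [h6, abs_of_nonneg (by linarith), one_div_mul_eq_div, le_div_iff₀ (by positivity)] at hn
  nlinarith [le_abs_self a]

/-- Gaussian bound for the lower tail of the weighted information density without feedback. -/
lemma exists_weighted_tail_le {W1 W2 : 𝒳 → 𝒴 → ℝ} (hW1 : IsChannel W1) (hW2 : IsChannel W2)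
    [Nonempty 𝒴] {P : 𝒳 → ℝ} (hP : IsDist P) {η C V : ℝ}
    (hD : ∀ x, η * relEnt (W1 x) (outDist P W1) + (1 - η) * relEnt (W2 x) (outDist P W2) = C)
    (hV : 0 < V) (hvar : ∀ x, η ^ 2 * symbVar P W1 x + (1 - η) ^ 2 * symbVar P W2 x = V) :
    ∃ K > 0, ∀ h, 1 ≤ h → ∀ (n : ℕ) (t : ℝ),
      ∑ u : Fin n → 𝒳, seqProb P u * ∑ a, ∑ b, blockProb W1 u a * blockProb W2 u b *
        (if η * ∑ i, infoDens P W1 (u i) (a i) + (1 - η) * ∑ i, infoDens P W2 (u i) (b i)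
          ≤ n * C + t then 1 else 0)
        ≤ Qfun ((-h ^ 2 - t) / Real.sqrt (h ^ 2 + n * V)) + K / h := by
  obtain ⟨B, hB, hb⟩ := exists_weightedDens_bound P W1 W2 η C
  obtain ⟨K, hK, hcdf⟩ := CausalStrategy.cdf_bounds (α := 𝒴) (β := 𝒴) (γ := 𝒳) hV hB
  refine ⟨K, hK, fun h h1 n t => ?_⟩
  have hu := isDist_seqProb hP n
  have hle : ∀ u : Fin n → 𝒳, ∑ a, ∑ b, blockProb W1 u a * blockProb W2 u b *
      (if η * ∑ i, infoDens P W1 (u i) (a i) + (1 - η) * ∑ i, infoDens P W2 (u i) (b i)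
        ≤ n * C + t then 1 else 0)
      ≤ Qfun ((-h ^ 2 - t) / Real.sqrt (h ^ 2 + n * V)) + K / h := by
    intro u
    have := (hcdf (fun x a b => W1 x a * W2 x b) (weightedDens P W1 W2 η C)
      (fun x a b => mul_nonneg ((hW1 x).1 a) ((hW2 x).1 b))
      (fun x => by simp_rw [← mul_sum, (hW2 x).2, mul_one, (hW1 x).2])
      (fun x => sum_sum_weightedDens hW1 hW2 (hD x))
      (fun x => (sum_sum_weightedDens_sq hW1 hW2 (hD x)).trans (hvar x))
      (fun x a b _ => hb x a b) h h1 n (fun _ _ => u) (fun _ _ _ _ _ _ _ => rfl) t).2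
    have e : ∀ a b : Fin n → 𝒴, (∑ i, weightedDens P W1 W2 η C (u i) (a i) (b i) ≤ t) ↔
        η * ∑ i, infoDens P W1 (u i) (a i) + (1 - η) * ∑ i, infoDens P W2 (u i) (b i)
          ≤ n * C + t := by
      intro a b
      unfold weightedDens
      rw [sum_sub_distrib, sum_add_distrib, ← mul_sum, ← mul_sum, sum_const, card_univ,
        Fintype.card_fin, nsmul_eq_mul, sub_le_iff_le_add, add_comm t]
    simp only [e, prod_mul_distrib] at this
    exact this
  refine (sum_le_sum fun u _ => mul_le_mul_of_nonneg_left (hle u) (hu.1 u)).trans ?_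
  rw [← sum_mul, hu.2, one_mul]

lemma abs_sqrt_phase_sub_le {h V n1 n2 : ℝ} (hh : 1 ≤ h) (hV : 0 ≤ V) (hn1 : 0 ≤ n1)
    (hn2 : 0 ≤ n2) (hn : n1 + n2 = h ^ 6) (hle : n2 ≤ 2 * h ^ 4) :
    |Real.sqrt (h ^ 2 + n1 * V) - h ^ 3 * Real.sqrt V| ≤ (1 + Real.sqrt (2 * V)) * h ^ 2 := by
  have h0 : 0 ≤ h := by linarith
  have hs := Real.sqrt_nonneg V
  have hs2 := Real.sqrt_nonneg (2 * V)
  have hsV := Real.sq_sqrt hV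
  have hsV2 := Real.sq_sqrt (by positivity : 0 ≤ 2 * V)
  have hr := Real.sqrt_nonneg (h ^ 2 + n1 * V)
  have hrsq := Real.sq_sqrt (by positivity : 0 ≤ h ^ 2 + n1 * V)
  rw [abs_le]
  constructor
  · have h1 : h ^ 3 * Real.sqrt V
        ≤ Real.sqrt (h ^ 2 + n1 * V) + Real.sqrt (2 * V) * h ^ 2 := by
      refine abs_le_of_sq_le_sq' ?_ (by positivity) |>.2
      have e1 : (h ^ 3 * Real.sqrt V) ^ 2 = (n1 + n2) * V := by
        rw [hn, mul_pow, hsV]; ring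
      have e2 : (Real.sqrt (2 * V) * h ^ 2) ^ 2 = 2 * V * h ^ 4 := by
        rw [mul_pow, hsV2]; ring
      have e3 : n2 * V ≤ 2 * h ^ 4 * V := mul_le_mul_of_nonneg_right hle hV
      have e4 : 0 ≤ Real.sqrt (h ^ 2 + n1 * V) * (Real.sqrt (2 * V) * h ^ 2) := by positivity
      rw [e1, add_sq, e2, hrsq]
      nlinarith [sq_nonneg h]
    nlinarith [sq_nonneg h]
  · have h1 := sqrt_add_sq_le h0 (mul_nonneg hn1 hV)
    have h2 : Real.sqrt (n1 * V) ≤ h ^ 3 * Real.sqrt V := by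
      rw [Real.sqrt_le_left (by positivity), mul_pow, hsV]
      have : n1 * V ≤ h ^ 6 * V := mul_le_mul_of_nonneg_right (by linarith) hV
      nlinarith
    have h3 : h ≤ h ^ 2 := by nlinarith
    have h4 : 0 ≤ Real.sqrt (2 * V) * h ^ 2 := by positivity
    linarith

set_option maxHeartbeats 2000000 in
/-- Second-order achievability under the per-symbol variance condition. -/
lemma achievability_asymptotic {W : Bool → 𝒳 → 𝒴 → ℝ} (hW : ∀ k, IsChannel (W k))
    [Nonempty 𝒳] [Nonempty 𝒴] {P : 𝒳 → ℝ} (hP : ∀ x, 0 < P x) (hP1 : ∑ x, P x = 1)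
    {v : 𝒳 → ℝ} (hv : ∑ x, v x = 0) {η C V ε : ℝ}
    (hI : ∀ k, mutInfo P (W k) = C)
    (hg1 : 0 < gradI P (W true) v) (hg2 : gradI P (W false) v < 0)
    (hbal : η * gradI P (W true) v + (1 - η) * gradI P (W false) v = 0)
    (hD : ∀ x, η * relEnt (W true x) (outDist P (W true))
      + (1 - η) * relEnt (W false x) (outDist P (W false)) = C)
    (hV : 0 < V)
    (hvar : ∀ x, η ^ 2 * symbVar P (W true) x + (1 - η) ^ 2 * symbVar P (W false) x = V)
    (hε0 : 0 < ε) (hε1 : ε < 1 / 2) :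
    ∃ K > 0, ∀ᶠ n : ℕ in Filter.atTop, ∃ M : ℕ, 0 < M ∧
      FLFExists (W true) (W false) n M ε ∧
      n * C - Real.sqrt (n * V) * Qinv (2 * ε) - K * (sixthRoot n ^ 2 * Real.log n)
        ≤ Real.log M := by
  have hPd : IsDist P := ⟨fun x => (hP x).le, hP1⟩
  obtain ⟨B, hB0, hB⟩ : ∃ B, 0 ≤ B ∧ ∀ k, ∀ P' : 𝒳 → ℝ, IsDist P' → (∀ x, P x / 2 ≤ P' x) →
      ∀ x y, W k x y ≠ 0 → |infoDens P' (W k) x y| ≤ B := by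
    choose b hb0 hb using fun k => exists_infoDens_bound (hW k) hP
    exact ⟨∑ k, b k, sum_nonneg fun k _ => hb0 k, fun k P' h1 h2 x y h3 =>
      (hb k P' h1 h2 x y h3).trans (single_le_sum (fun k _ => hb0 k) (mem_univ k))⟩
  obtain ⟨c, hc0, hc⟩ : ∃ c, 0 ≤ c ∧ ∀ k, ∀ δ : ℝ, (∀ x, 0 < P x + δ * v x) →
      mutInfo P (W k) + δ * gradI P (W k) v - c * δ ^ 2
        ≤ mutInfo (fun x => P x + δ * v x) (W k) := by
    choose b hb0 hb using fun k => exists_mutInfo_perturb (hW k) hP hP1 hv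
    refine ⟨∑ k, b k, sum_nonneg fun k _ => hb0 k, fun k δ hδ => le_trans ?_ (hb k δ hδ)⟩
    have := mul_le_mul_of_nonneg_right
      (single_le_sum (fun k _ => hb0 k) (mem_univ k) : b k ≤ ∑ k, b k) (sq_nonneg δ)
    linarith
  obtain ⟨K3, hK3, htail⟩ := exists_weighted_tail_le (hW true) (hW false) hPd hD hV hvar
  set q := Qinv (2 * ε) with hqdef
  have hq : Qfun q = 2 * ε := Qfun_Qinv (by linarith) (by linarith)
  obtain ⟨κ, hκ, hslope⟩ := exists_Qfun_slope q
  set G := |gradI P (W true) v| + |gradI P (W false) v| with hGdef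
  set gm := min |gradI P (W true) v| |gradI P (W false) v| with hgmdef
  have hgm0 : 0 < gm := lt_min (abs_pos.2 hg1.ne') (abs_pos.2 hg2.ne)
  have hG0 : 0 ≤ G := by positivity
  have hGk : ∀ k, |gradI P (W k) v| ≤ G := by
    intro k
    have h1 := abs_nonneg (gradI P (W true) v)
    have h2 := abs_nonneg (gradI P (W false) v)
    cases k <;> linarith
  have hgmk : ∀ k, gm ≤ |gradI P (W k) v| := by
    intro k
    cases k
    · exact min_le_right _ _
    · exact min_le_left _ _
  set S := Real.sqrt V with hSdef
  have hS0 : 0 ≤ S := Real.sqrt_nonneg V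
  set S2 := Real.sqrt (2 * V) with hS2def
  have hS20 : 0 ≤ S2 := Real.sqrt_nonneg _
  set K4 := 20 + 8 * Real.exp (8 * B ^ 2) with hK4
  have hK40 : 0 < K4 := by positivity
  set Kq := (K3 + K4) / κ with hKq
  have hKq0 : 0 < Kq := by positivity
  set K1 := ((4 * B ^ 2 + 1) + (1 + S) * |q|) / gm with hK1
  have hK10 : 0 < K1 := by positivity
  have hK1gm : K1 * gm = (4 * B ^ 2 + 1) + (1 + S) * |q| := div_mul_cancel₀ _ hgm0.ne'
  set K := 4 + c * (K1 + 1) ^ 2 + G + (1 + S2) * |q| + (1 + S) * Kq with hK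
  have hK0 : 0 < K := by positivity
  refine ⟨K + 1, by linarith, ?_⟩
  have hlogs : ∀ᶠ n : ℕ in Filter.atTop, ∀ x,
      (K1 + 1) * |v x| * (2 / P x) * Real.log n ≤ sixthRoot n := by
    rw [Filter.eventually_all]
    exact fun x => eventually_mul_log_le_sixthRoot _
  filter_upwards [tendsto_sixthRoot.eventually_ge_atTop (2 + Kq), eventually_one_le_log, hlogs,
    eventually_mul_log_le_sixthRoot (2 * B), eventually_mul_log_le_sixthRoot (3 * (K1 + 1))]
    with n hn hlog hvx hBl hRl
  set h := sixthRoot n with hh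
  set l := Real.log n with hl
  have h2 : 2 ≤ h := by linarith
  have h1 : 1 ≤ h := by linarith
  have h0 : 0 < h := by linarith
  have hl0 : 0 ≤ l := by linarith
  have hn6 : h ^ 6 = n := sixthRoot_pow_six n
  have hn2 : (2 : ℝ) ≤ n := by
    rw [← hn6]
    exact h2.trans (le_self_pow₀ h1 (by norm_num))
  have hn0 : (0 : ℝ) < n := by linarith
  have hexpl : Real.exp l = n := Real.exp_log hn0
  have hsqrt : Real.sqrt (n * V) = h ^ 3 * S := sqrt_mul_eq_sixthRoot n V
  have hh2 : 1 ≤ h ^ 2 := one_le_pow₀ h1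
  have hh22 : 2 ≤ h ^ 2 := h2.trans (le_self_pow₀ h1 two_ne_zero)
  have hhl : 1 ≤ h ^ 2 * l := one_le_mul_of_one_le_of_one_le hh2 hlog
  set E := n * C - h ^ 3 * S * q - K * (h ^ 2 * l) with hE
  rw [hsqrt]
  by_cases hEl : E ≤ l
  · refine ⟨1, one_pos, flfExists_one _ _ n hε0.le, ?_⟩
    have : l ≤ h ^ 2 * l := le_mul_of_one_le_left hl0 hh2
    rw [Nat.cast_one, Real.log_one]
    linarith
  push Not at hEl
  set M := ⌊Real.exp E⌋₊ with hM
  have hexpE : (n : ℝ) ≤ Real.exp E := by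
    rw [← hexpl]
    exact Real.exp_le_exp.2 hEl.le
  have hMle : (M : ℝ) ≤ Real.exp E := Nat.floor_le (Real.exp_pos E).le
  have hMge : Real.exp E / 2 ≤ M := by
    have := Nat.lt_floor_add_one (Real.exp E)
    linarith
  have hM0R : (0 : ℝ) < M := lt_of_lt_of_le (half_pos (Real.exp_pos E)) hMge
  have hM0 : 0 < M := by exact_mod_cast hM0R
  refine ⟨M, hM0, ?_, ?_⟩
  swap
  · have h3 := Real.log_le_log (half_pos (Real.exp_pos E)) hMge
    rw [Real.log_div (Real.exp_pos E).ne' two_ne_zero, Real.log_exp] at h3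
    have h4 := Real.log_two_lt_d9
    linarith
  set L := Real.sqrt l with hL
  have hLsq : L ^ 2 = l := Real.sq_sqrt hl0
  have hL1 : 1 ≤ L := by rw [hL]; exact Real.one_le_sqrt.2 hlog
  have hLl : L ≤ l := hLsq ▸ le_self_pow₀ hL1 two_ne_zero
  set m2 := ⌈h ^ 4⌉₊ with hm2
  have hm2a : h ^ 4 ≤ m2 := Nat.le_ceil _
  have hh4 : 1 ≤ h ^ 4 := one_le_pow₀ h1
  have hm2b : (m2 : ℝ) ≤ 2 * h ^ 4 := by
    have := Nat.ceil_lt_add_one (by positivity : 0 ≤ h ^ 4)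
    linarith
  have hm2n : m2 ≤ n := by
    have : (m2 : ℝ) ≤ n := by
      refine hm2b.trans ?_
      rw [← hn6]
      calc 2 * h ^ 4 ≤ h ^ 2 * h ^ 4 := mul_le_mul_of_nonneg_right hh22 (by positivity)
        _ = h ^ 6 := by ring
    exact_mod_cast this
  have hm20 : (0 : ℝ) < m2 := by linarith
  obtain ⟨m1, hm1⟩ := Nat.exists_eq_add_of_le' hm2n
  have hm1R : (m1 : ℝ) + m2 = n := by rw [hm1]; push_cast; ring
  have hm10 : (0 : ℝ) ≤ m1 := Nat.cast_nonneg _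
  set R := ⌈K1 * (h ^ 3 * L)⌉₊ with hR
  have hh3 : 1 ≤ h ^ 3 := one_le_pow₀ h1
  have hh3L : 1 ≤ h ^ 3 * L := one_le_mul_of_one_le_of_one_le hh3 hL1
  have hRa : K1 * (h ^ 3 * L) ≤ R := Nat.le_ceil _
  have hRb : (R : ℝ) ≤ (K1 + 1) * (h ^ 3 * L) := by
    have := Nat.ceil_lt_add_one (by positivity : 0 ≤ K1 * (h ^ 3 * L))
    linarith
  have hR0 : (0 : ℝ) ≤ R := Nat.cast_nonneg _
  set r := Real.sqrt (h ^ 2 + m1 * V) with hr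
  have hr0 : 0 < r := Real.sqrt_pos.2 (by positivity)
  have hrabs : |r - h ^ 3 * S| ≤ (1 + S2) * h ^ 2 :=
    abs_sqrt_phase_sub_le h1 hV.le hm10 hm20.le (by rw [hm1R, hn6]) hm2b
  have hrle : r ≤ h + h ^ 3 * S := by
    refine (sqrt_add_sq_le h0.le (mul_nonneg hm10 hV.le)).trans (add_le_add_right ?_ h)
    rw [← hsqrt]
    exact Real.sqrt_le_sqrt (mul_le_mul_of_nonneg_right (by linarith) hV.le)
  set s := Kq / h with hs
  have hs0 : 0 ≤ s := by positivity
  have hs1 : s ≤ 1 := by rw [hs, div_le_one h0]; linarith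
  have hκs : κ * s = (K3 + K4) / h := by rw [hs, hKq]; field_simp
  have hrs : r * s ≤ (1 + S) * Kq * h ^ 2 := by
    have e1 : h * s = Kq := by rw [hs]; field_simp
    calc r * s ≤ (h + h ^ 3 * S) * s := mul_le_mul_of_nonneg_right hrle hs0
      _ = (1 + h ^ 2 * S) * (h * s) := by ring
      _ ≤ ((1 + S) * h ^ 2) * Kq := by
        rw [e1]
        refine mul_le_mul_of_nonneg_right ?_ hKq0.le
        linarith
      _ = _ := by ring
  have hrq : (r - h ^ 3 * S) * q ≤ (1 + S2) * |q| * h ^ 2 := by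
    refine (le_abs_self _).trans ?_
    rw [abs_mul]
    calc _ ≤ (1 + S2) * h ^ 2 * |q| := mul_le_mul_of_nonneg_right hrabs (abs_nonneg q)
      _ = _ := by ring
  set t := -h ^ 2 - r * (q + s) with ht
  have hQ : (-h ^ 2 - t) / r = q + s := by
    rw [ht]
    field_simp
    ring
  clear_value q G gm S S2 K4 Kq K1 K h l E L R r s t m2 M
  have hbase : FLFExists (W true) (W false) (m1 + m2) M ε := by
    refine flfExists_of_tilts hW hP hP1 hv (C := C) (η := η) (B := B) (c := c) (G := G) (gm := gm)
      hI hg1 hg2 hbal hB hc0 hc hGk hgmk (n1 := m1) (n2 := m2) (R := R) (M := M)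
      (by exact_mod_cast hm20) hM0 (l1 := L / h ^ 3) (l2 := 1 / h ^ 2)
      (A1 := (4 * B ^ 2 + 1) * (h ^ 3 * L)) (A2 := h ^ 2 * l) (t0 := m1 * C + t)
      (α := 2 * ε - K4 / h) (Γ := E + 2 * l) ?_ (by positivity) ?_ (by positivity) ?_ ?_ ?_ ?_ ?_
    · intro x
      have hx := hP x
      have h3 : (K1 + 1) * |v x| * L ≤ h * (P x / 2) := by
        have h4 := mul_le_mul_of_nonneg_right (hvx x) (by positivity : 0 ≤ P x / 2)
        have h5 : (K1 + 1) * |v x| * (2 / P x) * l * (P x / 2) = (K1 + 1) * |v x| * l := by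
          field_simp
        rw [h5] at h4
        exact (mul_le_mul_of_nonneg_left hLl (by positivity)).trans h4
      calc (R : ℝ) * |v x| ≤ (K1 + 1) * (h ^ 3 * L) * |v x| :=
            mul_le_mul_of_nonneg_right hRb (abs_nonneg _)
        _ = h ^ 3 * ((K1 + 1) * |v x| * L) := by ring
        _ ≤ h ^ 3 * (h * (P x / 2)) := mul_le_mul_of_nonneg_left h3 (by positivity)
        _ = h ^ 4 * (P x / 2) := by ring
        _ ≤ m2 * (P x / 2) := mul_le_mul_of_nonneg_right hm2a (by positivity)
    · rw [div_mul_eq_mul_div, div_le_one (by positivity)]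
      calc L * (2 * B) ≤ l * (2 * B) := mul_le_mul_of_nonneg_right hLl (by positivity)
        _ ≤ h := by linarith
        _ ≤ h ^ 3 := le_self_pow₀ h1 (by norm_num)
    · rw [div_mul_eq_mul_div, div_le_one (by positivity), one_mul]
      calc 2 * B ≤ 2 * B * l := le_mul_of_one_le_right (by positivity) hlog
        _ ≤ h := hBl
        _ ≤ h ^ 2 := le_self_pow₀ h1 (by norm_num)
    · have h3 : -(r * q) ≤ (1 + S) * |q| * (h ^ 3 * L) := by
        calc -(r * q) = r * (-q) := by ring
          _ ≤ r * |q| := mul_le_mul_of_nonneg_left (neg_le_abs q) hr0.le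
          _ ≤ ((1 + S) * h ^ 3) * |q| := by
            refine mul_le_mul_of_nonneg_right (hrle.trans ?_) (abs_nonneg q)
            have : h ≤ h ^ 3 := le_self_pow₀ h1 (by norm_num)
            linarith
          _ = (1 + S) * |q| * h ^ 3 := by ring
          _ ≤ _ := mul_le_mul_of_nonneg_left
            (le_mul_of_one_le_right (by positivity) hL1) (by positivity)
      have h4 : K1 * (h ^ 3 * L) * gm ≤ R * gm := mul_le_mul_of_nonneg_right hRa hgm0.le
      have h5 : K1 * (h ^ 3 * L) * gm
          = (4 * B ^ 2 + 1) * (h ^ 3 * L) + (1 + S) * |q| * (h ^ 3 * L) := by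
        rw [mul_right_comm, hK1gm]; ring
      have h6 : 0 ≤ r * s := mul_nonneg hr0.le hs0
      have h7 : t = -h ^ 2 - r * q - r * s := by rw [ht]; ring
      linarith
    · have h3 : (R : ℝ) ^ 2 / m2 ≤ (K1 + 1) ^ 2 * (h ^ 2 * l) := by
        rw [div_le_iff₀ hm20]
        calc (R : ℝ) ^ 2 ≤ ((K1 + 1) * (h ^ 3 * L)) ^ 2 := pow_le_pow_left₀ hR0 hRb 2
          _ = (K1 + 1) ^ 2 * (h ^ 2 * L ^ 2) * h ^ 4 := by ring
          _ ≤ (K1 + 1) ^ 2 * (h ^ 2 * l) * m2 := by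
            rw [hLsq]
            exact mul_le_mul_of_nonneg_left hm2a (by positivity)
      have h4 := mul_le_mul_of_nonneg_left h3 hc0
      have h5 : t = -h ^ 2 - (r - h ^ 3 * S) * q - h ^ 3 * S * q - r * s := by rw [ht]; ring
      have h6 : h ^ 2 ≤ h ^ 2 * l := le_mul_of_one_le_right (by positivity) hlog
      have h7 : l ≤ h ^ 2 * l := le_mul_of_one_le_left hl0 hh2
      have h7' : 2 * l ≤ h ^ 2 * l := mul_le_mul_of_nonneg_right hh22 hl0
      have h8 : (1 + S2) * |q| * h ^ 2 ≤ (1 + S2) * |q| * (h ^ 2 * l) :=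
        mul_le_mul_of_nonneg_left h6 (by positivity)
      have h9 : (1 + S) * Kq * h ^ 2 ≤ (1 + S) * Kq * (h ^ 2 * l) :=
        mul_le_mul_of_nonneg_left h6 (by positivity)
      have h10 : G ≤ G * (h ^ 2 * l) := le_mul_of_one_le_right hG0 hhl
      have h11 : (n : ℝ) * C = m1 * C + m2 * C := by rw [← hm1R]; ring
      have h12 : K * (h ^ 2 * l) = 4 * (h ^ 2 * l) + c * ((K1 + 1) ^ 2 * (h ^ 2 * l))
          + G * (h ^ 2 * l) + (1 + S2) * |q| * (h ^ 2 * l) + (1 + S) * Kq * (h ^ 2 * l) := by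
        rw [hK]; ring
      rw [hE, h12]
      linarith
    · refine (htail h h1 m1 t).trans ?_
      rw [← hr, hQ]
      have h3 := (hslope s hs0 hs1).1
      rw [hq, hκs, add_div] at h3
      linarith
    · have hninv : Real.exp (-l) = 1 / n := by rw [Real.exp_neg, hexpl, one_div]
      have h3 : Real.exp (m1 * (L / h ^ 3 * (2 * B)) ^ 2
          - L / h ^ 3 * ((4 * B ^ 2 + 1) * (h ^ 3 * L))) ≤ 1 / n := by
        rw [← hninv]
        refine Real.exp_le_exp.2 ?_
        have e1 : L / h ^ 3 * ((4 * B ^ 2 + 1) * (h ^ 3 * L)) = (4 * B ^ 2 + 1) * l := by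
          rw [← hLsq]; field_simp
        have e2 : (m1 : ℝ) * (L / h ^ 3 * (2 * B)) ^ 2 ≤ 4 * B ^ 2 * l := by
          calc (m1 : ℝ) * (L / h ^ 3 * (2 * B)) ^ 2 ≤ h ^ 6 * (L / h ^ 3 * (2 * B)) ^ 2 :=
                mul_le_mul_of_nonneg_right (by rw [hn6]; linarith) (by positivity)
            _ = 4 * B ^ 2 * l := by rw [← hLsq]; field_simp; ring
        rw [e1]
        linarith
      have h4 : Real.exp (m2 * (1 / h ^ 2 * (2 * B)) ^ 2 - 1 / h ^ 2 * (h ^ 2 * l))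
          ≤ Real.exp (8 * B ^ 2) * (1 / n) := by
        rw [← hninv, ← Real.exp_add]
        refine Real.exp_le_exp.2 ?_
        have e1 : 1 / h ^ 2 * (h ^ 2 * l) = l := by field_simp
        have e2 : (m2 : ℝ) * (1 / h ^ 2 * (2 * B)) ^ 2 ≤ 8 * B ^ 2 := by
          calc (m2 : ℝ) * (1 / h ^ 2 * (2 * B)) ^ 2 ≤ 2 * h ^ 4 * (1 / h ^ 2 * (2 * B)) ^ 2 :=
                mul_le_mul_of_nonneg_right hm2b (by positivity)
            _ = 8 * B ^ 2 := by field_simp; ring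
        rw [e1]
        linarith
      have h5 : 2 * (R : ℝ) + 1 ≤ n := by
        calc 2 * (R : ℝ) + 1 ≤ 3 * (K1 + 1) * (h ^ 3 * L) := by
              have : 1 ≤ (K1 + 1) * (h ^ 3 * L) :=
                one_le_mul_of_one_le_of_one_le (by linarith) hh3L
              linarith
          _ = 3 * (K1 + 1) * L * h ^ 3 := by ring
          _ ≤ h * h ^ 3 := by
            refine mul_le_mul_of_nonneg_right (le_trans ?_ hRl) (by positivity)
            exact mul_le_mul_of_nonneg_left hLl (by positivity)
          _ = h ^ 4 := by ring
          _ ≤ h ^ 6 := pow_le_pow_right₀ h1 (by norm_num)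
          _ = n := hn6
      have h6 : (M : ℝ) * ((2 * R + 1) * Real.exp (-(E + 2 * l))) ≤ 1 / n := by
        calc (M : ℝ) * ((2 * R + 1) * Real.exp (-(E + 2 * l)))
            ≤ Real.exp E * (n * Real.exp (-(E + 2 * l))) := by
              refine mul_le_mul hMle ?_ (by positivity) (Real.exp_pos E).le
              exact mul_le_mul_of_nonneg_right h5 (Real.exp_pos _).le
          _ = 1 / n := by
              rw [← hninv, ← hexpl, ← Real.exp_add, ← Real.exp_add]
              congr 1
              ring
      have h7 : 1 / (M : ℝ) ≤ 2 * (1 / n) := by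
        rw [mul_one_div, div_le_div_iff₀ hM0R hn0]
        linarith
      have h8 : 1 / (n : ℝ) ≤ 1 / h := by
        apply one_div_le_one_div_of_le h0
        rw [← hn6]
        exact le_self_pow₀ h1 (by norm_num)
      have h9 : (2 * ε - K4 / h) / 2 = ε - (10 + 4 * Real.exp (8 * B ^ 2)) * (1 / h) := by
        rw [hK4]; ring
      have h10 : (10 + 4 * Real.exp (8 * B ^ 2)) * (1 / n)
          ≤ (10 + 4 * Real.exp (8 * B ^ 2)) * (1 / h) :=
        mul_le_mul_of_nonneg_left h8 (by positivity)
      rw [h9]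
      linarith
  rwa [hm1]

/-- A uniform bound on the log-size of all codes bounds the log-size of the largest code. -/
lemma log_MstarF_mem_Icc {𝒳 𝒴 : Type*} [Fintype 𝒴] [Nonempty 𝒳] {W1 W2 : 𝒳 → 𝒴 → ℝ}
    {n M : ℕ} {ε U : ℝ} (hε : 0 ≤ ε)
    (hU : ∀ M', FLFExists W1 W2 n M' ε → Real.log M' ≤ U) (hM0 : 0 < M)
    (hM : FLFExists W1 W2 n M ε) :
    Real.log (MstarF W1 W2 n ε) ∈ Set.Icc (Real.log M) U := by
  have hbdd : BddAbove {M' | FLFExists W1 W2 n M' ε} := by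
    refine ⟨⌈Real.exp U⌉₊, fun M' hM' => ?_⟩
    rcases M'.eq_zero_or_pos with rfl | hpos
    · exact Nat.zero_le _
    · have h := (Real.log_le_iff_le_exp (by exact_mod_cast hpos)).1 (hU M' hM')
      exact_mod_cast h.trans (Nat.le_ceil _)
  refine ⟨Real.log_le_log (by exact_mod_cast hM0) ?_,
    hU _ (Nat.sSup_mem ⟨1, flfExists_one W1 W2 n hε⟩ hbdd)⟩
  exact_mod_cast le_csSup hbdd hM

/-- **Theorem 3** (second-order expansion under the per-symbol variance condition):
if `η² Var(i₁|x) + (1-η)² Var(i₂|x) = V` for every `x`, then for `ε ∈ (0, 1/2)`,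
`log M*_f(n,ε) = nC − √(nV) Q⁻¹(2ε) + O(n^{1/3} log n)`. -/
theorem flf_second_order_variance_condition
    (W1 W2 : 𝒳 → 𝒴 → ℝ)
    (hW1 : ∀ x y, 0 ≤ W1 x y) (hW1sum : ∀ x, ∑ y, W1 x y = 1)
    (hW2 : ∀ x y, 0 ≤ W2 x y) (hW2sum : ∀ x, ∑ y, W2 x y = 1)
    (Pstar : 𝒳 → ℝ) (C C1 C2 : ℝ)
    (hPstar : IsDist Pstar) (hPpos : ∀ x, 0 < Pstar x)
    (hCach : min (mutInfo Pstar W1) (mutInfo Pstar W2) = C)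
    (hCmax : ∀ P, IsDist P → min (mutInfo P W1) (mutInfo P W2) ≤ C)
    (hUniq : ∀ P, IsDist P → min (mutInfo P W1) (mutInfo P W2) = C → P = Pstar)
    (hC1 : IsLUB {r | ∃ P, IsDist P ∧ r = mutInfo P W1} C1)
    (hC2 : IsLUB {r | ∃ P, IsDist P ∧ r = mutInfo P W2} C2)
    (hC1gt : C < C1) (hC2gt : C < C2)
    (η : ℝ) (hη : η ∈ Set.Ioo (0 : ℝ) 1)
    (hηeq : ∀ v : 𝒳 → ℝ, ∑ x, v x = 0 →
      η * gradI Pstar W1 v + (1 - η) * gradI Pstar W2 v = 0)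
    (hV1pos : 0 < condInfoVar Pstar W1) (hV2pos : 0 < condInfoVar Pstar W2)
    (V : ℝ)
    (hV : V = η ^ 2 * condInfoVar Pstar W1 + (1 - η) ^ 2 * condInfoVar Pstar W2)
    (hvarcond : ∀ x : 𝒳,
      η ^ 2 * symbVar Pstar W1 x + (1 - η) ^ 2 * symbVar Pstar W2 x = V)
    (ε : ℝ) (hε : ε ∈ Set.Ioo (0 : ℝ) (1 / 2)) :
    ∃ K > (0 : ℝ), ∃ n₀ : ℕ, ∀ n ≥ n₀,
      |Real.log (MstarF W1 W2 n ε) -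
          ((n : ℝ) * C - Real.sqrt ((n : ℝ) * V) * Qinv (2 * ε))|
        ≤ K * (n : ℝ) ^ ((1 : ℝ) / 3) * Real.log n := by
  obtain ⟨hη0, hη1⟩ := hη
  have hc1 : IsChannel W1 := fun x => ⟨hW1 x, hW1sum x⟩
  have hc2 : IsChannel W2 := fun x => ⟨hW2 x, hW2sum x⟩
  have : Nonempty 𝒳 := by
    by_contra h
    rw [not_nonempty_iff] at h
    simpa using hPstar.2
  have : Nonempty 𝒴 := by
    by_contra h
    rw [not_nonempty_iff] at h
    simpa using hW1sum (Classical.arbitrary 𝒳)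
  have hb1 : ∃ P, IsDist P ∧ C < mutInfo P W1 := by
    obtain ⟨_, ⟨P, hP, rfl⟩, h⟩ := (lt_isLUB_iff hC1).1 hC1gt
    exact ⟨P, hP, h⟩
  have hb2 : ∃ P, IsDist P ∧ C < mutInfo P W2 := by
    obtain ⟨_, ⟨P, hP, rfl⟩, h⟩ := (lt_isLUB_iff hC2).1 hC2gt
    exact ⟨P, hP, h⟩
  obtain ⟨hI1, hI2, hD, v, hv, hg1⟩ :=
    maxmin_structure hc1 hc2 hPpos hPstar.2 hCach hCmax hb1 hb2 hηeq
  have hg2 : gradI Pstar W2 v < 0 := by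
    have h1 := mul_pos hη0 hg1
    have h2 := hηeq v hv
    by_contra! h3
    have := mul_nonneg (sub_nonneg.2 hη1.le) h3
    linarith
  have hVpos : 0 < V := by
    rw [hV]
    exact add_pos_of_pos_of_nonneg (by positivity) (by positivity)
  obtain ⟨Ka, hKa, hach⟩ := achievability_asymptotic (W := fun k => cond k W1 W2)
    (Bool.rec hc2 hc1) hPpos hPstar.2 hv (Bool.rec hI2 hI1) hg1 hg2 (hηeq v hv) hD hVpos
    hvarcond hε.1 hε.2
  obtain ⟨Kc, hKc, hconv⟩ :=
    converse_asymptotic hc1 hc2 hPpos hPstar.2 hη0 hη1 hD hVpos hvarcond hε.1 hε.2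
  refine ⟨Ka + Kc, by positivity, ?_⟩
  obtain ⟨n₀, hn₀⟩ := Filter.eventually_atTop.1 (hach.and hconv)
  refine ⟨n₀, fun n hn => ?_⟩
  obtain ⟨⟨M, hM0, hM, hMlog⟩, hU⟩ := hn₀ n hn
  obtain ⟨hlo, hhi⟩ := log_MstarF_mem_Icc hε.1.le hU hM0 hM
  have hr : 0 ≤ sixthRoot n ^ 2 * Real.log n :=
    mul_nonneg (sq_nonneg _) (Real.log_natCast_nonneg n)
  have hra := mul_nonneg hKa.le hr
  have hrc := mul_nonneg hKc.le hr
  rw [mul_assoc, ← sixthRoot_sq, abs_le]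
  constructor <;> linarith
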